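/- arXiv:2005.12851 — 3 statements merged into one kernel-verified Lean document; each statement's English description precedes it below -/
import Mathlib

section
/- Method of upper and lower solutions: let f : ℝ × ℝ × ℝ → ℝ be continuous and T-periodic in its first variable. Suppose α and β are respectively a T-periodic lower solution and a T-periodic upper solution of (φ(x'(t)))' = f(t, x(t), x'(t)), i.e. α, β are continuously differentiable T-periodic functions with sup|α'| < c and sup|β'| < c, t ↦ φ(α'(t)) and t ↦ φ(β'(t)) are continuously differentiable, (φ(α'(t)))' ≥ f(t, α(t), α'(t)) for all t and (φ(β'(t)))' ≤ f(t, β(t), β'(t)) for all t. If α(t) ≤ β(t) for all t, then there exists a T-periodic solution x of (φ(x'(t)))' = f(t, x(t), x'(t)) with α(t) ≤ x(t) ≤ β(t) for all t. -/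
open Real Set MeasureTheory

/-- The relativistic operator `φ(v) = v / √(1 - v²/c²)`. -/
noncomputable def phi (c v : ℝ) : ℝ := v / Real.sqrt (1 - v ^ 2 / c ^ 2)

/-- `x` is a `T`-periodic solution of the relativistic pendulum equation
`(φ(x'))' + a x' + b sin x = p`. -/
def IsPendSol (c a b T : ℝ) (p x : ℝ → ℝ) : Prop :=
  Function.Periodic x T ∧
  ContDiff ℝ 1 x ∧
  (∀ t : ℝ, |deriv x t| < c) ∧
  ContDiff ℝ 1 (fun t : ℝ => phi c (deriv x t)) ∧
  ∀ t : ℝ, deriv (fun τ : ℝ => phi c (deriv x τ)) t + a * deriv x t + b * Real.sin (x t) = p t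

/-- The solvability set `I(p₀)`: the values `s` for which the relativistic pendulum
equation with forcing `p₀ + s` has a `T`-periodic solution. -/
def solvSet (c a b T : ℝ) (p₀ : ℝ → ℝ) : Set ℝ :=
  {s : ℝ | ∃ x : ℝ → ℝ, IsPendSol c a b T (fun t => p₀ t + s) x}


open Filter Topology

namespace ULS

/-- Vector field of the first order system. -/
def vf (ψ : ℝ → ℝ) (G : ℝ → ℝ → ℝ → ℝ) (t : ℝ) (z : ℝ × ℝ) : ℝ × ℝ := (ψ z.2, G t z.1 z.2)

lemma vf_lip {ψ : ℝ → ℝ} {G : ℝ → ℝ → ℝ → ℝ} {K : ℝ} (hK : 0 < K)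
    (hψl : ∀ a b, |ψ a - ψ b| ≤ |a - b|)
    (hGl : ∀ t x y x' y', |G t x y - G t x' y'| ≤ K * (|x - x'| + |y - y'|)) (t : ℝ) :
    LipschitzWith (Real.toNNReal (2 * K + 1)) (vf ψ G t) := by
  apply LipschitzWith.of_dist_le_mul
  rintro ⟨x, y⟩ ⟨x', y'⟩
  rw [Real.coe_toNNReal _ (by positivity)]
  simp only [vf, Prod.dist_eq, Real.dist_eq]
  have h1 := hψl y y'
  have h2 := hGl t x y x' y'
  have h3 := le_max_left |x - x'| |y - y'|
  have h4 := le_max_right |x - x'| |y - y'|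
  have h5 := abs_nonneg (x - x')
  apply max_le <;> nlinarith

lemma exists_flow {ψ : ℝ → ℝ} {G : ℝ → ℝ → ℝ → ℝ} {K c C T : ℝ} (hT : 0 < T) (hK : 0 < K)
    (hc : 0 < c) (hC : 0 < C)
    (hψl : ∀ a b, |ψ a - ψ b| ≤ |a - b|) (hψb : ∀ a, |ψ a| ≤ c)
    (hGc : Continuous fun q : ℝ × ℝ × ℝ => G q.1 q.2.1 q.2.2)
    (hGb : ∀ t x y, |G t x y| ≤ C)
    (hGl : ∀ t x y x' y', |G t x y - G t x' y'| ≤ K * (|x - x'| + |y - y'|)) (p : ℝ × ℝ) :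
    ∃ z : ℝ → ℝ × ℝ, z 0 = p ∧ ∀ t ∈ Icc 0 T, HasDerivAt z (vf ψ G t (z t)) t := by
  have h0 : (0 : ℝ) ∈ Icc (-T) (2 * T) := ⟨by linarith, by linarith⟩
  have hPL : IsPicardLindelof (vf ψ G) (⟨0, h0⟩ : Icc (-T) (2 * T)) p
      (Real.toNNReal ((c + C) * (2 * T))) 0 (Real.toNNReal (c + C)) (Real.toNNReal (2 * K + 1)) := by
    refine ⟨fun t _ => (vf_lip hK hψl hGl t).lipschitzOnWith, ?_, ?_, ?_⟩
    · intro x _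
      apply Continuous.continuousOn
      refine Continuous.prodMk continuous_const ?_
      exact hGc.comp (by fun_prop : Continuous fun t : ℝ => (t, x.1, x.2))
    · intro t _ x _
      rw [Real.coe_toNNReal _ (by positivity)]
      simp only [vf, Prod.norm_def, Real.norm_eq_abs]
      have := hψb x.2
      have := hGb t x.1 x.2
      apply max_le <;> linarith
    · rw [Real.coe_toNNReal _ (by positivity), Real.coe_toNNReal _ (by positivity)]
      simp only [NNReal.coe_zero, sub_zero]
      rw [max_eq_left (by linarith)]
  obtain ⟨z, hz0, hz⟩ := hPL.exists_eq_forall_mem_Icc_hasDerivWithinAt₀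
  refine ⟨z, hz0, fun t ht => (hz t ⟨by linarith [ht.1], by linarith [ht.2]⟩).hasDerivAt ?_⟩
  exact Icc_mem_nhds (by linarith [ht.1]) (by linarith [ht.2])

lemma mono_step {ψ : ℝ → ℝ} {G : ℝ → ℝ → ℝ → ℝ} {K T : ℝ} (hT : 0 < T)
    (hψm : StrictMono ψ)
    (hGl : ∀ t x y x' y', |G t x y - G t x' y'| ≤ K * (|x - x'| + |y - y'|))
    (hGm : ∀ t x x' y, x ≤ x' → G t x y ≤ G t x' y)
    {z w : ℝ → ℝ × ℝ} (hz : ∀ t ∈ Icc 0 T, HasDerivAt z (vf ψ G t (z t)) t)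
    (hw : ∀ t ∈ Icc 0 T, HasDerivAt w (vf ψ G t (w t)) t)
    (h1 : (z 0).1 = (w 0).1) (h2 : (z 0).2 < (w 0).2) : (z T).1 < (w T).1 := by
  have hz1 : ∀ t ∈ Icc 0 T, HasDerivAt (fun s => (z s).1) (ψ (z t).2) t := fun t ht => (hz t ht).fst
  have hz2 : ∀ t ∈ Icc 0 T, HasDerivAt (fun s => (z s).2) (G t (z t).1 (z t).2) t :=
    fun t ht => (hz t ht).snd
  have hw1 : ∀ t ∈ Icc 0 T, HasDerivAt (fun s => (w s).1) (ψ (w t).2) t := fun t ht => (hw t ht).fst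
  have hw2 : ∀ t ∈ Icc 0 T, HasDerivAt (fun s => (w s).2) (G t (w t).1 (w t).2) t :=
    fun t ht => (hw t ht).snd
  have hcE : ContinuousOn (fun t => (w t).2 - (z t).2) (Icc 0 T) := fun t ht =>
    ((hw2 t ht).continuousAt.sub (hz2 t ht).continuousAt).continuousWithinAt
  -- positivity of the second component of the difference
  have key : ∀ t ∈ Icc 0 T, 0 < (w t).2 - (z t).2 := by
    by_contra hcon
    push Not at hcon
    obtain ⟨t1, ht1, hle⟩ := hcon
    set S : Set ℝ := Icc 0 T ∩ (fun t => (w t).2 - (z t).2) ⁻¹' Iic 0 with hS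
    have hSc : IsCompact S := by
      apply IsCompact.of_isClosed_subset isCompact_Icc _ inter_subset_left
      exact hcE.preimage_isClosed_of_isClosed isClosed_Icc isClosed_Iic
    obtain ⟨τ, hτS, hτ⟩ := hSc.exists_isLeast ⟨t1, ht1, hle⟩
    have hτ0 : 0 ≤ τ := hτS.1.1
    have hpos : ∀ t ∈ Ico 0 τ, 0 < (w t).2 - (z t).2 := by
      intro t ht
      by_contra hn
      have : t ∈ S := ⟨⟨ht.1, by linarith [ht.2, hτS.1.2]⟩, by simpa using hn⟩
      linarith [hτ this, ht.2]
    have hsub : ∀ t, t ∈ Icc 0 τ → t ∈ Icc 0 T := fun t ht => ⟨ht.1, ht.2.trans hτS.1.2⟩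
    have hD : MonotoneOn (fun t => (w t).1 - (z t).1) (Icc 0 τ) := by
      apply monotoneOn_of_deriv_nonneg (convex_Icc _ _)
      · exact fun t ht => ((hw1 t (hsub t ht)).continuousAt.sub
          (hz1 t (hsub t ht)).continuousAt).continuousWithinAt
      · intro t ht
        rw [interior_Icc] at ht
        have ht' := hsub t (Ioo_subset_Icc_self ht)
        exact ((hw1 t ht').sub (hz1 t ht')).differentiableAt.differentiableWithinAt
      · intro t ht
        rw [interior_Icc] at ht
        have ht' := hsub t (Ioo_subset_Icc_self ht)
        rw [((hw1 t ht').fun_sub (hz1 t ht')).deriv]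
        have := hψm (sub_pos.1 (hpos t ⟨ht.1.le, ht.2⟩))
        linarith
    have hE : MonotoneOn (fun t => ((w t).2 - (z t).2) * Real.exp (K * t)) (Icc 0 τ) := by
      have hder : ∀ t ∈ Icc 0 τ, HasDerivAt (fun t => ((w t).2 - (z t).2) * Real.exp (K * t))
          ((G t (w t).1 (w t).2 - G t (z t).1 (z t).2) * Real.exp (K * t) +
            ((w t).2 - (z t).2) * (Real.exp (K * t) * (K * 1))) t := by
        intro t ht
        exact ((hw2 t (hsub t ht)).sub (hz2 t (hsub t ht))).mul
          (((hasDerivAt_id t).const_mul K).exp)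
      apply monotoneOn_of_deriv_nonneg (convex_Icc _ _)
      · exact fun t ht => (hder t ht).continuousAt.continuousWithinAt
      · intro t ht
        rw [interior_Icc] at ht
        exact (hder t (Ioo_subset_Icc_self ht)).differentiableAt.differentiableWithinAt
      · intro t ht
        rw [interior_Icc] at ht
        have ht' := Ioo_subset_Icc_self ht
        rw [(hder t ht').deriv]
        have hd := hD (left_mem_Icc.2 hτ0) ht' ht'.1
        simp only [h1, sub_self] at hd
        have he := hpos t ⟨ht.1.le, ht.2⟩
        have a1 := hGm t (z t).1 (w t).1 (w t).2 (by linarith)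
        have a2 := (abs_le.1 (hGl t (z t).1 (w t).2 (z t).1 (z t).2)).1
        rw [sub_self, abs_zero, zero_add, abs_of_pos he] at a2
        have : 0 ≤ ((G t (w t).1 (w t).2 - G t (z t).1 (z t).2) + K * ((w t).2 - (z t).2)) *
          Real.exp (K * t) := mul_nonneg (by linarith) (Real.exp_pos _).le
        linarith
    have := hE (left_mem_Icc.2 hτ0) (right_mem_Icc.2 hτ0) hτ0
    simp only [mul_zero, Real.exp_zero, mul_one] at this
    have h3 : (w τ).2 - (z τ).2 ≤ 0 := hτS.2
    have := mul_nonpos_of_nonpos_of_nonneg h3 (Real.exp_pos (K * τ)).le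
    linarith
  have hD : StrictMonoOn (fun t => (w t).1 - (z t).1) (Icc 0 T) := by
    apply strictMonoOn_of_deriv_pos (convex_Icc _ _)
    · exact fun t ht => ((hw1 t ht).continuousAt.sub (hz1 t ht).continuousAt).continuousWithinAt
    · intro t ht
      rw [interior_Icc] at ht
      have ht' := Ioo_subset_Icc_self ht
      rw [((hw1 t ht').fun_sub (hz1 t ht')).deriv]
      have := hψm (sub_pos.1 (key t ht'))
      linarith
  have := hD (left_mem_Icc.2 hT.le) (right_mem_Icc.2 hT.le) hT
  simp only [h1, sub_self] at this
  linarith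

lemma abs_sub_le_of_deriv {u u' : ℝ → ℝ} {T C : ℝ} (h : ∀ t ∈ Icc 0 T, HasDerivAt u (u' t) t)
    (hb : ∀ t ∈ Icc 0 T, |u' t| ≤ C) (s t : ℝ) (hs : s ∈ Icc 0 T) (ht : t ∈ Icc 0 T) :
    |u t - u s| ≤ C * |t - s| := by
  have := (convex_Icc 0 T).norm_image_sub_le_of_norm_hasDerivWithin_le
    (fun x hx => (h x hx).hasDerivWithinAt) (C := C) hb hs ht
  simpa using this

lemma nonneg_diff {u u' : ℝ → ℝ} {T : ℝ} (hT : 0 < T) (h : ∀ t ∈ Icc 0 T, HasDerivAt u (u' t) t)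
    (hb : ∀ t ∈ Icc 0 T, 0 ≤ u' t) : u 0 ≤ u T := by
  have : MonotoneOn u (Icc 0 T) := by
    apply monotoneOn_of_deriv_nonneg (convex_Icc _ _)
    · exact fun t ht => (h t ht).continuousAt.continuousWithinAt
    · intro t ht
      rw [interior_Icc] at ht
      exact (h t (Ioo_subset_Icc_self ht)).differentiableAt.differentiableWithinAt
    · intro t ht
      rw [interior_Icc] at ht
      rw [(h t (Ioo_subset_Icc_self ht)).deriv]
      exact hb t (Ioo_subset_Icc_self ht)
  exact this (left_mem_Icc.2 hT.le) (right_mem_Icc.2 hT.le) hT.le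

lemma nonpos_diff {u u' : ℝ → ℝ} {T : ℝ} (hT : 0 < T) (h : ∀ t ∈ Icc 0 T, HasDerivAt u (u' t) t)
    (hb : ∀ t ∈ Icc 0 T, u' t ≤ 0) : u T ≤ u 0 := by
  have := nonneg_diff (u := fun t => - u t) (u' := fun t => - u' t) hT (fun t ht => (h t ht).fun_neg)
    (fun t ht => by linarith [hb t ht])
  simpa using this

/-- Periodic boundary value problem for a monotone right-hand side, by double shooting. -/
lemma exists_bvp {ψ : ℝ → ℝ} {G : ℝ → ℝ → ℝ → ℝ} {K c C T R : ℝ} (hT : 0 < T) (hK : 0 < K)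
    (hc : 0 < c) (hC : 0 < C) (hR : 0 < R) (hψm : StrictMono ψ) (hψ0 : ψ 0 = 0)
    (hψl : ∀ a b, |ψ a - ψ b| ≤ |a - b|) (hψb : ∀ a, |ψ a| ≤ c)
    (hGc : Continuous fun q : ℝ × ℝ × ℝ => G q.1 q.2.1 q.2.2)
    (hGb : ∀ t x y, |G t x y| ≤ C)
    (hGl : ∀ t x y x' y', |G t x y - G t x' y'| ≤ K * (|x - x'| + |y - y'|))
    (hGm : ∀ t x x' y, x ≤ x' → G t x y ≤ G t x' y)
    (hGp : ∀ t x y, R ≤ x → 0 ≤ G t x y) (hGn : ∀ t x y, x ≤ -R → G t x y ≤ 0) :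
    ∃ z : ℝ → ℝ × ℝ, z 0 = z T ∧ ∀ t ∈ Icc 0 T, HasDerivAt z (vf ψ G t (z t)) t := by
  choose Z hZ0 hZ using exists_flow hT hK hc hC hψl hψb hGc hGb hGl
  have hZ1 : ∀ p, ∀ t ∈ Icc 0 T, HasDerivAt (fun s => (Z p s).1) (ψ (Z p t).2) t :=
    fun p t ht => (hZ p t ht).fst
  have hZ2 : ∀ p, ∀ t ∈ Icc 0 T, HasDerivAt (fun s => (Z p s).2) (G t (Z p t).1 (Z p t).2) t :=
    fun p t ht => (hZ p t ht).snd
  have m0 : (0 : ℝ) ∈ Icc 0 T := left_mem_Icc.2 hT.le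
  have mT : T ∈ Icc 0 T := right_mem_Icc.2 hT.le
  have hcont : Continuous fun p => Z p T := by
    have : LipschitzWith (Real.toNNReal (Real.exp ((Real.toNNReal (2 * K + 1) : ℝ) * (T - 0))))
        (fun p => Z p T) := by
      apply LipschitzWith.of_dist_le_mul
      intro p q
      rw [Real.coe_toNNReal _ (Real.exp_pos _).le, mul_comm]
      refine dist_le_of_trajectories_ODE (v := vf ψ G) (a := 0) (b := T)
        (fun t => vf_lip hK hψl hGl t)
        (fun t ht => (hZ p t ht).continuousAt.continuousWithinAt)
        (fun t ht => (hZ p t (Ico_subset_Icc_self ht)).hasDerivWithinAt)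
        (fun t ht => (hZ q t ht).continuousAt.continuousWithinAt)
        (fun t ht => (hZ q t (Ico_subset_Icc_self ht)).hasDerivWithinAt) ?_ T mT
      rw [hZ0, hZ0]
    exact this.continuous
  have hmono : ∀ s η η', η < η' → (Z (s, η) T).1 < (Z (s, η') T).1 := by
    intro s η η' h
    exact mono_step hT hψm hGl hGm (hZ _) (hZ _) (by simp [hZ0]) (by simpa [hZ0] using h)
  have hYex : ∀ s, ∃ η, (Z (s, η) T).1 = s := by
    intro s
    have hc1 : Continuous fun η => (Z (s, η) T).1 :=
      continuous_fst.comp (hcont.comp (by fun_prop))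
    have up : s ≤ (Z (s, C * T) T).1 := by
      have := nonneg_diff hT (hZ1 (s, C * T)) (fun t ht => ?_)
      · simpa [hZ0] using this
      · rw [← hψ0]
        apply hψm.monotone
        have := abs_sub_le_of_deriv (hZ2 (s, C * T)) (fun t _ => hGb _ _ _) 0 t m0 ht
        simp only [hZ0, sub_zero, abs_of_nonneg ht.1] at this
        have h2 := (abs_le.1 this).1
        have := mul_le_mul_of_nonneg_left ht.2 hC.le
        linarith
    have lo : (Z (s, -(C * T)) T).1 ≤ s := by
      have := nonpos_diff hT (hZ1 (s, -(C * T))) (fun t ht => ?_)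
      · simpa [hZ0] using this
      · rw [← hψ0]
        apply hψm.monotone
        have := abs_sub_le_of_deriv (hZ2 (s, -(C * T))) (fun t _ => hGb _ _ _) 0 t m0 ht
        simp only [hZ0, sub_zero, abs_of_nonneg ht.1] at this
        have h2 := (abs_le.1 this).2
        have := mul_le_mul_of_nonneg_left ht.2 hC.le
        linarith
    have hCT : 0 ≤ C * T := by positivity
    obtain ⟨η, _, h⟩ := intermediate_value_Icc (by linarith : -(C * T) ≤ C * T) hc1.continuousOn
      ⟨lo, up⟩
    exact ⟨η, h⟩
  choose Y hY using hYex
  have hYc : Continuous Y := by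
    rw [continuous_iff_continuousAt]
    intro s
    rw [ContinuousAt, Metric.tendsto_nhds]
    intro ε hε
    have c1 : ∀ a, Continuous fun s => (Z (s, a) T).1 - s := fun a =>
      (continuous_fst.comp (hcont.comp (by fun_prop))).sub continuous_id
    have e1 : ∀ᶠ s' in 𝓝 s, (Z (s', Y s - ε) T).1 - s' < 0 := by
      apply (c1 (Y s - ε)).continuousAt.eventually_lt continuousAt_const
      have := hmono s (Y s - ε) (Y s) (by linarith)
      rw [hY] at this
      linarith
    have e2 : ∀ᶠ s' in 𝓝 s, 0 < (Z (s', Y s + ε) T).1 - s' := by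
      apply continuousAt_const.eventually_lt (c1 (Y s + ε)).continuousAt
      have := hmono s (Y s) (Y s + ε) (by linarith)
      rw [hY] at this
      linarith
    filter_upwards [e1, e2] with s' h1 h2
    have hm : StrictMono fun η => (Z (s', η) T).1 := fun a b h => hmono s' a b h
    rw [Real.dist_eq, abs_lt]
    constructor
    · have := hm.lt_iff_lt.1 (show (Z (s', Y s - ε) T).1 < (Z (s', Y s') T).1 by rw [hY]; linarith)
      linarith
    · have := hm.lt_iff_lt.1 (show (Z (s', Y s') T).1 < (Z (s', Y s + ε) T).1 by rw [hY]; linarith)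
      linarith
  have hxb : ∀ s η, ∀ t ∈ Icc 0 T, |(Z (s, η) t).1 - s| ≤ c * T := by
    intro s η t ht
    have := abs_sub_le_of_deriv (hZ1 (s, η)) (fun t _ => hψb _) 0 t m0 ht
    simp only [hZ0, sub_zero, abs_of_nonneg ht.1] at this
    exact this.trans (mul_le_mul_of_nonneg_left ht.2 hc.le)
  have hΨc : Continuous fun s => (Z (s, Y s) T).2 - Y s :=
    (continuous_snd.comp (hcont.comp (by fun_prop))).sub hYc
  have up : 0 ≤ (Z (R + c * T, Y (R + c * T)) T).2 - Y (R + c * T) := by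
    have := nonneg_diff hT (hZ2 (R + c * T, Y (R + c * T))) (fun t ht => hGp _ _ _ ?_)
    · simpa [hZ0] using this
    · linarith [(abs_le.1 (hxb (R + c * T) (Y (R + c * T)) t ht)).1]
  have lo : (Z (-(R + c * T), Y (-(R + c * T))) T).2 - Y (-(R + c * T)) ≤ 0 := by
    have := nonpos_diff hT (hZ2 (-(R + c * T), Y (-(R + c * T)))) (fun t ht => hGn _ _ _ ?_)
    · simpa [hZ0] using this
    · linarith [(abs_le.1 (hxb (-(R + c * T)) (Y (-(R + c * T))) t ht)).2]
  have hRT : 0 ≤ R + c * T := by positivity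
  obtain ⟨s, _, hs⟩ := intermediate_value_Icc (by linarith : -(R + c * T) ≤ R + c * T)
    hΨc.continuousOn ⟨lo, up⟩
  refine ⟨Z (s, Y s), ?_, hZ _⟩
  rw [hZ0]
  apply Prod.ext
  · exact (hY s).symm
  · simp only at hs ⊢
    linarith

/-- `x' = ψ(y)`, `y' = d`, all `T`-periodic. -/
structure PSol (ψ : ℝ → ℝ) (T : ℝ) (x y d : ℝ → ℝ) : Prop where
  px : Function.Periodic x T
  py : Function.Periodic y T
  dx : ∀ t, HasDerivAt x (ψ (y t)) t
  dy : ∀ t, HasDerivAt y (d t) t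

lemma periodic_extend {V : ℝ → ℝ × ℝ → ℝ × ℝ} {T : ℝ} (hT : 0 < T) (hV : Function.Periodic V T)
    {z : ℝ → ℝ × ℝ} (hz0 : z 0 = z T) (hz : ∀ t ∈ Icc 0 T, HasDerivAt z (V t (z t)) t) :
    ∃ w : ℝ → ℝ × ℝ, Function.Periodic w T ∧ ∀ t, HasDerivAt w (V t (w t)) t := by
  set w : ℝ → ℝ × ℝ := fun t => z (t - ⌊t / T⌋ * T) with hwdef
  have hw : ∀ n : ℤ, ∀ t ∈ Icc (n * T) ((n + 1) * T), w t = z (t - n * T) := by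
    intro n t ht
    rcases ht.2.lt_or_eq with h | h
    · have : ⌊t / T⌋ = n := by
        rw [Int.floor_eq_iff]
        exact ⟨by rw [le_div_iff₀ hT]; exact ht.1, by rw [div_lt_iff₀ hT]; exact h⟩
      simp only [hwdef, this]
    · have : ⌊t / T⌋ = n + 1 := by
        rw [h, mul_div_cancel_right₀ _ hT.ne']
        exact_mod_cast Int.floor_intCast (n + 1)
      simp only [hwdef, this]
      push_cast
      rw [h, sub_self, hz0]
      congr 1
      ring
  have hd : ∀ n : ℤ, ∀ t ∈ Icc (n * T) ((n + 1) * T),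
      HasDerivWithinAt w (V t (w t)) (Icc (n * T) ((n + 1) * T)) t := by
    intro n t ht
    have h1 : t - n * T ∈ Icc 0 T := ⟨by linarith [ht.1], by linarith [ht.2]⟩
    have h2 := hz _ h1
    rw [hV.sub_int_mul_eq, ← hw n t ht] at h2
    exact ((h2.comp_sub_const t (n * T)).hasDerivWithinAt).congr (fun s hs => hw n s hs) (hw n t ht)
  refine ⟨w, ?_, ?_⟩
  · intro t
    have : ⌊(t + T) / T⌋ = ⌊t / T⌋ + 1 := by
      rw [add_div, div_self hT.ne', Int.floor_add_one]
    simp only [hwdef, this]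
    congr 1
    push_cast
    ring
  · intro t
    set n := ⌊t / T⌋ with hn
    have h1 : n * T ≤ t := by rw [← le_div_iff₀ hT]; exact Int.floor_le _
    have h2 : t < (n + 1) * T := by rw [← div_lt_iff₀ hT]; exact Int.lt_floor_add_one _
    rcases h1.lt_or_eq with h | h
    · exact (hd n t ⟨h1, h2.le⟩).hasDerivAt (Icc_mem_nhds h h2)
    · have a := hd n t ⟨h1, h2.le⟩
      have b := hd (n - 1) t ⟨by push_cast; linarith, by push_cast; linarith⟩
      refine (a.union b).hasDerivAt ?_
      have : Icc ((n - 1) * T) ((n + 1) * T) ∈ 𝓝 t := Icc_mem_nhds (by linarith) h2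
      filter_upwards [this] with s hs
      rcases le_total t s with h' | h'
      · left; exact ⟨by linarith, hs.2⟩
      · right; push_cast; exact ⟨hs.1, by linarith⟩

/-- Comparison principle. -/
lemma compare {ψ : ℝ → ℝ} {T : ℝ} (hT : 0 < T) (hψm : StrictMono ψ)
    {x₁ y₁ d₁ x₂ y₂ d₂ : ℝ → ℝ} (h₁ : PSol ψ T x₁ y₁ d₁) (h₂ : PSol ψ T x₂ y₂ d₂)
    (h : ∀ t, x₂ t < x₁ t → y₁ t = y₂ t → d₂ t < d₁ t) (t : ℝ) : x₁ t ≤ x₂ t := by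
  set D : ℝ → ℝ := fun t => x₁ t - x₂ t with hD
  have hDd : ∀ t, HasDerivAt D (ψ (y₁ t) - ψ (y₂ t)) t := fun t => (h₁.dx t).sub (h₂.dx t)
  have hDc : Continuous D := continuous_iff_continuousAt.2 fun t => (hDd t).continuousAt
  have hDp : Function.Periodic D T := h₁.px.sub h₂.px
  obtain ⟨m, ⟨t0, rfl⟩, hm⟩ := (hDp.compact_of_continuous hT.ne' hDc).exists_isGreatest
    (range_nonempty D)
  have hmax : ∀ s, D s ≤ D t0 := fun s => hm ⟨s, rfl⟩
  by_contra hcon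
  push Not at hcon
  have hpos : 0 < D t0 := by
    have := hmax t
    simp only [hD] at this ⊢
    linarith
  have hloc : IsLocalMax D t0 := Filter.Eventually.of_forall hmax
  have hz := hloc.hasDerivAt_eq_zero (hDd t0)
  have hy : y₁ t0 = y₂ t0 := hψm.injective (by linarith)
  have hd := h t0 (by simp only [hD] at hpos; linarith) hy
  have hE : HasDerivAt (fun t => y₁ t - y₂ t) (d₁ t0 - d₂ t0) t0 := (h₁.dy t0).sub (h₂.dy t0)
  have hs := (hasDerivAt_iff_tendsto_slope.1 hE).eventually_const_lt (sub_pos.2 hd)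
  have hs' : ∀ᶠ s in 𝓝[>] t0, 0 < slope (fun t => y₁ t - y₂ t) t0 s :=
    hs.filter_mono (nhdsWithin_mono _ fun s hs => (ne_of_gt hs))
  obtain ⟨b, hb, hbs⟩ := (mem_nhdsGT_iff_exists_Ioo_subset).1 hs'
  have hb' : t0 < b := hb
  have hsm : StrictMonoOn D (Icc t0 b) := by
    apply strictMonoOn_of_deriv_pos (convex_Icc _ _) hDc.continuousOn
    intro s hs
    rw [interior_Icc] at hs
    rw [(hDd s).deriv]
    have h3 : 0 < slope (fun t => y₁ t - y₂ t) t0 s := hbs hs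
    rw [slope_def_field, hy, sub_self, sub_zero] at h3
    have h4 : 0 < y₁ s - y₂ s := by
      have := mul_pos h3 (sub_pos.2 hs.1)
      rwa [div_mul_cancel₀ _ (sub_pos.2 hs.1).ne'] at this
    have := hψm (sub_pos.1 h4)
    linarith
  have := hsm (left_mem_Icc.2 hb'.le) (right_mem_Icc.2 hb'.le) hb'
  linarith [hmax b]

lemma exists_psol_mono {ψ : ℝ → ℝ} {G : ℝ → ℝ → ℝ → ℝ} {K c C T R : ℝ} (hT : 0 < T) (hK : 0 < K)
    (hc : 0 < c) (hC : 0 < C) (hR : 0 < R) (hψm : StrictMono ψ) (hψ0 : ψ 0 = 0)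
    (hψl : ∀ a b, |ψ a - ψ b| ≤ |a - b|) (hψb : ∀ a, |ψ a| ≤ c)
    (hGc : Continuous fun q : ℝ × ℝ × ℝ => G q.1 q.2.1 q.2.2)
    (hGT : ∀ t x y, G (t + T) x y = G t x y)
    (hGb : ∀ t x y, |G t x y| ≤ C)
    (hGl : ∀ t x y x' y', |G t x y - G t x' y'| ≤ K * (|x - x'| + |y - y'|))
    (hGm : ∀ t x x' y, x ≤ x' → G t x y ≤ G t x' y)
    (hGp : ∀ t x y, R ≤ x → 0 ≤ G t x y) (hGn : ∀ t x y, x ≤ -R → G t x y ≤ 0) :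
    ∃ x y : ℝ → ℝ, PSol ψ T x y (fun t => G t (x t) (y t)) := by
  obtain ⟨z, hz0, hz⟩ := exists_bvp hT hK hc hC hR hψm hψ0 hψl hψb hGc hGb hGl hGm hGp hGn
  have hV : Function.Periodic (vf ψ G) T := by
    intro t
    funext p
    simp [vf, hGT]
  obtain ⟨w, hwp, hw⟩ := periodic_extend hT hV hz0 hz
  exact ⟨fun t => (w t).1, fun t => (w t).2, fun t => by simp only [hwp t],
    fun t => by simp only [hwp t], fun t => (hw t).fst, fun t => (hw t).snd⟩

lemma abs_sub_le_of_deriv' {u u' : ℝ → ℝ} {C : ℝ} (h : ∀ t, HasDerivAt u (u' t) t)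
    (hb : ∀ t, |u' t| ≤ C) (s t : ℝ) : |u t - u s| ≤ C * |t - s| := by
  have := convex_univ.norm_image_sub_le_of_norm_hasDerivWithin_le (s := univ)
    (fun x _ => (h x).hasDerivWithinAt) (C := C) (fun x _ => hb x) (mem_univ s) (mem_univ t)
  simpa using this

lemma PSol.y_bound {ψ : ℝ → ℝ} {T C : ℝ} (hT : 0 < T) (hψm : StrictMono ψ) (hψ0 : ψ 0 = 0)
    (hC : 0 < C) {x y d : ℝ → ℝ} (h : PSol ψ T x y d) (hd : ∀ t, |d t| ≤ C) (t : ℝ) :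
    |y t| ≤ C * T := by
  obtain ⟨s, hs, h0⟩ := exists_hasDerivAt_eq_zero (f := x) (f' := fun t => ψ (y t))
    (by linarith : t < t + T)
    (fun s _ => (h.dx s).continuousAt.continuousWithinAt) (h.px t).symm (fun s _ => h.dx s)
  have hy : y s = 0 := hψm.injective (by rw [h0, hψ0])
  have := abs_sub_le_of_deriv' h.dy hd s t
  rw [hy, sub_zero] at this
  refine this.trans (mul_le_mul_of_nonneg_left ?_ hC.le)
  rw [abs_le]
  constructor <;> linarith [hs.1, hs.2]

/-- Extraction of a pointwise convergent subsequence from bounded equi-Lipschitz functions. -/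
lemma extract {L B : ℝ} (hL : 0 < L) (z : ℕ → ℝ → ℝ × ℝ) (hB : ∀ n t, ‖z n t‖ ≤ B)
    (hz : ∀ n s t, dist (z n s) (z n t) ≤ L * |s - t|) :
    ∃ k : ℕ → ℕ, StrictMono k ∧ ∃ w : ℝ → ℝ × ℝ, ∀ t, Tendsto (fun n => z (k n) t) atTop (𝓝 (w t)) := by
  have hcpt : IsCompact (Set.pi univ fun _ : ℚ => Metric.closedBall (0 : ℝ × ℝ) B) :=
    isCompact_univ_pi fun _ => isCompact_closedBall _ _
  obtain ⟨w, _, k, hk, hw⟩ := hcpt.tendsto_subseq (x := fun n (q : ℚ) => z n q)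
    (fun n q _ => by simpa using hB n q)
  rw [tendsto_pi_nhds] at hw
  refine ⟨k, hk, ?_⟩
  have : ∀ t, ∃ a, Tendsto (fun n => z (k n) t) atTop (𝓝 a) := by
    intro t
    apply cauchySeq_tendsto_of_complete
    rw [Metric.cauchySeq_iff]
    intro ε hε
    have hδ : 0 < ε / (4 * L) := by positivity
    obtain ⟨q, hq1, hq2⟩ := exists_rat_btwn (show t < t + ε / (4 * L) by linarith)
    obtain ⟨N, hN⟩ := Metric.cauchySeq_iff.1 (hw q).cauchySeq (ε / 2) (by positivity)
    refine ⟨N, fun m hm n hn => ?_⟩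
    have h1 := hz (k m) t q
    have h2 := hz (k n) q t
    have h3 : dist (z (k m) q) (z (k n) q) < ε / 2 := hN m hm n hn
    have h4 := dist_triangle4 (z (k m) t) (z (k m) q) (z (k n) q) (z (k n) t)
    rw [abs_of_neg (by linarith)] at h1
    rw [abs_of_pos (by linarith)] at h2
    have h5 : L * (q - t) < L * (ε / (4 * L)) := mul_lt_mul_of_pos_left (by linarith) hL
    have h6 : L * (ε / (4 * L)) = ε / 4 := by field_simp
    linarith
  choose w' hw' using this
  exact ⟨w', hw'⟩

lemma limit_deriv {u v : ℕ → ℝ → ℝ} {u0 v0 : ℝ → ℝ} {C : ℝ} (h : ∀ n t, HasDerivAt (u n) (v n t) t)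
    (hv : ∀ n, Continuous (v n)) (hb : ∀ n t, |v n t| ≤ C)
    (hu0 : ∀ t, Tendsto (fun n => u n t) atTop (𝓝 (u0 t)))
    (hv0 : ∀ t, Tendsto (fun n => v n t) atTop (𝓝 (v0 t))) (hvc : Continuous v0) (t : ℝ) :
    HasDerivAt u0 (v0 t) t := by
  have key : ∀ t, u0 t = u0 0 + ∫ s in (0 : ℝ)..t, v0 s := by
    intro t
    have h1 : ∀ n, ∫ s in (0 : ℝ)..t, v n s = u n t - u n 0 := fun n =>
      intervalIntegral.integral_eq_sub_of_hasDerivAt (fun s _ => h n s)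
        ((hv n).intervalIntegrable _ _)
    have h2 : Tendsto (fun n => ∫ s in (0 : ℝ)..t, v n s) atTop (𝓝 (∫ s in (0 : ℝ)..t, v0 s)) := by
      apply intervalIntegral.tendsto_integral_filter_of_dominated_convergence (fun _ => C)
      · exact Filter.Eventually.of_forall fun n => (hv n).aestronglyMeasurable
      · exact Filter.Eventually.of_forall fun n => Filter.Eventually.of_forall fun s _ => hb n s
      · exact intervalIntegrable_const
      · exact Filter.Eventually.of_forall fun s _ => hv0 s
    have h3 := tendsto_nhds_unique (h2.congr h1) ((hu0 t).sub (hu0 0))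
    linarith
  have : u0 = fun t => u0 0 + ∫ s in (0 : ℝ)..t, v0 s := funext key
  rw [this]
  exact (intervalIntegral.integral_hasDerivAt_right (hvc.intervalIntegrable _ _)
    (hvc.stronglyMeasurableAtFilter _ _) hvc.continuousAt).const_add _

/-- Compactness of periodic solutions. -/
lemma psol_limit {ψ : ℝ → ℝ} {T c C R : ℝ} (hT : 0 < T) (hc : 0 < c) (hC : 0 < C)
    (hψm : StrictMono ψ) (hψ0 : ψ 0 = 0) (hψc : Continuous ψ) (hψb : ∀ a, |ψ a| ≤ c)
    (x y d : ℕ → ℝ → ℝ) (h : ∀ n, PSol ψ T (x n) (y n) (d n)) (hx : ∀ n t, |x n t| ≤ R)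
    (hdc : ∀ n, Continuous (d n)) (hd : ∀ n t, |d n t| ≤ C) :
    ∃ k : ℕ → ℕ, StrictMono k ∧ ∃ X Y : ℝ → ℝ, Continuous X ∧ Continuous Y ∧
      (∀ t, Tendsto (fun n => x (k n) t) atTop (𝓝 (X t))) ∧
      (∀ t, Tendsto (fun n => y (k n) t) atTop (𝓝 (Y t))) ∧
      ∀ D : ℝ → ℝ, Continuous D → (∀ t, Tendsto (fun n => d (k n) t) atTop (𝓝 (D t))) →
        PSol ψ T X Y D := by
  have hlx : ∀ n s t, |x n s - x n t| ≤ c * |s - t| := fun n s t =>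
    abs_sub_le_of_deriv' (h n).dx (fun _ => hψb _) t s
  have hly : ∀ n s t, |y n s - y n t| ≤ C * |s - t| := fun n s t =>
    abs_sub_le_of_deriv' (h n).dy (hd n) t s
  obtain ⟨k, hk, w, hw⟩ := extract (L := c + C) (B := max R (C * T)) (by positivity)
    (fun n t => (x n t, y n t))
    (fun n t => by
      simp only [Prod.norm_def, Real.norm_eq_abs]
      exact max_le_max (hx n t) ((h n).y_bound hT hψm hψ0 hC (hd n) t))
    (fun n s t => by
      simp only [Prod.dist_eq, Real.dist_eq]
      have h1 := hlx n s t
      have h2 := hly n s t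
      have h3 := mul_nonneg hc.le (abs_nonneg (s - t))
      have h4 := mul_nonneg hC.le (abs_nonneg (s - t))
      apply max_le <;> linarith)
  have hX : ∀ t, Tendsto (fun n => x (k n) t) atTop (𝓝 (w t).1) := fun t =>
    (continuous_fst.tendsto _).comp (hw t)
  have hY : ∀ t, Tendsto (fun n => y (k n) t) atTop (𝓝 (w t).2) := fun t =>
    (continuous_snd.tendsto _).comp (hw t)
  have hXc : Continuous fun t => (w t).1 := by
    have : LipschitzWith (Real.toNNReal c) fun t => (w t).1 := by
      apply LipschitzWith.of_dist_le_mul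
      intro s t
      rw [Real.coe_toNNReal _ hc.le, Real.dist_eq, Real.dist_eq]
      exact le_of_tendsto ((hX s).sub (hX t)).abs (Filter.Eventually.of_forall fun n => hlx _ s t)
    exact this.continuous
  have hYc : Continuous fun t => (w t).2 := by
    have : LipschitzWith (Real.toNNReal C) fun t => (w t).2 := by
      apply LipschitzWith.of_dist_le_mul
      intro s t
      rw [Real.coe_toNNReal _ hC.le, Real.dist_eq, Real.dist_eq]
      exact le_of_tendsto ((hY s).sub (hY t)).abs (Filter.Eventually.of_forall fun n => hly _ s t)
    exact this.continuous
  refine ⟨k, hk, fun t => (w t).1, fun t => (w t).2, hXc, hYc, hX, hY, ?_⟩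
  intro D hDc hD
  refine ⟨?_, ?_, ?_, ?_⟩
  · intro t
    refine tendsto_nhds_unique (hX (t + T)) ((hX t).congr fun n => ((h (k n)).px t).symm)
  · intro t
    refine tendsto_nhds_unique (hY (t + T)) ((hY t).congr fun n => ((h (k n)).py t).symm)
  · intro t
    refine limit_deriv (u := fun n => x (k n)) (v := fun n t => ψ (y (k n) t)) (C := c)
      (v0 := fun t => ψ (w t).2) (fun n => (h (k n)).dx) (fun n => ?_) (fun n t => hψb _) hX
      (fun t => (hψc.tendsto _).comp (hY t)) (hψc.comp hYc) t
    exact hψc.comp (continuous_iff_continuousAt.2 fun t => ((h (k n)).dy t).continuousAt)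
  · exact limit_deriv (fun n => (h (k n)).dy) (fun n => hdc (k n)) (fun n => hd (k n)) hY hD hDc

/-- Truncation to `[-R, R]`. -/
noncomputable def cl (R x : ℝ) : ℝ := max (-R) (min R x)

lemma cl_cont (R : ℝ) : Continuous (cl R) := by unfold cl; fun_prop

lemma cl_mono (R : ℝ) : Monotone (cl R) := fun _ _ h => max_le_max le_rfl (min_le_min le_rfl h)

lemma cl_abs {R : ℝ} (hR : 0 ≤ R) (x : ℝ) : |cl R x| ≤ R := by
  unfold cl
  rw [abs_le]
  exact ⟨le_max_left _ _, max_le (by linarith) (min_le_left _ _)⟩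

lemma cl_lip (R x x' : ℝ) : |cl R x - cl R x'| ≤ |x - x'| := by
  unfold cl
  have h1 := abs_max_sub_max_le_max (-R) (min R x) (-R) (min R x')
  have h2 := abs_min_sub_min_le_max R x R x'
  rw [sub_self, abs_zero, max_eq_right (abs_nonneg (min R x - min R x'))] at h1
  rw [sub_self, abs_zero, max_eq_right (abs_nonneg (x - x'))] at h2
  exact h1.trans h2

lemma cl_eq {R x : ℝ} (h : |x| ≤ R) : cl R x = x := by
  rw [abs_le] at h
  unfold cl
  rw [min_eq_right h.2, max_eq_right h.1]

lemma lt_cl {R x a : ℝ} (h : a < R) (h' : a < x) : a < cl R x :=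
  (lt_min h h').trans_le (le_max_right _ _)

lemma cl_lt {R x a : ℝ} (h : -R < a) (h' : x < a) : cl R x < a :=
  max_lt h ((min_le_right _ _).trans_lt h')

lemma psol_const {ψ : ℝ → ℝ} (hψ0 : ψ 0 = 0) (T r : ℝ) :
    PSol ψ T (fun _ => r) (fun _ => 0) (fun _ => 0) :=
  ⟨fun _ => rfl, fun _ => rfl, fun t => by rw [hψ0]; exact hasDerivAt_const _ _,
    fun t => hasDerivAt_const _ _⟩

section lip

variable {ψ : ℝ → ℝ} {G : ℝ → ℝ → ℝ → ℝ} {K c C T R : ℝ}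

lemma lip_step (hT : 0 < T) (hK : 0 < K)
    (hc : 0 < c) (hC : 0 < C) (hR : 0 < R) (hψm : StrictMono ψ) (hψ0 : ψ 0 = 0)
    (hψl : ∀ a b, |ψ a - ψ b| ≤ |a - b|) (hψb : ∀ a, |ψ a| ≤ c)
    (hGc : Continuous fun q : ℝ × ℝ × ℝ => G q.1 q.2.1 q.2.2)
    (hGT : ∀ t x y, G (t + T) x y = G t x y)
    (hGb : ∀ t x y, |G t x y| ≤ C)
    (hGl : ∀ t x y x' y', |G t x y - G t x' y'| ≤ K * (|x - x'| + |y - y'|))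
    (hGp : ∀ t x y, R ≤ x → 0 ≤ G t x y) (hGn : ∀ t x y, x ≤ -R → G t x y ≤ 0)
    (u : ℝ → ℝ) (huc : Continuous u) (hup : Function.Periodic u T) (hub : ∀ t, |u t| ≤ R) :
    ∃ x y : ℝ → ℝ, PSol ψ T x y (fun t => G t (u t) (y t) + K * (x t - u t)) ∧
      ∀ t, |x t| ≤ R := by
  have up : ∀ t y a, R ≤ a → 0 ≤ G t (u t) y + K * (a - u t) := by
    intro t y a ha
    have h1 := (abs_le.1 (hub t)).2
    have h2 := (abs_le.1 (hGl t R y (u t) y)).2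
    rw [sub_self, abs_zero, add_zero, abs_of_nonneg (by linarith)] at h2
    have h3 := hGp t R y le_rfl
    have := mul_le_mul_of_nonneg_left ha hK.le
    linarith
  have lo : ∀ t y a, a ≤ -R → G t (u t) y + K * (a - u t) ≤ 0 := by
    intro t y a ha
    have h1 := (abs_le.1 (hub t)).1
    have h2 := (abs_le.1 (hGl t (u t) y (-R) y)).2
    rw [sub_self, abs_zero, add_zero, abs_of_nonneg (by linarith)] at h2
    have h3 := hGn t (-R) y le_rfl
    have := mul_le_mul_of_nonneg_left ha hK.le
    linarith
  obtain ⟨x, y, h⟩ := exists_psol_mono (G := fun t x y => G t (u t) y + K * (cl (R + 1) x - u t))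
    (K := K) (C := C + K * (2 * R + 1)) (R := R) hT hK hc (by positivity) hR hψm hψ0 hψl hψb
    (by
      have h1 : Continuous fun q : ℝ × ℝ × ℝ => G q.1 (u q.1) q.2.2 :=
        hGc.comp (by fun_prop : Continuous fun q : ℝ × ℝ × ℝ => (q.1, u q.1, q.2.2))
      have h2 := cl_cont (R + 1)
      fun_prop)
    (fun t x y => by simp only [hGT, hup t])
    (fun t x y => by
      have h1 := abs_le.1 (hGb t (u t) y)
      have h2 := abs_le.1 (cl_abs (by linarith : 0 ≤ R + 1) x)
      have h3 := abs_le.1 (hub t)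
      rw [abs_le]
      constructor <;> nlinarith)
    (fun t x y x' y' => by
      have h1 := hGl t (u t) y (u t) y'
      rw [sub_self, abs_zero, zero_add] at h1
      have h2 := mul_le_mul_of_nonneg_left (cl_lip (R + 1) x x') hK.le
      have h3 : K * |cl (R + 1) x - cl (R + 1) x'| = |K * (cl (R + 1) x - cl (R + 1) x')| := by
        rw [abs_mul, abs_of_pos hK]
      have h4 := abs_add_le (G t (u t) y - G t (u t) y') (K * (cl (R + 1) x - cl (R + 1) x'))
      have h5 : G t (u t) y + K * (cl (R + 1) x - u t) - (G t (u t) y' + K * (cl (R + 1) x' - u t))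
        = G t (u t) y - G t (u t) y' + K * (cl (R + 1) x - cl (R + 1) x') := by ring
      rw [h5]
      linarith)
    (fun t x x' y hx => by
      have := mul_le_mul_of_nonneg_left (cl_mono (R + 1) hx) hK.le
      linarith)
    (fun t x y hx => by
      apply up
      have := cl_mono (R + 1) hx
      rwa [cl_eq (by rw [abs_of_pos hR]; linarith)] at this)
    (fun t x y hx => by
      apply lo
      have := cl_mono (R + 1) hx
      rwa [cl_eq (x := -R) (by rw [abs_neg, abs_of_pos hR]; linarith)] at this)
  have hxR : ∀ t, |x t| ≤ R := by
    intro t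
    rw [abs_le]
    constructor
    · refine compare hT hψm (psol_const hψ0 T (-R)) h (fun t h1 h2 => ?_) t
      have h3 := lo t (y t) (-R) le_rfl
      have := mul_lt_mul_of_pos_left (cl_lt (R := R + 1) (by linarith) h1) hK
      linarith
    · refine compare hT hψm h (psol_const hψ0 T R) (fun t h1 h2 => ?_) t
      have h3 := up t (y t) R le_rfl
      have := mul_lt_mul_of_pos_left (lt_cl (R := R + 1) (by linarith) h1) hK
      linarith
  refine ⟨x, y, ⟨h.px, h.py, h.dx, fun t => ?_⟩, hxR⟩
  have := h.dy t
  rwa [cl_eq (by linarith [hxR t])] at this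

lemma lip_compare (hT : 0 < T) (hK : 0 < K) (hψm : StrictMono ψ)
    (hGl : ∀ t x y x' y', |G t x y - G t x' y'| ≤ K * (|x - x'| + |y - y'|))
    {u₁ u₂ x₁ x₂ y₁ y₂ : ℝ → ℝ} (hu : ∀ t, u₁ t ≤ u₂ t)
    (h₁ : PSol ψ T x₁ y₁ (fun t => G t (u₁ t) (y₁ t) + K * (x₁ t - u₁ t)))
    (h₂ : PSol ψ T x₂ y₂ (fun t => G t (u₂ t) (y₂ t) + K * (x₂ t - u₂ t))) (t : ℝ) :
    x₁ t ≤ x₂ t := by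
  refine compare hT hψm h₁ h₂ (fun t h1 h2 => ?_) t
  have h3 := (abs_le.1 (hGl t (u₂ t) (y₁ t) (u₁ t) (y₁ t))).2
  rw [sub_self, abs_zero, add_zero, abs_of_nonneg (by linarith [hu t])] at h3
  have := mul_lt_mul_of_pos_left h1 hK
  rw [← h2]
  linarith

/-- Existence for Lipschitz right-hand sides, by monotone iteration. -/
lemma exists_psol_lip (hT : 0 < T) (hK : 0 < K)
    (hc : 0 < c) (hC : 0 < C) (hR : 0 < R) (hψm : StrictMono ψ) (hψ0 : ψ 0 = 0)
    (hψl : ∀ a b, |ψ a - ψ b| ≤ |a - b|) (hψc : Continuous ψ) (hψb : ∀ a, |ψ a| ≤ c)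
    (hGc : Continuous fun q : ℝ × ℝ × ℝ => G q.1 q.2.1 q.2.2)
    (hGT : ∀ t x y, G (t + T) x y = G t x y)
    (hGb : ∀ t x y, |G t x y| ≤ C)
    (hGl : ∀ t x y x' y', |G t x y - G t x' y'| ≤ K * (|x - x'| + |y - y'|))
    (hGp : ∀ t x y, R ≤ x → 0 ≤ G t x y) (hGn : ∀ t x y, x ≤ -R → G t x y ≤ 0) :
    ∃ x y : ℝ → ℝ, PSol ψ T x y (fun t => G t (x t) (y t)) ∧ ∀ t, |x t| ≤ R := by
  let U := {u : ℝ → ℝ // Continuous u ∧ Function.Periodic u T ∧ ∀ t, |u t| ≤ R}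
  have hstep : ∀ u : U, ∃ v : U, ∃ y : ℝ → ℝ,
      PSol ψ T v.1 y (fun t => G t (u.1 t) (y t) + K * (v.1 t - u.1 t)) := by
    rintro ⟨u, h1, h2, h3⟩
    obtain ⟨x, y, h, hx⟩ := lip_step hT hK hc hC hR hψm hψ0 hψl hψb hGc hGT hGb hGl hGp hGn u h1 h2 h3
    exact ⟨⟨x, continuous_iff_continuousAt.2 fun t => (h.dx t).continuousAt, h.px, hx⟩, y, h⟩
  choose S Y hS using hstep
  let u0 : U := ⟨fun _ => -R, continuous_const, fun _ => rfl, fun t => by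
    rw [abs_neg, abs_of_pos hR]⟩
  let s : ℕ → U := fun n => S^[n] u0
  have hs : ∀ n, s (n + 1) = S (s n) := fun n => Function.iterate_succ_apply' S n u0
  have hsol : ∀ n, PSol ψ T (s (n + 1)).1 (Y (s n))
      (fun t => G t ((s n).1 t) (Y (s n) t) + K * ((s (n + 1)).1 t - (s n).1 t)) := by
    intro n
    rw [hs]
    exact hS (s n)
  have hmono : ∀ n t, (s n).1 t ≤ (s (n + 1)).1 t := by
    intro n
    induction n with
    | zero => exact fun t => (abs_le.1 ((s 1).2.2.2 t)).1
    | succ n ih => exact lip_compare hT hK hψm hGl ih (hsol n) (hsol (n + 1))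
  have hYc : ∀ n, Continuous (Y (s n)) := fun n =>
    continuous_iff_continuousAt.2 fun t => ((hsol n).dy t).continuousAt
  obtain ⟨k, hk, X, Z, hXc, hZc, hX, hZ, hlim⟩ := psol_limit (C := C + K * (2 * R)) (R := R) hT hc
    (by positivity) hψm hψ0 hψc hψb _ _ _ hsol (fun n t => (s (n + 1)).2.2.2 t)
    (fun n => by
      have h1 := (s n).2.1
      have h2 := (s (n + 1)).2.1
      have h3 := hYc n
      have : Continuous fun t => G t ((s n).1 t) (Y (s n) t) :=
        hGc.comp (by fun_prop : Continuous fun t => (t, (s n).1 t, Y (s n) t))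
      fun_prop)
    (fun n t => by
      have h1 := abs_le.1 (hGb t ((s n).1 t) (Y (s n) t))
      have h2 := abs_le.1 ((s n).2.2.2 t)
      have h3 := abs_le.1 ((s (n + 1)).2.2.2 t)
      rw [abs_le]
      constructor <;> nlinarith)
  have hXR : ∀ t, |X t| ≤ R := fun t =>
    le_of_tendsto (hX t).abs (Filter.Eventually.of_forall fun n => (s (k n + 1)).2.2.2 t)
  have hX' : ∀ t, Tendsto (fun n => (s (k n)).1 t) atTop (𝓝 (X t)) := by
    intro t
    have hm : Monotone fun n => (s n).1 t := monotone_nat_of_le_succ fun n => hmono n t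
    have hb : BddAbove (range fun n => (s n).1 t) := by
      refine ⟨R, ?_⟩
      rintro _ ⟨n, rfl⟩
      exact (abs_le.1 ((s n).2.2.2 t)).2
    have h1 := tendsto_atTop_ciSup hm hb
    have h2 := h1.comp hk.tendsto_atTop
    have h3 := h1.comp ((tendsto_add_atTop_nat 1).comp hk.tendsto_atTop)
    have h4 := tendsto_nhds_unique (hX t) h3
    rw [h4]
    exact h2
  refine ⟨X, Z, hlim _ ?_ ?_, hXR⟩
  · exact hGc.comp (by fun_prop : Continuous fun t => (t, X t, Z t))
  · intro t
    have h1 : Tendsto (fun n => G t ((s (k n)).1 t) (Y (s (k n)) t)) atTop (𝓝 (G t (X t) (Z t))) :=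
      (hGc.tendsto (t, X t, Z t)).comp
        (tendsto_const_nhds.prodMk_nhds ((hX' t).prodMk_nhds (hZ t)))
    have h2 := h1.add (((hX t).sub (hX' t)).const_mul K)
    simpa using h2

end lip

section infconv

variable {X : Type*} [MetricSpace X] {h : X → ℝ} {B k : ℝ}

/-- Lipschitz regularization. -/
noncomputable def ic (h : X → ℝ) (k : ℝ) (p : X) : ℝ := ⨅ w, (h w + k * dist p w)

lemma ic_bdd (hk : 0 ≤ k) (hb : ∀ p, |h p| ≤ B) (p : X) :
    BddBelow (range fun w => h w + k * dist p w) := by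
  refine ⟨-B, ?_⟩
  rintro _ ⟨w, rfl⟩
  have := (abs_le.1 (hb w)).1
  have := mul_nonneg hk (dist_nonneg (x := p) (y := w))
  simp only
  linarith

lemma ic_le (hk : 0 ≤ k) (hb : ∀ p, |h p| ≤ B) (p : X) : ic h k p ≤ h p := by
  have := ciInf_le (ic_bdd hk hb p) p
  simpa [ic] using this

lemma ic_abs (hk : 0 ≤ k) (hb : ∀ p, |h p| ≤ B) (p : X) : |ic h k p| ≤ B := by
  rw [abs_le]
  constructor
  · have : Nonempty X := ⟨p⟩
    apply le_ciInf
    intro w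
    have := (abs_le.1 (hb w)).1
    have := mul_nonneg hk (dist_nonneg (x := p) (y := w))
    linarith
  · exact (ic_le hk hb p).trans (abs_le.1 (hb p)).2

lemma ic_lip (hk : 0 ≤ k) (hb : ∀ p, |h p| ≤ B) (p q : X) :
    |ic h k p - ic h k q| ≤ k * dist p q := by
  have key : ∀ p q : X, ic h k p ≤ ic h k q + k * dist p q := by
    intro p q
    have : Nonempty X := ⟨p⟩
    rw [← sub_le_iff_le_add]
    apply le_ciInf
    intro w
    have h1 := ciInf_le (ic_bdd hk hb p) w
    have h2 := mul_le_mul_of_nonneg_left (dist_triangle p q w) hk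
    simp only [ic] at h1 ⊢
    linarith
  rw [abs_le]
  have h1 := key p q
  have h2 := key q p
  rw [dist_comm q p] at h2
  constructor <;> linarith

lemma ic_tendsto_sub (hc : Continuous h) (hb : ∀ p, |h p| ≤ B) {k : ℕ → ℕ} (hkm : StrictMono k)
    {p : ℕ → X} {p0 : X} (hp : Tendsto p atTop (𝓝 p0)) :
    Tendsto (fun n : ℕ => ic h ((k n : ℝ) + 1) (p n)) atTop (𝓝 (h p0)) := by
  have hB : 0 ≤ B := (abs_nonneg _).trans (hb p0)
  rw [Metric.tendsto_atTop]
  intro ε hε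
  obtain ⟨δ, hδ, hd⟩ := Metric.continuousAt_iff.1 (hc.continuousAt (x := p0)) (ε / 2) (by positivity)
  obtain ⟨N1, hN1⟩ := Metric.tendsto_atTop.1 hp (δ / 2) (by positivity)
  obtain ⟨N2, hN2⟩ := exists_nat_gt (2 * B / (δ / 2))
  refine ⟨max N1 N2, fun n hn => ?_⟩
  have hn1 := hN1 n (le_of_max_le_left hn)
  have hn2 : (N2 : ℝ) ≤ k n := by
    exact_mod_cast (le_of_max_le_right hn).trans hkm.le_apply
  have hnk : (0 : ℝ) ≤ k n + 1 := by positivity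
  rw [Real.dist_eq, abs_lt]
  constructor
  · have : Nonempty X := ⟨p0⟩
    have : h p0 - ε / 2 ≤ ic h (k n + 1) (p n) := by
      apply le_ciInf
      intro w
      rcases lt_or_ge (dist (p n) w) (δ / 2) with h1 | h1
      · have h2 : dist w p0 < δ := by
          have := dist_triangle w (p n) p0
          rw [dist_comm w (p n)] at this
          linarith
        have h3 := hd h2
        rw [Real.dist_eq, abs_lt] at h3
        have := mul_nonneg hnk (dist_nonneg (x := p n) (y := w))
        linarith [h3.1]
      · have h2 : 2 * B ≤ (k n + 1) * dist (p n) w := by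
          rw [div_lt_iff₀ (by positivity)] at hN2
          calc 2 * B ≤ N2 * (δ / 2) := hN2.le
            _ ≤ (k n + 1) * dist (p n) w := by
              apply mul_le_mul _ h1 (by positivity) hnk
              linarith
        have := (abs_le.1 (hb w)).1
        have := (abs_le.1 (hb p0)).2
        linarith
    linarith
  · have h1 := ic_le hnk hb (p n)
    have h2 := hd (show dist (p n) p0 < δ by linarith)
    rw [Real.dist_eq, abs_lt] at h2
    linarith [h2.2]

lemma ic_inv (e : X ≃ᵢ X) (he : ∀ p, h (e p) = h p) (p : X) : ic h k (e p) = ic h k p := by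
  unfold ic
  rw [← e.toEquiv.iInf_comp]
  simp [he, e.isometry.dist_eq]

end infconv

/-- Existence for continuous bounded perturbations of the truncation. -/
lemma exists_psol_cont {ψ : ℝ → ℝ} {H : ℝ → ℝ → ℝ → ℝ} {c B T R : ℝ} (hT : 0 < T)
    (hc : 0 < c) (hBR : B ≤ R) (hR : 0 < R) (hψm : StrictMono ψ) (hψ0 : ψ 0 = 0)
    (hψl : ∀ a b, |ψ a - ψ b| ≤ |a - b|) (hψc : Continuous ψ) (hψb : ∀ a, |ψ a| ≤ c)
    (hHc : Continuous fun q : ℝ × ℝ × ℝ => H q.1 q.2.1 q.2.2)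
    (hHT : ∀ t x y, H (t + T) x y = H t x y)
    (hHb : ∀ t x y, |H t x y| ≤ B) :
    ∃ x y : ℝ → ℝ, PSol ψ T x y (fun t => cl R (x t) + H t (x t) (y t)) := by
  set h : ℝ × ℝ × ℝ → ℝ := fun q => H q.1 q.2.1 q.2.2 with hh
  have hb : ∀ p, |h p| ≤ B := fun p => hHb _ _ _
  have hk : ∀ n : ℕ, (0 : ℝ) ≤ n + 1 := fun n => by positivity
  have icc : ∀ n : ℕ, Continuous (ic h (n + 1)) := by
    intro n
    have : LipschitzWith (Real.toNNReal (n + 1)) (ic h (n + 1)) := by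
      apply LipschitzWith.of_dist_le_mul
      intro p q
      rw [Real.coe_toNNReal _ (hk n), Real.dist_eq]
      exact ic_lip (hk n) hb p q
    exact this.continuous
  have hex : ∀ n : ℕ, ∃ x y : ℝ → ℝ,
      PSol ψ T x y (fun t => cl R (x t) + ic h (n + 1) (t, x t, y t)) ∧ ∀ t, |x t| ≤ R := by
    intro n
    refine exists_psol_lip (G := fun t x y => cl R x + ic h (n + 1) (t, x, y)) (K := n + 2)
      (C := 2 * R) hT (by positivity) hc (by positivity) hR hψm hψ0 hψl hψc hψb ?_ ?_ ?_ ?_ ?_ ?_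
    · have h1 := icc n
      have h2 := cl_cont R
      fun_prop
    · intro t x y
      have := ic_inv (h := h) (k := n + 1)
        (IsometryEquiv.addRight ((T, 0, 0) : ℝ × ℝ × ℝ)) (fun p => by simp [hh, hHT]) (t, x, y)
      simp only [IsometryEquiv.addRight_apply, Prod.mk_add_mk, add_zero] at this
      rw [this]
    · intro t x y
      have h1 := abs_add_le (cl R x) (ic h (n + 1) (t, x, y))
      have h2 := cl_abs hR.le x
      have h3 := ic_abs (hk n) hb (t, x, y)
      linarith
    · intro t x y x' y'
      have h1 := ic_lip (hk n) hb (t, x, y) (t, x', y')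
      have h2 := cl_lip R x x'
      have h3 : dist (t, x, y) (t, x', y') ≤ |x - x'| + |y - y'| := by
        simp only [Prod.dist_eq, Real.dist_eq, sub_self, abs_zero]
        have := abs_nonneg (x - x')
        have := abs_nonneg (y - y')
        refine max_le (by linarith) (max_le (by linarith) (by linarith))
      have h4 := mul_le_mul_of_nonneg_left h3 (hk n)
      have h5 := abs_add_le (cl R x - cl R x') (ic h (n + 1) (t, x, y) - ic h (n + 1) (t, x', y'))
      rw [add_sub_add_comm]
      have := abs_nonneg (y - y')
      linarith
    · intro t x y hx
      have h1 := cl_mono R hx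
      rw [cl_eq (by rw [abs_of_pos hR])] at h1
      have h3 := (abs_le.1 (ic_abs (hk n) hb (t, x, y))).1
      linarith
    · intro t x y hx
      have h1 := cl_mono R hx
      rw [cl_eq (x := -R) (by rw [abs_neg, abs_of_pos hR])] at h1
      have h3 := (abs_le.1 (ic_abs (hk n) hb (t, x, y))).2
      linarith
  choose x y hxy hxR using hex
  have hxc : ∀ n, Continuous (x n) := fun n =>
    continuous_iff_continuousAt.2 fun t => ((hxy n).dx t).continuousAt
  have hyc : ∀ n, Continuous (y n) := fun n =>
    continuous_iff_continuousAt.2 fun t => ((hxy n).dy t).continuousAt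
  have hcl := cl_cont R
  obtain ⟨k, hkm, X, Z, hXc, hZc, hX, hZ, hlim⟩ := psol_limit (C := 2 * R) (R := R) hT hc
    (by positivity) hψm hψ0 hψc hψb _ _ _ hxy hxR
    (fun n => by
      have h1 := icc n
      have h2 := hxc n
      have h3 := hyc n
      fun_prop)
    (fun n t => by
      have h1 := abs_add_le (cl R (x n t)) (ic h (n + 1) (t, x n t, y n t))
      have h2 := cl_abs hR.le (x n t)
      have h3 := ic_abs (hk n) hb (t, x n t, y n t)
      linarith)
  refine ⟨X, Z, hlim _ ?_ ?_⟩
  · have : Continuous fun t => H t (X t) (Z t) :=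
      hHc.comp (by fun_prop : Continuous fun t => (t, X t, Z t))
    exact (hcl.comp hXc).add this
  · intro t
    refine ((hcl.tendsto _).comp (hX t)).add ?_
    -- convergence along the subsequence
    have hp : Tendsto (fun n => (t, x (k n) t, y (k n) t)) atTop (𝓝 (t, X t, Z t)) :=
      tendsto_const_nhds.prodMk_nhds ((hX t).prodMk_nhds (hZ t))
    exact ic_tendsto_sub hHc hb hkm hp

/-- The inverse of `phi c`. -/
noncomputable def psi (c y : ℝ) : ℝ := y / Real.sqrt (1 + y ^ 2 / c ^ 2)

section psi

variable {c : ℝ}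

lemma psi_zero : psi c 0 = 0 := by simp [psi]

lemma one_add_pos (y : ℝ) : 0 < 1 + y ^ 2 / c ^ 2 := by positivity

lemma phi_psi (hc : 0 < c) (y : ℝ) : phi c (psi c y) = y := by
  have hs : 0 < Real.sqrt (1 + y ^ 2 / c ^ 2) := Real.sqrt_pos.2 (one_add_pos y)
  have hs2 : Real.sqrt (1 + y ^ 2 / c ^ 2) ^ 2 = 1 + y ^ 2 / c ^ 2 := Real.sq_sqrt (one_add_pos y).le
  unfold phi psi
  set s := Real.sqrt (1 + y ^ 2 / c ^ 2) with hsdef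
  have h1 : 1 - (y / s) ^ 2 / c ^ 2 = (1 / s) ^ 2 := by
    have : (y / s) ^ 2 / c ^ 2 = (y ^ 2 / c ^ 2) / s ^ 2 := by field_simp
    rw [this, show y ^ 2 / c ^ 2 = s ^ 2 - 1 by linarith]
    field_simp
    ring
  rw [h1, Real.sqrt_sq (by positivity)]
  field_simp

lemma psi_phi (hc : 0 < c) {v : ℝ} (hv : |v| < c) : psi c (phi c v) = v := by
  have h0 : 0 < 1 - v ^ 2 / c ^ 2 := by
    rw [sub_pos, div_lt_one (by positivity)]
    exact sq_lt_sq' (by linarith [(abs_lt.1 hv).1]) (abs_lt.1 hv).2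
  have hs : 0 < Real.sqrt (1 - v ^ 2 / c ^ 2) := Real.sqrt_pos.2 h0
  have hs2 : Real.sqrt (1 - v ^ 2 / c ^ 2) ^ 2 = 1 - v ^ 2 / c ^ 2 := Real.sq_sqrt h0.le
  unfold phi psi
  set s := Real.sqrt (1 - v ^ 2 / c ^ 2) with hsdef
  have h1 : 1 + (v / s) ^ 2 / c ^ 2 = (1 / s) ^ 2 := by
    have : (v / s) ^ 2 / c ^ 2 = (v ^ 2 / c ^ 2) / s ^ 2 := by field_simp
    rw [this, show v ^ 2 / c ^ 2 = 1 - s ^ 2 by linarith]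
    field_simp
    ring
  rw [h1, Real.sqrt_sq (by positivity)]
  field_simp

lemma psi_lt (hc : 0 < c) (y : ℝ) : |psi c y| < c := by
  have hs : 0 < Real.sqrt (1 + y ^ 2 / c ^ 2) := Real.sqrt_pos.2 (one_add_pos y)
  unfold psi
  rw [abs_div, abs_of_pos hs, div_lt_iff₀ hs]
  have : |y| / c < Real.sqrt (1 + y ^ 2 / c ^ 2) := by
    apply Real.lt_sqrt_of_sq_lt
    rw [div_pow, sq_abs]
    linarith
  rw [div_lt_iff₀ hc] at this
  linarith

lemma psi_deriv (y : ℝ) : HasDerivAt (psi c) (1 / Real.sqrt (1 + y ^ 2 / c ^ 2) ^ 3) y := by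
  have hs : 0 < Real.sqrt (1 + y ^ 2 / c ^ 2) := Real.sqrt_pos.2 (one_add_pos y)
  have hs2 : Real.sqrt (1 + y ^ 2 / c ^ 2) ^ 2 = 1 + y ^ 2 / c ^ 2 := Real.sq_sqrt (one_add_pos y).le
  have h1 : HasDerivAt (fun y : ℝ => 1 + y ^ 2 / c ^ 2) (2 * y / c ^ 2) y := by
    have := ((hasDerivAt_pow 2 y).div_const (c ^ 2)).const_add 1
    simpa using this
  have h2 := (hasDerivAt_id y).div (h1.sqrt (one_add_pos y).ne') hs.ne'
  refine h2.congr_deriv ?_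
  simp only [id]
  set s := Real.sqrt (1 + y ^ 2 / c ^ 2) with hsdef
  have h3 : y * (2 * y / c ^ 2 / (2 * s)) = (s ^ 2 - 1) / s := by
    rw [hs2]
    field_simp
    ring
  rw [h3]
  field_simp
  ring

lemma psi_strictMono : StrictMono (psi c) := by
  apply strictMono_of_deriv_pos
  intro y
  rw [(psi_deriv y).deriv]
  have hs : 0 < Real.sqrt (1 + y ^ 2 / c ^ 2) := Real.sqrt_pos.2 (one_add_pos y)
  positivity

lemma psi_lip (a b : ℝ) : |psi c a - psi c b| ≤ |a - b| := by
  have := abs_sub_le_of_deriv' (C := 1) (psi_deriv (c := c)) (fun y => ?_) b a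
  · simpa using this
  · have hs : 1 ≤ Real.sqrt (1 + y ^ 2 / c ^ 2) := by
      rw [Real.one_le_sqrt]
      have : 0 ≤ y ^ 2 / c ^ 2 := by positivity
      linarith
    rw [abs_of_pos (by positivity), div_le_one (by positivity)]
    exact one_le_pow₀ hs

lemma psi_cont : Continuous (psi c) := continuous_iff_continuousAt.2 fun y => (psi_deriv y).continuousAt

lemma psol_of {T : ℝ} (hc : 0 < c) {α : ℝ → ℝ} (hαper : Function.Periodic α T) (hαC1 : ContDiff ℝ 1 α)
    (hα' : ∀ t : ℝ, |deriv α t| < c)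
    (hαφ : ContDiff ℝ 1 (fun t : ℝ => phi c (deriv α t))) :
    PSol (psi c) T α (fun t => phi c (deriv α t)) (deriv fun τ : ℝ => phi c (deriv α τ)) := by
  refine ⟨hαper, ?_, ?_, ?_⟩
  · intro t
    have : deriv α (t + T) = deriv α t := by
      rw [← deriv_comp_add_const]
      congr 1
      exact funext hαper
    simp only [this]
  · intro t
    rw [psi_phi hc (hα' t)]
    exact (hαC1.differentiable one_ne_zero t).hasDerivAt
  · intro t
    exact (hαφ.differentiable one_ne_zero t).hasDerivAt

end psi

end ULS

/-- the method of upper and lower solutions for `(φ(x'))' = f(t, x, x')`. -/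
theorem upper_lower_solutions (c T : ℝ) (hc : 0 < c) (hT : 0 < T)
    (f : ℝ → ℝ → ℝ → ℝ)
    (hfcont : Continuous fun q : ℝ × ℝ × ℝ => f q.1 q.2.1 q.2.2)
    (hfper : ∀ t u v : ℝ, f (t + T) u v = f t u v)
    (α β : ℝ → ℝ)
    (hαper : Function.Periodic α T) (hαC1 : ContDiff ℝ 1 α)
    (hα' : ∀ t : ℝ, |deriv α t| < c)
    (hαφ : ContDiff ℝ 1 (fun t : ℝ => phi c (deriv α t)))
    (hαlow : ∀ t : ℝ, f t (α t) (deriv α t) ≤ deriv (fun τ : ℝ => phi c (deriv α τ)) t)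
    (hβper : Function.Periodic β T) (hβC1 : ContDiff ℝ 1 β)
    (hβ' : ∀ t : ℝ, |deriv β t| < c)
    (hβφ : ContDiff ℝ 1 (fun t : ℝ => phi c (deriv β t)))
    (hβupp : ∀ t : ℝ, deriv (fun τ : ℝ => phi c (deriv β τ)) t ≤ f t (β t) (deriv β t))
    (hαβ : ∀ t : ℝ, α t ≤ β t) :
    ∃ x : ℝ → ℝ,
      Function.Periodic x T ∧ ContDiff ℝ 1 x ∧ (∀ t : ℝ, |deriv x t| < c) ∧
      ContDiff ℝ 1 (fun t : ℝ => phi c (deriv x t)) ∧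
      (∀ t : ℝ, deriv (fun τ : ℝ => phi c (deriv x τ)) t = f t (x t) (deriv x t)) ∧
      (∀ t : ℝ, α t ≤ x t ∧ x t ≤ β t) := by

  have sα := ULS.psol_of hc hαper hαC1 hα' hαφ
  have sβ := ULS.psol_of hc hβper hβC1 hβ' hβφ
  have hαc := hαC1.continuous
  have hβc := hβC1.continuous
  obtain ⟨A1, hA1⟩ := (hαper.isBounded_of_continuous hT.ne' hαc).exists_norm_le
  obtain ⟨A2, hA2⟩ := (hβper.isBounded_of_continuous hT.ne' hβc).exists_norm_le
  set A : ℝ := max A1 A2 with hA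
  have hAα : ∀ t, |α t| ≤ A := fun t => (hA1 _ ⟨t, rfl⟩).trans (le_max_left _ _)
  have hAβ : ∀ t, |β t| ≤ A := fun t => (hA2 _ ⟨t, rfl⟩).trans (le_max_right _ _)
  have hA0 : 0 ≤ A := (abs_nonneg _).trans (hAα 0)
  -- bound on `f`
  have hcomp : IsCompact (Icc 0 T ×ˢ (Icc (-A) A ×ˢ Icc (-c) c)) :=
    isCompact_Icc.prod (isCompact_Icc.prod isCompact_Icc)
  obtain ⟨F, hF⟩ := hcomp.exists_bound_of_continuousOn hfcont.continuousOn
  have hfper' : Function.Periodic f T := fun t => by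
    funext u v
    exact hfper t u v
  have hFb : ∀ t u v, |u| ≤ A → |v| ≤ c → |f t u v| ≤ F := by
    intro t u v hu hv
    obtain ⟨s, hs, h⟩ := hfper'.exists_mem_Ico₀ hT t
    rw [h]
    exact hF (s, u, v) ⟨Ico_subset_Icc_self hs, abs_le.1 hu, abs_le.1 hv⟩
  set m : ℝ → ℝ → ℝ := fun t x => max (α t) (min (β t) x) with hm
  have hmA : ∀ t x, |m t x| ≤ A := by
    intro t x
    have h1 := abs_le.1 (hAα t)
    have h2 := abs_le.1 (hAβ t)
    rw [abs_le]
    exact ⟨h1.1.trans (le_max_left _ _), max_le h1.2 ((min_le_left _ _).trans h2.2)⟩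
  have hmc : Continuous fun q : ℝ × ℝ × ℝ => m q.1 q.2.1 := by
    simp only [hm]
    fun_prop
  have hψc := ULS.psi_cont (c := c)
  set R : ℝ := |F| + A + 1 with hR
  have hFabs := le_abs_self F
  have hFnn := abs_nonneg F
  obtain ⟨x, y, hxy⟩ := ULS.exists_psol_cont (ψ := ULS.psi c) (T := T) (c := c)
    (H := fun t x y => f t (m t x) (ULS.psi c y) - m t x)
    (B := |F| + A) (R := R) hT hc (by linarith) (by linarith) ULS.psi_strictMono ULS.psi_zero
    ULS.psi_lip hψc (fun a => (ULS.psi_lt hc a).le)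
    (by
      have : Continuous fun q : ℝ × ℝ × ℝ => f q.1 (m q.1 q.2.1) (ULS.psi c q.2.2) :=
        hfcont.comp (by fun_prop : Continuous fun q : ℝ × ℝ × ℝ =>
          (q.1, m q.1 q.2.1, ULS.psi c q.2.2))
      exact this.sub hmc)
    (fun t x y => by simp only [hfper, hm, hαper t, hβper t])
    (fun t x y => by
      have h1 := abs_le.1 (hFb t (m t x) (ULS.psi c y) (hmA t x) (ULS.psi_lt hc y).le)
      have h2 := abs_le.1 (hmA t x)
      rw [abs_le]
      constructor <;> linarith)
  have hxβ : ∀ t, x t ≤ β t := by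
    refine ULS.compare hT ULS.psi_strictMono hxy sβ (fun t h1 h2 => ?_)
    have hmt : m t (x t) = β t := by
      simp only [hm]
      rw [min_eq_left h1.le, max_eq_right (hαβ t)]
    have hb := (abs_le.1 (hAβ t)).2
    have h3 := ULS.lt_cl (R := R) (by linarith) h1
    have h4 := hβupp t
    rw [hmt, h2, ULS.psi_phi hc (hβ' t)]
    linarith
  have hαx : ∀ t, α t ≤ x t := by
    refine ULS.compare hT ULS.psi_strictMono sα hxy (fun t h1 h2 => ?_)
    have hmt : m t (x t) = α t := by
      simp only [hm]
      rw [max_eq_left ((min_le_right _ _).trans h1.le)]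
    have hb := (abs_le.1 (hAα t)).1
    have h3 := ULS.cl_lt (R := R) (by linarith) h1
    have h4 := hαlow t
    rw [hmt, ← h2, ULS.psi_phi hc (hα' t)]
    linarith
  have hdx : deriv x = fun t => ULS.psi c (y t) := funext fun t => (hxy.dx t).deriv
  have hphi : (fun t => phi c (deriv x t)) = y := by
    funext t
    rw [hdx]
    exact ULS.phi_psi hc (y t)
  have hdy : deriv y = fun t => f t (x t) (ULS.psi c (y t)) := by
    funext t
    rw [(hxy.dy t).deriv]
    have h1 : m t (x t) = x t := by
      simp only [hm]
      rw [min_eq_right (hxβ t), max_eq_right (hαx t)]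
    have h2 : |x t| ≤ R := by
      have h3 := abs_le.1 (hAα t)
      have h4 := abs_le.1 (hAβ t)
      rw [abs_le]
      constructor <;> linarith [hαx t, hxβ t]
    rw [h1, ULS.cl_eq h2]
    ring
  have hxc : Continuous x := continuous_iff_continuousAt.2 fun t => (hxy.dx t).continuousAt
  have hyc : Continuous y := continuous_iff_continuousAt.2 fun t => (hxy.dy t).continuousAt
  refine ⟨x, hxy.px, ?_, ?_, ?_, ?_, fun t => ⟨hαx t, hxβ t⟩⟩
  · rw [contDiff_one_iff_deriv]
    refine ⟨fun t => (hxy.dx t).differentiableAt, ?_⟩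
    rw [hdx]
    exact hψc.comp hyc
  · intro t
    rw [hdx]
    exact ULS.psi_lt hc _
  · rw [hphi, contDiff_one_iff_deriv]
    refine ⟨fun t => (hxy.dy t).differentiableAt, ?_⟩
    rw [hdy]
    exact hfcont.comp (by fun_prop : Continuous fun t => (t, x t, ULS.psi c (y t)))
  · intro t
    rw [hphi, hdy, hdx]
end

section
/- Let k = T/(2√3) and suppose c·k < π. Define ψ(δ) = 2δ·cos(δ) + (cT − 2δ)·cos(c·k). If ψ(δ) ≥ 0 for some δ ∈ (0, π/2), then 0 ∈ I(p₀) for every continuous T-periodic p₀ with zero average over [0, T]; that is, the equation (φ(x'(t)))' + a·x'(t) + b·sin(x(t)) = p₀(t) has a T-periodic solution. -/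
open Real Set MeasureTheory

lemma edge_aux (g : ℝ → ℝ) (hg : Continuous g) (m A B s₀ : ℝ) (hs₀ : s₀ ∈ Icc A B)
    (h : ∀ s ∈ Icc A B, 0 < Real.cos (g s - m)) (h0 : |g s₀ - m| < π / 2) :
    ∀ s ∈ Icc A B, |g s - m| < π / 2 := by
  intro s hs
  by_contra hcon
  push Not at hcon
  have hc : ContinuousOn (fun u => |g u - m|) (uIcc s₀ s) := by fun_prop
  have hsub : uIcc s₀ s ⊆ Icc A B := by
    rw [← uIcc_of_le (hs.1.trans hs.2)]
    exact uIcc_subset_uIcc (Icc_subset_uIcc hs₀) (Icc_subset_uIcc hs)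
  have := intermediate_value_uIcc hc
  have hm : π / 2 ∈ uIcc (|g s₀ - m|) (|g s - m|) := Icc_subset_uIcc ⟨h0.le, hcon⟩
  obtain ⟨u, hu, hu'⟩ := this hm
  have h1 := h u (hsub hu)
  simp only at hu'
  rw [← Real.cos_abs, hu', Real.cos_pi_div_two] at h1
  exact lt_irrefl _ h1

lemma poincare_miranda (F G : ℝ × ℝ → ℝ) (hF : Continuous F) (hG : Continuous G) (R : ℝ)
    (hR : 0 < R)
    (hr : ∀ y ∈ Icc (-R) R, 0 < G (R, y)) (hl : ∀ y ∈ Icc (-R) R, G (-R, y) < 0)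
    (ht : ∀ x ∈ Icc (-R) R, 0 < F (x, R)) (hb : ∀ x ∈ Icc (-R) R, F (x, -R) < 0) :
    ∃ x ∈ Icc (-R) R, ∃ y ∈ Icc (-R) R, F (x, y) = 0 ∧ G (x, y) = 0 := by
  by_contra hcon
  push Not at hcon
  set cl : ℝ → ℝ := fun s => max (-R) (min R s) with hcl
  have clc : Continuous cl := by fun_prop
  have clm : ∀ s, cl s ∈ Icc (-R) R := fun s =>
    ⟨le_max_left _ _, max_le (by linarith) (min_le_left _ _)⟩
  have cle : ∀ s ∈ Icc (-R) R, cl s = s := fun s hs => by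
    simp only [hcl]; rw [min_eq_right hs.2, max_eq_right hs.1]
  let f : C(ℝ × ℝ, ℂ) := ⟨fun z => ⟨G (cl z.1, cl z.2), F (cl z.1, cl z.2)⟩, by
    rw [show (fun z : ℝ × ℝ => (⟨G (cl z.1, cl z.2), F (cl z.1, cl z.2)⟩ : ℂ)) =
      fun z : ℝ × ℝ => ((G (cl z.1, cl z.2) : ℝ) : ℂ) + ((F (cl z.1, cl z.2) : ℝ) : ℂ) * Complex.I from
      funext fun z => Complex.mk_eq_add_mul_I _ _]
    fun_prop⟩
  have hf0 : ∀ z, f z ∈ ({0}ᶜ : Set ℂ) := by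
    intro z hz
    have h1 : G (cl z.1, cl z.2) = 0 := congrArg Complex.re hz
    have h2 : F (cl z.1, cl z.2) = 0 := congrArg Complex.im hz
    exact hcon _ (clm z.1) _ (clm z.2) h2 h1
  have hRm : R ∈ Icc (-R) R := ⟨by linarith, le_rfl⟩
  have hRm' : -R ∈ Icc (-R) R := ⟨le_rfl, by linarith⟩
  obtain ⟨g, ⟨hg0, hg⟩, -⟩ := Complex.isCoveringMapOn_exp.existsUnique_continuousMap_lifts f
    (a₀ := (R, R)) (e₀ := Complex.log (f (R, R))) (Complex.exp_log (hf0 _)) hf0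
  set θ : ℝ → ℝ → ℝ := fun x y => (g (x, y)).im with hθ
  have hGθ : ∀ x ∈ Icc (-R) R, ∀ y ∈ Icc (-R) R,
      G (x, y) = Real.exp (g (x, y)).re * Real.cos (θ x y) := by
    intro x hx y hy
    have := congrArg Complex.re (congrFun hg (x, y))
    simp only [Function.comp, Complex.exp_re] at this
    rw [this]; simp [f, cle x hx, cle y hy]
  have hFθ : ∀ x ∈ Icc (-R) R, ∀ y ∈ Icc (-R) R,
      F (x, y) = Real.exp (g (x, y)).re * Real.sin (θ x y) := by
    intro x hx y hy
    have := congrArg Complex.im (congrFun hg (x, y))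
    simp only [Function.comp, Complex.exp_im] at this
    rw [this]; simp [f, cle x hx, cle y hy]
  have hθ0 : |θ R R| < π / 2 := by
    simp only [hθ, hg0, Complex.log_im]
    rw [Complex.abs_arg_lt_pi_div_two_iff]
    left
    have := hr R hRm
    simpa [f, cle R hRm] using this
  have cosr : ∀ y ∈ Icc (-R) R, 0 < Real.cos (θ R y) := fun y hy => by
    have := hr y hy
    rw [hGθ R hRm y hy] at this
    exact pos_of_mul_pos_right this (Real.exp_pos _).le
  have cosl : ∀ y ∈ Icc (-R) R, 0 < -Real.cos (θ (-R) y) := fun y hy => by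
    have := hl y hy
    rw [hGθ (-R) hRm' y hy] at this
    exact pos_of_mul_pos_right (by linarith : 0 < Real.exp (g (-R, y)).re * -Real.cos (θ (-R) y)) (Real.exp_pos _).le
  have sint : ∀ x ∈ Icc (-R) R, 0 < Real.sin (θ x R) := fun x hx => by
    have := ht x hx
    rw [hFθ x hx R hRm] at this
    exact pos_of_mul_pos_right this (Real.exp_pos _).le
  have sinb : ∀ x ∈ Icc (-R) R, 0 < -Real.sin (θ x (-R)) := fun x hx => by
    have := hb x hx
    rw [hFθ x hx (-R) hRm'] at this
    exact pos_of_mul_pos_right (by linarith : 0 < Real.exp (g (x, -R)).re * -Real.sin (θ x (-R))) (Real.exp_pos _).le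
  have e1 := edge_aux (fun y => θ R y) (by fun_prop) 0 (-R) R R hRm
    (fun s hs => by simpa using cosr s hs) (by simpa using hθ0) (-R) hRm'
  have hpi := Real.pi_pos
  have e2 := edge_aux (fun x => θ x R) (by fun_prop) (π / 2) (-R) R R hRm
    (fun s hs => by simpa [Real.cos_sub] using sint s hs) (by
      rw [abs_lt] at hθ0 ⊢
      have : 0 < θ R R := by
        by_contra hn
        push Not at hn
        have := Real.sin_nonpos_of_nonpos_of_neg_pi_le hn (by linarith)
        linarith [sint R hRm]
      constructor <;> linarith) (-R) hRm'
  have e3 := edge_aux (fun y => θ (-R) y) (by fun_prop) π (-R) R R hRm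
    (fun s hs => by simpa [Real.cos_sub] using cosl s hs) (by
      rw [abs_lt] at e2 ⊢
      have : π / 2 < θ (-R) R := by
        by_contra hn
        push Not at hn
        have := Real.cos_nonneg_of_neg_pi_div_two_le_of_le (by linarith) hn
        linarith [cosl R hRm]
      constructor <;> linarith) (-R) hRm'
  have hc3 : ∀ u : ℝ, Real.cos (u - 3 * π / 2) = - Real.sin u := by
    intro u
    rw [show u - 3 * π / 2 = (u + π / 2) - 2 * π by ring, Real.cos_sub_two_pi, Real.cos_add_pi_div_two]
  have e4 := edge_aux (fun x => θ x (-R)) (by fun_prop) (3 * π / 2) (-R) R (-R) hRm'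
    (fun s hs => by simpa [hc3] using sinb s hs) (by
      rw [abs_lt] at e3 ⊢
      have : π < θ (-R) (-R) := by
        by_contra hn
        push Not at hn
        have := Real.sin_nonneg_of_nonneg_of_le_pi (by linarith) hn
        linarith [sinb (-R) hRm']
      constructor <;> linarith) R hRm
  rw [abs_lt] at e1 e4
  linarith [e1.2, e4.1]

lemma per_ext (x : ℝ → ℝ) (T c : ℝ) (hT : 0 < T) (hc : 0 ≤ c)
    (hx : ∀ s ∈ Icc 0 T, ∀ t ∈ Icc 0 T, |x t - x s| ≤ c * |t - s|) (h0 : x T = x 0) :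
    ∃ X : ℝ → ℝ, Function.Periodic X T ∧ (∀ s t, |X t - X s| ≤ c * |t - s|) ∧
      ∀ t ∈ Icc 0 T, X t = x t := by
  refine ⟨fun t => x (toIcoMod hT 0 t), fun t => by simp, ?_, ?_⟩
  · have key : ∀ s t, s ≤ t → |x (toIcoMod hT 0 t) - x (toIcoMod hT 0 s)| ≤ c * |t - s| := by
      intro s t hst
      have hs := toIcoMod_mem_Ico hT 0 s
      have ht := toIcoMod_mem_Ico hT 0 t
      have es := toIcoMod_add_toIcoDiv_zsmul hT 0 s
      have et := toIcoMod_add_toIcoDiv_zsmul hT 0 t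
      simp only [zsmul_eq_mul] at es et
      set s' := toIcoMod hT 0 s
      set t' := toIcoMod hT 0 t
      set m := toIcoDiv hT 0 s
      set n := toIcoDiv hT 0 t
      rw [zero_add] at hs ht
      rw [abs_of_nonneg (sub_nonneg.2 hst)]
      rcases lt_trichotomy m n with h | h | h
      · have h1 : (m : ℝ) + 1 ≤ n := by exact_mod_cast h
        have a1 := hx 0 ⟨le_rfl, hT.le⟩ t' ⟨ht.1, ht.2.le⟩
        have a2 := hx s' ⟨hs.1, hs.2.le⟩ T ⟨hT.le, le_rfl⟩
        rw [sub_zero, abs_of_nonneg ht.1] at a1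
        rw [abs_of_nonneg (by linarith [hs.2] : 0 ≤ T - s'), h0] at a2
        have : t' + (T - s') ≤ t - s := by nlinarith
        calc |x t' - x s'| ≤ |x t' - x 0| + |x 0 - x s'| := abs_sub_le _ _ _
          _ ≤ c * t' + c * (T - s') := add_le_add a1 a2
          _ = c * (t' + (T - s')) := by ring
          _ ≤ _ := mul_le_mul_of_nonneg_left this hc
      · have := hx s' ⟨hs.1, hs.2.le⟩ t' ⟨ht.1, ht.2.le⟩
        have e : t - s = t' - s' := by rw [← es, ← et, h]; ring
        rw [e]
        have : 0 ≤ t' - s' := by rw [← e]; linarith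
        rwa [abs_of_nonneg this] at *
      · exfalso
        have h1 : (n : ℝ) + 1 ≤ m := by exact_mod_cast h
        nlinarith [hs.1, ht.2]
    intro s t
    rcases le_total s t with h | h
    · exact key s t h
    · rw [abs_sub_comm, abs_sub_comm t s]; exact key t s h
  · intro t ht
    rcases eq_or_lt_of_le ht.2 with h | h
    · subst h
      have : toIcoMod hT 0 t = 0 := by
        have := toIcoMod_apply_right hT 0
        rwa [zero_add] at this
      simp only [this, h0]
    · have : toIcoMod hT 0 t = t := (toIcoMod_eq_self hT).2 ⟨ht.1, by simpa using h⟩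
      simp only [this]

lemma osc_bound (X : ℝ → ℝ) (T c : ℝ) (hT : 0 < T) (hX : Continuous X)
    (hper : Function.Periodic X T) (hL : ∀ s t, |X t - X s| ≤ c * |t - s|) (τ : ℝ) :
    |X τ - (∫ t in (0:ℝ)..T, X t) / T| ≤ c * T / 4 := by
  have e1 : ∫ t in (0:ℝ)..T, X t = ∫ t in (τ - T / 2)..(τ + T / 2), X t := by
    have := hper.intervalIntegral_add_eq 0 (τ - T / 2)
    rw [zero_add, show τ - T / 2 + T = τ + T / 2 by ring] at this
    exact this
  have e2 : ∫ t in (τ - T / 2)..(τ + T / 2), (X τ - X t) = T * X τ - ∫ t in (0:ℝ)..T, X t := by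
    rw [intervalIntegral.integral_sub (by simp) (hX.intervalIntegrable _ _), e1]
    simp
  have e3 : ∫ t in (τ - T / 2)..(τ + T / 2), c * |t - τ| = c * T ^ 2 / 4 := by
    rw [intervalIntegral.integral_const_mul,
      intervalIntegral.integral_comp_sub_right (fun u => |u|) τ,
      ← intervalIntegral.integral_add_adjacent_intervals (b := 0)
        (continuous_abs.intervalIntegrable _ _) (continuous_abs.intervalIntegrable _ _)]
    have i1 : ∫ u in (τ - T / 2 - τ)..0, |u| = ∫ u in (τ - T / 2 - τ)..0, -u := by
      apply intervalIntegral.integral_congr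
      intro u hu
      rw [uIcc_of_le (by linarith)] at hu
      exact abs_of_nonpos hu.2
    have i2 : ∫ u in (0:ℝ)..(τ + T / 2 - τ), |u| = ∫ u in (0:ℝ)..(τ + T / 2 - τ), u := by
      apply intervalIntegral.integral_congr
      intro u hu
      rw [uIcc_of_le (by linarith)] at hu
      exact abs_of_nonneg hu.1
    rw [i1, i2, intervalIntegral.integral_neg, integral_id, integral_id]
    ring
  have e4 : |∫ t in (τ - T / 2)..(τ + T / 2), (X τ - X t)| ≤
      ∫ t in (τ - T / 2)..(τ + T / 2), c * |t - τ| := by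
    refine (intervalIntegral.abs_integral_le_integral_abs (by linarith)).trans ?_
    refine intervalIntegral.integral_mono_on (by linarith) ?_ ?_ ?_
    · exact Continuous.intervalIntegrable (by fun_prop) _ _
    · exact Continuous.intervalIntegrable (by fun_prop) _ _
    · intro t _
      rw [abs_sub_comm t τ]; exact hL t τ
  rw [e2, e3] at e4
  have : X τ - (∫ t in (0:ℝ)..T, X t) / T = (T * X τ - ∫ t in (0:ℝ)..T, X t) / T := by
    field_simp
  rw [this, abs_div, abs_of_pos hT, div_le_iff₀ hT]
  linarith [e4, (by ring : c * T / 4 * T = c * T ^ 2 / 4)]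

lemma exists_zero_mean (X : ℝ → ℝ) (T : ℝ) (hT : 0 < T) (hX : Continuous X) :
    ∃ τ, X τ = (∫ t in (0:ℝ)..T, X t) / T := by
  obtain ⟨τ, -, h⟩ := exists_eq_interval_average (f := X) hT.ne hX.continuousOn
  refine ⟨τ, ?_⟩
  rw [h, interval_average_eq_div, sub_zero]

lemma cos_integral_nonneg (X : ℝ → ℝ) (T c : ℝ) (hc : 0 < c) (hT : 0 < T)
    (hper : Function.Periodic X T) (hL : ∀ s t, |X t - X s| ≤ c * |t - s|)
    (hk : c * (T / (2 * Real.sqrt 3)) < Real.pi)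
    (hψ : ∃ δ : ℝ, δ ∈ Set.Ioo 0 (Real.pi / 2) ∧
      0 ≤ 2 * δ * Real.cos δ + (c * T - 2 * δ) * Real.cos (c * (T / (2 * Real.sqrt 3)))) :
    0 ≤ ∫ t in (0:ℝ)..T, Real.cos (X t - (∫ t in (0:ℝ)..T, X t) / T) := by
  have hX : Continuous X := by
    have : LipschitzWith (Real.toNNReal c) X := LipschitzWith.of_dist_le_mul fun s t => by
      rw [Real.dist_eq, Real.dist_eq, Real.coe_toNNReal _ hc.le]; exact hL t s
    exact this.continuous
  have hb := osc_bound X T c hT hX hper hL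
  obtain ⟨τ, hτ⟩ := exists_zero_mean X T hT hX
  set m := (∫ t in (0:ℝ)..T, X t) / T with hm
  have hcT := mul_pos hc hT
  have hkk : c * T / 4 ≤ c * (T / (2 * Real.sqrt 3)) := by
    rw [← mul_div_assoc]
    apply div_le_div_of_nonneg_left hcT.le (by positivity)
    nlinarith [Real.sq_sqrt (show (0:ℝ) ≤ 3 by norm_num), Real.sqrt_nonneg 3]
  set κ := c * (T / (2 * Real.sqrt 3)) with hκ
  rcases le_or_gt (c * T / 4) (π / 2) with hsmall | hbig
  · apply intervalIntegral.integral_nonneg hT.le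
    intro t _
    have := abs_le.1 (hb t)
    exact Real.cos_nonneg_of_neg_pi_div_two_le_of_le (by linarith) (by linarith)
  obtain ⟨δ, ⟨hδ0, hδ⟩, hψ⟩ := hψ
  have hcc : ∀ u v : ℝ, |u| ≤ v → v ≤ π → Real.cos v ≤ Real.cos u := by
    intro u v h1 h2
    rw [← Real.cos_abs u]
    exact Real.cos_le_cos_of_nonneg_of_le_pi (abs_nonneg _) h2 h1
  have hcont : Continuous fun t => Real.cos (X t - m) := by fun_prop
  have hper' : Function.Periodic (fun t => Real.cos (X t - m)) T := fun t => by
    simp only [hper t]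
  have e1 : ∫ t in (0:ℝ)..T, Real.cos (X t - m) =
      ∫ t in (τ - T / 2)..(τ + T / 2), Real.cos (X t - m) := by
    have := hper'.intervalIntegral_add_eq 0 (τ - T / 2)
    rw [zero_add, show τ - T / 2 + T = τ + T / 2 by ring] at this
    exact this
  have hd : δ / c < T / 2 := by
    rw [div_lt_iff₀ hc]; linarith [Real.pi_pos]
  have hd0 : 0 < δ / c := div_pos hδ0 hc
  have hI := fun p q : ℝ => hcont.intervalIntegrable (μ := volume) p q
  rw [e1, ← intervalIntegral.integral_add_adjacent_intervals (hI _ (τ - δ / c)) (hI _ _),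
    ← intervalIntegral.integral_add_adjacent_intervals (hI (τ - δ / c) (τ + δ / c)) (hI _ _)]
  have low : ∀ p q C : ℝ, p ≤ q → (∀ t ∈ Icc p q, C ≤ Real.cos (X t - m)) →
      (q - p) * C ≤ ∫ t in p..q, Real.cos (X t - m) := by
    intro p q C hpq h
    have := intervalIntegral.integral_mono_on (μ := volume) hpq (f := fun _ => C)
      (by simp) (hI p q) h
    simpa using this
  have l1 := low (τ - T / 2) (τ - δ / c) (Real.cos κ) (by linarith)
    (fun t _ => hcc _ _ ((hb t).trans hkk) hk.le)
  have l3 := low (τ + δ / c) (τ + T / 2) (Real.cos κ) (by linarith)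
    (fun t _ => hcc _ _ ((hb t).trans hkk) hk.le)
  have l2 := low (τ - δ / c) (τ + δ / c) (Real.cos δ) (by linarith)
    (fun t ht => hcc _ _ (by
      rw [← hτ]
      refine (hL τ t).trans ?_
      have : |t - τ| ≤ δ / c := abs_le.2 ⟨by linarith [ht.1], by linarith [ht.2]⟩
      calc c * |t - τ| ≤ c * (δ / c) := mul_le_mul_of_nonneg_left this hc.le
        _ = δ := by field_simp) (by linarith [Real.pi_pos]))
  have : 0 ≤ (2 * δ * Real.cos δ + (c * T - 2 * δ) * Real.cos κ) / c := div_nonneg hψ hc.le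
  have e : (2 * δ * Real.cos δ + (c * T - 2 * δ) * Real.cos κ) / c =
    2 * (δ / c) * Real.cos δ + (T - 2 * (δ / c)) * Real.cos κ := by field_simp
  rw [e] at this
  nlinarith [l1, l2, l3]


noncomputable def wInv (c y : ℝ) : ℝ := y / Real.sqrt (1 + y ^ 2 / c ^ 2)

lemma wInv_S (c y : ℝ) : 1 ≤ Real.sqrt (1 + y ^ 2 / c ^ 2) := by
  rw [Real.one_le_sqrt]
  have : 0 ≤ y ^ 2 / c ^ 2 := by positivity
  linarith

lemma wInv_sq (c y : ℝ) : Real.sqrt (1 + y ^ 2 / c ^ 2) ^ 2 = 1 + y ^ 2 / c ^ 2 :=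
  Real.sq_sqrt (by positivity)

lemma phi_wInv (c y : ℝ) (hc : 0 < c) : phi c (wInv c y) = y := by
  unfold phi wInv
  have h1 := wInv_S c y
  have h2 := wInv_sq c y
  set S := Real.sqrt (1 + y ^ 2 / c ^ 2)
  have hS : 0 < S := by linarith
  have : 1 - (y / S) ^ 2 / c ^ 2 = (1 / S) ^ 2 := by
    have : y ^ 2 / c ^ 2 = S ^ 2 - 1 := by linarith
    have e : (y / S) ^ 2 / c ^ 2 = (y ^ 2 / c ^ 2) / S ^ 2 := by field_simp
    rw [e, this]; field_simp; ring
  rw [this, Real.sqrt_sq (by positivity)]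
  field_simp

lemma abs_wInv_lt (c y : ℝ) (hc : 0 < c) : |wInv c y| < c := by
  unfold wInv
  have h1 := wInv_S c y
  have h2 := wInv_sq c y
  set S := Real.sqrt (1 + y ^ 2 / c ^ 2)
  have hS : 0 < S := by linarith
  rw [abs_div, abs_of_pos hS, div_lt_iff₀ hS]
  apply abs_lt_of_sq_lt_sq _ (by positivity)
  rw [mul_pow, h2]
  field_simp
  nlinarith [sq_pos_of_pos hc]

lemma wInv_pos (c y : ℝ) (hy : 0 < y) : 0 < wInv c y :=
  div_pos hy (by linarith [wInv_S c y])

lemma wInv_neg (c y : ℝ) (hy : y < 0) : wInv c y < 0 :=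
  div_neg_of_neg_of_pos hy (by linarith [wInv_S c y])

lemma hasDerivAt_wInv (c y : ℝ) :
    HasDerivAt (wInv c) (1 / Real.sqrt (1 + y ^ 2 / c ^ 2) ^ 3) y := by
  have h1 := wInv_S c y
  have h2 := wInv_sq c y
  have hpos : (1 + y ^ 2 / c ^ 2) ≠ 0 := by positivity
  have hd : HasDerivAt (fun y : ℝ => 1 + y ^ 2 / c ^ 2) (2 * y / c ^ 2) y := by
    have := ((hasDerivAt_pow 2 y).div_const (c ^ 2)).const_add 1
    simpa using this
  have := (hasDerivAt_id y).div (hd.sqrt hpos) (by linarith)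
  refine (this.congr_deriv ?_ : HasDerivAt (wInv c) _ y)
  set S := Real.sqrt (1 + y ^ 2 / c ^ 2)
  have hS : 0 < S := by linarith
  have e : id y * (2 * y / c ^ 2 / (2 * S)) = (y ^ 2 / c ^ 2) / S := by
    simp only [id]; field_simp
  rw [e, (by linarith : y ^ 2 / c ^ 2 = S ^ 2 - 1)]
  field_simp
  ring

lemma lip_wInv (c : ℝ) (u v : ℝ) : |wInv c u - wInv c v| ≤ |u - v| := by
  have h : LipschitzWith 1 (wInv c) := by
    apply lipschitzWith_of_nnnorm_deriv_le (fun y => (hasDerivAt_wInv c y).differentiableAt)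
    intro y
    rw [(hasDerivAt_wInv c y).deriv, ← NNReal.coe_le_coe, coe_nnnorm, NNReal.coe_one,
      Real.norm_eq_abs, abs_of_nonneg (by positivity)]
    have h1 := wInv_S c y
    rw [div_le_one (by positivity)]
    exact one_le_pow₀ h1
  simpa [Real.dist_eq] using h.dist_le_mul u v

lemma continuous_wInv (c : ℝ) : Continuous (wInv c) :=
  continuous_iff_continuousAt.2 fun y => (hasDerivAt_wInv c y).continuousAt

lemma flow_exists (c a b T R P : ℝ) (p : ℝ → ℝ) (hc : 0 < c) (ha : 0 < a) (hb : 0 < b)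
    (hT : 0 < T) (hR : 0 < R) (hp : Continuous p) (hP0 : 0 ≤ P)
    (hP : ∀ t ∈ Icc 0 T, |p t| ≤ P) :
    ∃ x y : ℝ × ℝ → ℝ → ℝ, Continuous (Function.uncurry x) ∧ Continuous (Function.uncurry y) ∧
      ∀ z : ℝ × ℝ, z.1 ∈ Icc (-R) R → z.2 ∈ Icc (-R) R →
        x z 0 = z.1 ∧ y z 0 = z.2 ∧ ∀ t ∈ Ioo 0 T,
          HasDerivAt (x z) (wInv c (y z t)) t ∧
          HasDerivAt (y z) (p t - a * wInv c (y z t) - b * Real.sin (x z t)) t := by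
  let V : ℝ → ℝ × ℝ → ℝ × ℝ := fun t z =>
    (wInv c z.2, p t - a * wInv c z.2 - b * Real.sin z.1)
  have hw := continuous_wInv c
  let L : ℝ := c + P + a * c + b
  have hL : 0 ≤ L := by positivity
  have hPL : IsPicardLindelof V (tmin := 0) (tmax := T) ⟨0, le_rfl, hT.le⟩ (0 : ℝ × ℝ)
      (Real.toNNReal (R + L * T)) (Real.toNNReal R) (Real.toNNReal L)
      (Real.toNNReal (1 + a + b)) := by
    constructor
    · intro t _
      apply LipschitzWith.lipschitzOnWith
      apply LipschitzWith.of_dist_le_mul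
      intro z z'
      rw [Real.coe_toNNReal _ (by positivity)]
      have d1 : |z.1 - z'.1| ≤ dist z z' := by rw [← Real.dist_eq]; exact le_max_left _ _
      have d2 : |z.2 - z'.2| ≤ dist z z' := by rw [← Real.dist_eq]; exact le_max_right _ _
      have l := lip_wInv c z.2 z'.2
      have d0 : 0 ≤ dist z z' := dist_nonneg
      rw [Prod.dist_eq]
      apply max_le
      · rw [Real.dist_eq]
        change |wInv c z.2 - wInv c z'.2| ≤ _
        nlinarith
      · rw [Real.dist_eq]
        change |(p t - a * wInv c z.2 - b * Real.sin z.1) -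
          (p t - a * wInv c z'.2 - b * Real.sin z'.1)| ≤ _
        have s : |Real.sin z.1 - Real.sin z'.1| ≤ |z.1 - z'.1| := by
          simpa [Real.dist_eq] using Real.lipschitzWith_sin.dist_le_mul z.1 z'.1
        have : (p t - a * wInv c z.2 - b * Real.sin z.1) -
          (p t - a * wInv c z'.2 - b * Real.sin z'.1) =
          -(a * (wInv c z.2 - wInv c z'.2)) + -(b * (Real.sin z.1 - Real.sin z'.1)) := by ring
        rw [this]
        refine (abs_add_le _ _).trans ?_
        rw [abs_neg, abs_neg, abs_mul, abs_mul, abs_of_pos ha, abs_of_pos hb]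
        nlinarith
    · intro z _
      apply Continuous.continuousOn
      simp only [V]
      fun_prop
    · intro t ht z _
      rw [Real.coe_toNNReal _ hL, Prod.norm_def]
      have h1 := (abs_wInv_lt c z.2 hc).le
      have h2 := hP t ht
      have h3 := Real.abs_sin_le_one z.1
      apply max_le
      · rw [Real.norm_eq_abs]
        change |wInv c z.2| ≤ _
        simp only [L]
        nlinarith [mul_pos ha hc]
      · rw [Real.norm_eq_abs]
        change |p t - a * wInv c z.2 - b * Real.sin z.1| ≤ _
        rw [abs_le] at *
        simp only [L]
        constructor <;> nlinarith
    · rw [Real.coe_toNNReal _ hL, Real.coe_toNNReal _ hR.le,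
        Real.coe_toNNReal _ (by positivity)]
      simp [hT.le]
  obtain ⟨α, hα, hαc⟩ := hPL.exists_forall_mem_closedBall_eq_hasDerivWithinAt_continuousOn
  rw [Real.coe_toNNReal _ hR.le] at hα hαc
  have hball : ∀ z : ℝ × ℝ, z ∈ Metric.closedBall (0 : ℝ × ℝ) R ↔
      z.1 ∈ Icc (-R) R ∧ z.2 ∈ Icc (-R) R := by
    intro z
    rw [mem_closedBall_zero_iff, Prod.norm_def, max_le_iff, Real.norm_eq_abs, Real.norm_eq_abs,
      abs_le, abs_le]; rfl
  set cl : ℝ → ℝ := fun s => max (-R) (min R s) with hcl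
  have clc : Continuous cl := by fun_prop
  have clm : ∀ s, cl s ∈ Icc (-R) R := fun s =>
    ⟨le_max_left _ _, max_le (by linarith) (min_le_left _ _)⟩
  have cle : ∀ s ∈ Icc (-R) R, cl s = s := fun s hs => by
    simp only [hcl]; rw [min_eq_right hs.2, max_eq_right hs.1]
  set ct : ℝ → ℝ := fun s => max 0 (min T s) with hct
  have ctc : Continuous ct := by fun_prop
  have ctm : ∀ s, ct s ∈ Icc 0 T := fun s =>
    ⟨le_max_left _ _, max_le hT.le (min_le_left _ _)⟩
  have cte : ∀ s ∈ Icc 0 T, ct s = s := fun s hs => by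
    simp only [hct]; rw [min_eq_right hs.2, max_eq_right hs.1]
  have hβ : Continuous fun q : (ℝ × ℝ) × ℝ => α ((cl q.1.1, cl q.1.2), ct q.2) := by
    apply hαc.comp_continuous (by fun_prop)
    intro q
    exact ⟨(hball _).2 ⟨clm _, clm _⟩, ctm _⟩
  refine ⟨fun z t => (α ((cl z.1, cl z.2), ct t)).1, fun z t => (α ((cl z.1, cl z.2), ct t)).2,
    continuous_fst.comp hβ, continuous_snd.comp hβ, ?_⟩
  intro z h1 h2
  have hz : ((cl z.1, cl z.2) : ℝ × ℝ) = z := by rw [cle _ h1, cle _ h2]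
  obtain ⟨h0, hd⟩ := hα z ((hball z).2 ⟨h1, h2⟩)
  simp only [hz]
  have c0 : ct 0 = 0 := cte 0 ⟨le_rfl, hT.le⟩
  refine ⟨by rw [c0]; exact congrArg Prod.fst h0, by rw [c0]; exact congrArg Prod.snd h0, ?_⟩
  intro t ht
  have hd1 := (hd t (Ioo_subset_Icc_self ht)).hasDerivAt (Icc_mem_nhds ht.1 ht.2)
  have hd2 : HasDerivAt (fun s => α (z, ct s)) (V t (α (z, t))) t := by
    apply hd1.congr_of_eventuallyEq
    filter_upwards [Icc_mem_nhds ht.1 ht.2] with s hs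
    simp only [cte s hs]
  have ctt : ct t = t := cte t (Ioo_subset_Icc_self ht)
  rw [ctt]
  exact ⟨(ContinuousLinearMap.fst ℝ ℝ ℝ).hasFDerivAt.comp_hasDerivAt t hd2,
    (ContinuousLinearMap.snd ℝ ℝ ℝ).hasFDerivAt.comp_hasDerivAt t hd2⟩

lemma lip_of_deriv (f f' : ℝ → ℝ) (T C : ℝ) (hf : Continuous f)
    (hd : ∀ t ∈ Ioo 0 T, HasDerivAt f (f' t) t) (hC : ∀ t ∈ Ioo 0 T, |f' t| ≤ C) :
    ∀ s ∈ Icc 0 T, ∀ t ∈ Icc 0 T, |f t - f s| ≤ C * |t - s| := by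
  have key : ∀ s ∈ Icc 0 T, ∀ t ∈ Icc 0 T, s < t → |f t - f s| ≤ C * |t - s| := by
    intro s hs t ht hst
    obtain ⟨u, hu, h⟩ := exists_hasDerivAt_eq_slope f f' hst hf.continuousOn
      (fun v hv => hd v ⟨hs.1.trans_lt hv.1, hv.2.trans_le ht.2⟩)
    have h1 := hC u ⟨hs.1.trans_lt hu.1, hu.2.trans_le ht.2⟩
    rw [h, abs_div, div_le_iff₀ (abs_pos.2 (by linarith))] at h1
    exact h1
  intro s hs t ht
  rcases lt_trichotomy s t with h | h | h
  · exact key s hs t ht h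
  · subst h; simp
  · rw [abs_sub_comm, abs_sub_comm t s]; exact key t ht s hs h

lemma per_deriv (X h : ℝ → ℝ) (T : ℝ) (hT : 0 < T) (hX : Continuous X) (hh : Continuous h)
    (pX : Function.Periodic X T) (ph : Function.Periodic h T)
    (hd : ∀ t ∈ Ioo 0 T, HasDerivAt X (h t) t) : ∀ t, HasDerivAt X (h t) t := by
  have hI := fun p q : ℝ => hh.intervalIntegrable (μ := volume) p q
  have ftc : ∀ t ∈ Icc 0 T, ∫ s in (0:ℝ)..t, h s = X t - X 0 := by
    intro t ht
    exact intervalIntegral.integral_eq_sub_of_hasDerivAt_of_le ht.1 hX.continuousOn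
      (fun s hs => hd s ⟨hs.1, hs.2.trans_le ht.2⟩) (hI _ _)
  have z : ∫ s in (0:ℝ)..T, h s = 0 := by
    rw [ftc T ⟨hT.le, le_rfl⟩]
    have := pX 0
    rw [zero_add] at this
    linarith
  have pD : Function.Periodic (fun t => X t - ∫ s in (0:ℝ)..t, h s) T := by
    intro t
    have e := ph.intervalIntegral_add_eq t 0
    rw [zero_add, z] at e
    have := intervalIntegral.integral_add_adjacent_intervals (hI 0 t) (hI t (t + T))
    simp only [pX t]
    linarith
  have all : ∀ t, X t = X 0 + ∫ s in (0:ℝ)..t, h s := by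
    intro t
    obtain ⟨u, hu, e⟩ := pD.exists_mem_Ico₀ hT t
    have := ftc u (Ico_subset_Icc_self hu)
    linarith
  intro t
  have : HasDerivAt (fun t => X 0 + ∫ s in (0:ℝ)..t, h s) (h t) t :=
    (intervalIntegral.integral_hasDerivAt_right (hI 0 t)
      (hh.stronglyMeasurableAtFilter _ _) hh.continuousAt).const_add _
  rwa [← funext all] at this

/-- if `ψ(δ) ≥ 0` for some `δ ∈ (0, π/2)` (with `k = T/(2√3)`, `ck < π`),
then `0 ∈ I(p₀)` for every admissible forcing `p₀`. -/
theorem zero_mem_solvSet_of_psi_nonneg (c a b T : ℝ) (hc : 0 < c) (ha : 0 < a) (hb : 0 < b)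
    (hT : 0 < T) (hk : c * (T / (2 * Real.sqrt 3)) < Real.pi)
    (hψ : ∃ δ : ℝ, δ ∈ Set.Ioo 0 (Real.pi / 2) ∧
      0 ≤ 2 * δ * Real.cos δ + (c * T - 2 * δ) * Real.cos (c * (T / (2 * Real.sqrt 3)))) :
    ∀ p₀ : ℝ → ℝ, Continuous p₀ → Function.Periodic p₀ T →
      (∫ t in (0:ℝ)..T, p₀ t) = 0 → (0 : ℝ) ∈ solvSet c a b T p₀ := by
  intro p hp hper hint
  have hpi := Real.pi_pos
  have hw := continuous_wInv c
  obtain ⟨P, hP⟩ := isCompact_Icc.exists_bound_of_continuousOn (hp.continuousOn (s := Icc 0 T))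
  simp only [Real.norm_eq_abs] at hP
  have hP0 : 0 ≤ P := (abs_nonneg _).trans (hP 0 ⟨le_rfl, hT.le⟩)
  set B : ℝ := P + a * c + b with hB
  have hB0 : 0 ≤ B := by positivity
  set R : ℝ := (c * T + π / 2 + T + 1) + (B * T + 1) with hRdef
  have hcT := mul_pos hc hT
  have hBT : 0 ≤ B * T := mul_nonneg hB0 hT.le
  have hR : 0 < R := by linarith
  obtain ⟨x, y, hx, hy, hsol⟩ := flow_exists c a b T R P p hc ha hb hT hR hp hP0 hP
  have hxz : ∀ z, Continuous (x z) := fun z => hx.comp (by fun_prop : Continuous fun t => (z, t))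
  have hyz : ∀ z, Continuous (y z) := fun z => hy.comp (by fun_prop : Continuous fun t => (z, t))
  have hxt : ∀ t, Continuous fun z => x z t :=
    fun t => hx.comp (by fun_prop : Continuous fun z : ℝ × ℝ => (z, t))
  have xL : ∀ z : ℝ × ℝ, z.1 ∈ Icc (-R) R → z.2 ∈ Icc (-R) R →
      ∀ s ∈ Icc 0 T, ∀ t ∈ Icc 0 T, |x z t - x z s| ≤ c * |t - s| := fun z h1 h2 =>
    lip_of_deriv (x z) _ T c (hxz z) (fun t ht => ((hsol z h1 h2).2.2 t ht).1)
      (fun t _ => (abs_wInv_lt c _ hc).le)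
  have yL : ∀ z : ℝ × ℝ, z.1 ∈ Icc (-R) R → z.2 ∈ Icc (-R) R →
      ∀ s ∈ Icc 0 T, ∀ t ∈ Icc 0 T, |y z t - y z s| ≤ B * |t - s| := fun z h1 h2 =>
    lip_of_deriv (y z) _ T B (hyz z) (fun t ht => ((hsol z h1 h2).2.2 t ht).2)
      (fun t ht => by
        have h1 := (abs_wInv_lt c (y z t) hc).le
        have h2 := hP t (Ioo_subset_Icc_self ht)
        have h3 := Real.abs_sin_le_one (x z t)
        rw [abs_le] at *
        rw [hB]
        constructor <;> nlinarith)
  have near : ∀ (f : ℝ → ℝ) (C : ℝ), 0 ≤ C →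
      (∀ s ∈ Icc 0 T, ∀ t ∈ Icc 0 T, |f t - f s| ≤ C * |t - s|) →
      ∀ t ∈ Icc 0 T, |f t - f 0| ≤ C * T := by
    intro f C hC h t ht
    refine (h 0 ⟨le_rfl, hT.le⟩ t ht).trans ?_
    rw [sub_zero, abs_of_nonneg ht.1]
    exact mul_le_mul_of_nonneg_left ht.2 hC
  set m : ℝ × ℝ → ℝ := fun z => (∫ t in (0:ℝ)..T, x z t) / T with hm
  have hmc : Continuous m :=
    (intervalIntegral.continuous_parametric_intervalIntegral_of_continuous' hx 0 T).div_const T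
  set K : ℝ → ℝ := fun r => max (-(π / 2)) (min (π / 2) r) with hK
  have hKc : Continuous K := by fun_prop
  set S : ℝ × ℝ → ℝ := fun z => ∫ t in (0:ℝ)..T, Real.sin (x z t - m z + K (m z)) with hS
  have hSc : Continuous S := by
    apply intervalIntegral.continuous_parametric_intervalIntegral_of_continuous'
    have h1 : Continuous fun q : (ℝ × ℝ) × ℝ => x q.1 q.2 := hx
    change Continuous fun q : (ℝ × ℝ) × ℝ => Real.sin (x q.1 q.2 - m q.1 + K (m q.1))
    fun_prop
  have hSb : ∀ z, |S z| ≤ T := by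
    intro z
    have := intervalIntegral.norm_integral_le_of_norm_le_const (a := 0) (b := T) (C := 1)
      (f := fun t => Real.sin (x z t - m z + K (m z))) (fun t _ => Real.abs_sin_le_one _)
    simpa [abs_of_pos hT] using this
  have hK1 : ∀ r, π / 2 ≤ r → K r = π / 2 := fun r hr => by
    simp only [hK]; rw [min_eq_left hr, max_eq_right (by linarith)]
  have hK2 : ∀ r, r ≤ -(π / 2) → K r = -(π / 2) := fun r hr => by
    simp only [hK]; rw [min_eq_right (by linarith), max_eq_left hr]
  have hK3 : ∀ r, -(π / 2) ≤ r → r ≤ π / 2 → K r = r := fun r h1 h2 => by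
    simp only [hK]; rw [min_eq_right h2, max_eq_right h1]
  have hRm : R ∈ Icc (-R) R := ⟨by linarith, le_rfl⟩
  have hRm' : -R ∈ Icc (-R) R := ⟨le_rfl, by linarith⟩
  have hslope : ∀ z : ℝ × ℝ, z.1 ∈ Icc (-R) R → z.2 ∈ Icc (-R) R →
      ∃ u ∈ Ioo 0 T, wInv c (y z u) = (x z T - x z 0) / T := by
    intro z h1 h2
    obtain ⟨u, hu, h⟩ := exists_hasDerivAt_eq_slope (x z) (fun t => wInv c (y z t)) hT
      (hxz z).continuousOn (fun t ht => ((hsol z h1 h2).2.2 t ht).1)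
    exact ⟨u, hu, by rw [h, sub_zero]⟩
  obtain ⟨z1, hz1, z2, hz2, hF, hG⟩ := poincare_miranda (fun z => x z T - x z 0)
    (fun z => S z + (m z - K (m z))) ((hxt T).sub (hxt 0)) (by fun_prop) R hR
    (by
      intro v hv
      have hm1 : π / 2 + T + 1 ≤ m (R, v) := by
        rw [hm]
        simp only
        rw [le_div_iff₀ hT]
        have := intervalIntegral.integral_mono_on (μ := volume) hT.le
          (f := fun _ => π / 2 + T + 1) (by simp) ((hxz (R, v)).intervalIntegrable 0 T)
          (fun t ht => by
            have h := abs_le.1 (near _ c hc.le (xL (R, v) hRm hv) t ht)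
            rw [(hsol (R, v) hRm hv).1] at h
            simp only at h
            linarith [h.1])
        simp only [intervalIntegral.integral_const, sub_zero, smul_eq_mul] at this
        linarith
      have := abs_le.1 (hSb (R, v))
      rw [hK1 _ (by linarith)]
      linarith)
    (by
      intro v hv
      have hm1 : m (-R, v) ≤ -(π / 2 + T + 1) := by
        rw [hm]
        simp only
        rw [div_le_iff₀ hT]
        have := intervalIntegral.integral_mono_on (μ := volume) hT.le
          (g := fun _ => -(π / 2 + T + 1)) ((hxz (-R, v)).intervalIntegrable 0 T) (by simp)
          (fun t ht => by
            have h := abs_le.1 (near _ c hc.le (xL (-R, v) hRm' hv) t ht)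
            rw [(hsol (-R, v) hRm' hv).1] at h
            simp only at h
            linarith [h.2])
        simp only [intervalIntegral.integral_const, sub_zero, smul_eq_mul] at this
        linarith
      have := abs_le.1 (hSb (-R, v))
      rw [hK2 _ (by linarith)]
      linarith)
    (by
      intro v hv
      obtain ⟨u, hu, h⟩ := hslope (v, R) hv hRm
      have h1 := abs_le.1 (near _ B hB0 (yL (v, R) hv hRm) u (Ioo_subset_Icc_self hu))
      rw [(hsol (v, R) hv hRm).2.1] at h1
      have h2 := wInv_pos c (y (v, R) u) (by simp only at h1; linarith [h1.1])
      rw [h] at h2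
      exact (div_pos_iff_of_pos_right hT).1 h2)
    (by
      intro v hv
      obtain ⟨u, hu, h⟩ := hslope (v, -R) hv hRm'
      have h1 := abs_le.1 (near _ B hB0 (yL (v, -R) hv hRm') u (Ioo_subset_Icc_self hu))
      rw [(hsol (v, -R) hv hRm').2.1] at h1
      have h2 := wInv_neg c (y (v, -R) u) (by simp only at h1; linarith [h1.2])
      rw [h] at h2
      by_contra hn
      push Not at hn
      exact absurd (div_nonneg hn hT.le) (not_le.2 h2))
  set z : ℝ × ℝ := (z1, z2) with hz
  have hxT : x z T = x z 0 := by linarith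
  obtain ⟨X, pX, LX, eX⟩ := per_ext (x z) T c hT hc.le (xL z hz1 hz2) hxT
  have hcos := cos_integral_nonneg X T c hc hT pX LX hk hψ
  have e1 : ∫ t in (0:ℝ)..T, X t = ∫ t in (0:ℝ)..T, x z t :=
    intervalIntegral.integral_congr fun t ht => eX t (by rwa [uIcc_of_le hT.le] at ht)
  rw [e1] at hcos
  have e2 : ∫ t in (0:ℝ)..T, Real.cos (X t - m z) = ∫ t in (0:ℝ)..T, Real.cos (x z t - m z) :=
    intervalIntegral.integral_congr fun t ht => by
      rw [eX t (by rwa [uIcc_of_le hT.le] at ht)]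
  change 0 ≤ ∫ t in (0:ℝ)..T, Real.cos (X t - m z) at hcos
  rw [e2] at hcos
  have hsin : ∫ t in (0:ℝ)..T, Real.sin (x z t) = 0 := by
    rcases lt_or_ge (π / 2) (m z) with h | h
    · exfalso
      have : S z = ∫ t in (0:ℝ)..T, Real.cos (x z t - m z) := by
        simp only [hS]
        rw [hK1 _ h.le]
        simp only [Real.sin_add_pi_div_two]
      rw [this, hK1 _ h.le] at hG
      linarith
    rcases lt_or_ge (m z) (-(π / 2)) with h' | h'
    · exfalso
      have : S z = -∫ t in (0:ℝ)..T, Real.cos (x z t - m z) := by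
        simp only [hS]
        rw [hK2 _ h'.le]
        simp only [← sub_eq_add_neg, Real.sin_sub_pi_div_two, intervalIntegral.integral_neg]
      rw [this, hK2 _ h'.le] at hG
      linarith
    · have : S z = ∫ t in (0:ℝ)..T, Real.sin (x z t) := by
        simp only [hS]
        rw [hK3 _ h' h]
        simp only [sub_add_cancel]
      rw [this, hK3 _ h' h] at hG
      linarith
  have hyzc := hyz z
  have hxzc := hxz z
  have hwi : ∫ t in (0:ℝ)..T, wInv c (y z t) = 0 := by
    rw [intervalIntegral.integral_eq_sub_of_hasDerivAt_of_le hT.le (hxz z).continuousOn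
      (fun t ht => ((hsol z hz1 hz2).2.2 t ht).1)
      ((hw.comp hyzc).intervalIntegrable _ _), hxT, sub_self]
  have hyT : y z T = y z 0 := by
    have := intervalIntegral.integral_eq_sub_of_hasDerivAt_of_le hT.le (hyz z).continuousOn
      (fun t ht => ((hsol z hz1 hz2).2.2 t ht).2)
      (Continuous.intervalIntegrable (by fun_prop) _ _)
    rw [intervalIntegral.integral_sub (Continuous.intervalIntegrable (by fun_prop) _ _)
      (Continuous.intervalIntegrable (by fun_prop) _ _),
      intervalIntegral.integral_sub (Continuous.intervalIntegrable (by fun_prop) _ _)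
      (Continuous.intervalIntegrable (by fun_prop) _ _), intervalIntegral.integral_const_mul,
      intervalIntegral.integral_const_mul, hint, hwi, hsin] at this
    linarith
  obtain ⟨Y, pY, LY, eY⟩ := per_ext (y z) T B hT hB0 (yL z hz1 hz2) hyT
  have cont : ∀ (f : ℝ → ℝ) (C : ℝ), 0 ≤ C → (∀ s t, |f t - f s| ≤ C * |t - s|) →
      Continuous f := by
    intro f C hC h
    have : LipschitzWith (Real.toNNReal C) f := LipschitzWith.of_dist_le_mul fun s t => by
      rw [Real.dist_eq, Real.dist_eq, Real.coe_toNNReal _ hC]; exact h t s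
    exact this.continuous
  have cX := cont X c hc.le LX
  have cY := cont Y B hB0 LY
  have dX : ∀ t, HasDerivAt X (wInv c (Y t)) t := by
    refine per_deriv X (fun t => wInv c (Y t)) T hT cX (by fun_prop) pX
      (fun t => by simp only [pY t]) ?_
    intro t ht
    rw [eY t (Ioo_subset_Icc_self ht)]
    apply ((hsol z hz1 hz2).2.2 t ht).1.congr_of_eventuallyEq
    filter_upwards [Icc_mem_nhds ht.1 ht.2] with s hs using eX s hs
  have dY : ∀ t, HasDerivAt Y (p t - a * wInv c (Y t) - b * Real.sin (X t)) t := by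
    refine per_deriv Y (fun t => p t - a * wInv c (Y t) - b * Real.sin (X t)) T hT cY
      (by fun_prop) pY (fun t => by simp only [pY t, pX t, hper t]) ?_
    intro t ht
    rw [eY t (Ioo_subset_Icc_self ht), eX t (Ioo_subset_Icc_self ht)]
    apply ((hsol z hz1 hz2).2.2 t ht).2.congr_of_eventuallyEq
    filter_upwards [Icc_mem_nhds ht.1 ht.2] with s hs using eY s hs
  have dX' : deriv X = fun t => wInv c (Y t) := funext fun t => (dX t).deriv
  have dY' : deriv Y = fun t => p t - a * wInv c (Y t) - b * Real.sin (X t) :=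
    funext fun t => (dY t).deriv
  have hphi : (fun t => phi c (deriv X t)) = Y := by
    funext t
    rw [dX', phi_wInv c _ hc]
  refine ⟨X, pX, ?_, ?_, ?_, ?_⟩
  · rw [contDiff_one_iff_deriv, dX']
    exact ⟨fun t => (dX t).differentiableAt, by fun_prop⟩
  · intro t
    rw [dX']
    exact abs_wInv_lt c _ hc
  · rw [hphi, contDiff_one_iff_deriv, dY']
    exact ⟨fun t => (dY t).differentiableAt, by fun_prop⟩
  · intro t
    rw [hphi, dX', dY']
    ring
end

section
/- Let k = T/(2√3) and suppose c·k < π. Define ψ(δ) = 2δ·cos(δ) + (cT − 2δ)·cos(c·k). If ψ(δ) > 0 for some δ ∈ (0, π/2), then 0 is an interior point of I(p₀) for every continuous T-periodic p₀ with zero average over [0, T]; that is, there exists ε > 0 such that [−ε, ε] ⊆ I(p₀). -/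
open Real Set MeasureTheory

/-- Positive averaging operator solving `y' = lam (g - y)` periodically. -/
noncomputable def avgOp (T lam : ℝ) (g : ℝ → ℝ) (t : ℝ) : ℝ :=
  lam / (Real.exp (lam * T) - 1) * (Real.exp (-(lam * t)) *
    ∫ s in t..(t + T), Real.exp (lam * s) * g s)

lemma avgOp_coef_pos {T lam : ℝ} (hT : 0 < T) (hl : lam ≠ 0) :
    0 < lam / (Real.exp (lam * T) - 1) := by
  rcases lt_or_gt_of_ne hl with h | h
  · apply div_pos_of_neg_of_neg h
    have : Real.exp (lam * T) < 1 := by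
      rw [Real.exp_lt_one_iff]; exact mul_neg_of_neg_of_pos h hT
    linarith
  · apply div_pos h
    have : 1 < Real.exp (lam * T) := Real.one_lt_exp_iff.2 (mul_pos h hT)
    linarith

lemma avgOp_coef_ne {T lam : ℝ} (hT : 0 < T) (hl : lam ≠ 0) :
    Real.exp (lam * T) - 1 ≠ 0 := by
  intro h
  have := avgOp_coef_pos hT hl
  rw [h] at this
  simp at this

lemma avgOp_hasDerivAt {T lam : ℝ} (hT : 0 < T) (hl : lam ≠ 0) {g : ℝ → ℝ} (hg : Continuous g)
    (hp : Function.Periodic g T) (t : ℝ) :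
    HasDerivAt (avgOp T lam g) (lam * (g t - avgOp T lam g t)) t := by
  have hc : Continuous (fun s => Real.exp (lam * s) * g s) := by fun_prop
  have h0 : ∀ u, HasDerivAt (fun u => ∫ s in (0:ℝ)..u, Real.exp (lam * s) * g s)
      (Real.exp (lam * u) * g u) u := fun u =>
    intervalIntegral.integral_hasDerivAt_right (hc.intervalIntegrable _ _)
      (hc.stronglyMeasurableAtFilter _ _) hc.continuousAt
  have h1 : HasDerivAt (fun u => ∫ s in u..(u + T), Real.exp (lam * s) * g s)
      (Real.exp (lam * (t + T)) * g (t + T) - Real.exp (lam * t) * g t) t := by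
    have := ((h0 (t + T)).comp_add_const t T).sub (h0 t)
    refine this.congr_of_eventuallyEq (Filter.Eventually.of_forall fun u => ?_)
    simp only [Pi.sub_apply]
    rw [intervalIntegral.integral_interval_sub_left (hc.intervalIntegrable _ _)
      (hc.intervalIntegrable _ _)]
  have h2 : HasDerivAt (fun u => Real.exp (-(lam * u))) (Real.exp (-(lam * t)) * (-(lam * 1))) t :=
    (((hasDerivAt_id t).const_mul lam).neg).exp
  have h3 := (h2.mul h1).const_mul (lam / (Real.exp (lam * T) - 1))
  refine h3.congr_deriv ?_
  have hne := avgOp_coef_ne hT hl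
  rw [hp t, avgOp]
  have e1 : Real.exp (lam * (t + T)) = Real.exp (lam * t) * Real.exp (lam * T) := by
    rw [← Real.exp_add]; ring_nf
  have e2 : Real.exp (-(lam * t)) * Real.exp (lam * t) = 1 := by
    rw [← Real.exp_add]; simp
  rw [e1]
  generalize (∫ s in t..(t + T), Real.exp (lam * s) * g s) = I
  have e3 : Real.exp (-(lam * t)) * (Real.exp (lam * t) * Real.exp (lam * T) * g t -
      Real.exp (lam * t) * g t) = (Real.exp (lam * T) - 1) * g t := by
    linear_combination (Real.exp (lam * T) - 1) * g t * e2
  rw [e3]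
  field_simp
  ring

lemma avgOp_continuous {T lam : ℝ} (hT : 0 < T) (hl : lam ≠ 0) {g : ℝ → ℝ} (hg : Continuous g)
    (hp : Function.Periodic g T) : Continuous (avgOp T lam g) :=
  continuous_iff_continuousAt.2 fun t => (avgOp_hasDerivAt hT hl hg hp t).continuousAt

lemma avgOp_periodic {T lam : ℝ} {g : ℝ → ℝ}
    (hp : Function.Periodic g T) : Function.Periodic (avgOp T lam g) T := by
  intro t
  unfold avgOp
  have : (∫ s in (t + T)..(t + T + T), Real.exp (lam * s) * g s)
      = Real.exp (lam * T) * ∫ s in t..(t + T), Real.exp (lam * s) * g s := by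
    rw [← intervalIntegral.integral_comp_add_right (fun s => Real.exp (lam * s) * g s) T,
      ← intervalIntegral.integral_const_mul]
    congr 1
    ext s
    rw [hp s, mul_add, Real.exp_add]; ring
  rw [this, mul_add, neg_add, Real.exp_add]
  have e2 : Real.exp (-(lam * T)) * Real.exp (lam * T) = 1 := by
    rw [← Real.exp_add]; simp
  generalize (∫ s in t..(t + T), Real.exp (lam * s) * g s) = I
  linear_combination lam / (Real.exp (lam * T) - 1) * Real.exp (-(lam * t)) * I * e2

lemma avgOp_le {T lam : ℝ} (hT : 0 < T) (hl : lam ≠ 0) {g g' : ℝ → ℝ} (hg : Continuous g)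
    (hg' : Continuous g') {d : ℝ} (h : ∀ t, g' t ≤ g t + d) (t : ℝ) :
    avgOp T lam g' t ≤ avgOp T lam g t + d := by
  have hc : Continuous (fun s => Real.exp (lam * s) * g s) := by fun_prop
  have hc' : Continuous (fun s => Real.exp (lam * s) * g' s) := by fun_prop
  have hcd : Continuous (fun s => Real.exp (lam * s) * d) := by fun_prop
  have h1 : (∫ s in t..(t + T), Real.exp (lam * s) * g' s) ≤
      ∫ s in t..(t + T), (Real.exp (lam * s) * g s + Real.exp (lam * s) * d) := by
    apply intervalIntegral.integral_mono_on (by linarith) (hc'.intervalIntegrable _ _)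
      ((hc.add hcd).intervalIntegrable _ _)
    intro s _
    show _ ≤ Real.exp (lam * s) * g s + Real.exp (lam * s) * d
    rw [← mul_add]
    exact mul_le_mul_of_nonneg_left (h s) (Real.exp_pos _).le
  rw [intervalIntegral.integral_add (hc.intervalIntegrable _ _) (hcd.intervalIntegrable _ _),
    intervalIntegral.integral_mul_const] at h1
  have h2 : (∫ s in t..(t + T), Real.exp (lam * s)) =
      Real.exp (lam * t) * (Real.exp (lam * T) - 1) / lam := by
    rw [intervalIntegral.integral_comp_mul_left (fun s => Real.exp s) hl, integral_exp]
    rw [mul_add, Real.exp_add, smul_eq_mul]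
    field_simp
  rw [h2] at h1
  have hk := avgOp_coef_pos hT hl
  have hne := avgOp_coef_ne hT hl
  unfold avgOp
  have e2 : Real.exp (-(lam * t)) * Real.exp (lam * t) = 1 := by
    rw [← Real.exp_add]; simp
  have h3 := mul_le_mul_of_nonneg_left
    (mul_le_mul_of_nonneg_left h1 (Real.exp_pos (-(lam * t))).le) hk.le
  refine h3.trans (le_of_eq ?_)
  have e4 : lam / (Real.exp (lam * T) - 1) * (Real.exp (-(lam * t)) *
      (Real.exp (lam * t) * (Real.exp (lam * T) - 1) / lam * d)) =
      (Real.exp (-(lam * t)) * Real.exp (lam * t)) * d := by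
    field_simp
  rw [mul_add, mul_add, e4, e2, one_mul]

/-- The complete space of continuous `T`-periodic functions. -/
lemma periodic_bdd {T : ℝ} (hT : 0 < T) {g : ℝ → ℝ} (hg : Continuous g)
    (hp : Function.Periodic g T) : ∃ C, ∀ t, |g t| ≤ C := by
  obtain ⟨C, hC⟩ := (isCompact_Icc (a := (0:ℝ)) (b := T)).exists_bound_of_continuousOn
    hg.continuousOn
  refine ⟨C, fun t => ?_⟩
  obtain ⟨y, hy, e⟩ := hp.exists_mem_Ico₀ hT t
  rw [e]
  exact hC y ⟨hy.1, hy.2.le⟩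

lemma periodic_bcf {T : ℝ} (hT : 0 < T) {g : ℝ → ℝ} (hg : Continuous g)
    (hp : Function.Periodic g T) : ∃ G : BoundedContinuousFunction ℝ ℝ, ∀ t, G t = g t := by
  obtain ⟨C, hC⟩ := periodic_bdd hT hg hp
  exact ⟨BoundedContinuousFunction.ofNormedAddCommGroup g hg C hC, fun t => rfl⟩

lemma pair_fix {T : ℝ} (hT : 0 < T) (A B : (ℝ → ℝ) → (ℝ → ℝ) → (ℝ → ℝ))
    (q r : ℝ) (hq0 : 0 ≤ q) (hq1 : q < 1) (hr : 0 < r)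
    (hA : ∀ x z : ℝ → ℝ, Continuous x → Function.Periodic x T → Continuous z →
      Function.Periodic z T → Continuous (A x z) ∧ Function.Periodic (A x z) T)
    (hB : ∀ x z : ℝ → ℝ, Continuous x → Function.Periodic x T → Continuous z →
      Function.Periodic z T → Continuous (B x z) ∧ Function.Periodic (B x z) T)
    (hAB : ∀ x z x' z' : ℝ → ℝ, Continuous x → Continuous z → Continuous x' → Continuous z' →
      ∀ d : ℝ, 0 ≤ d → (∀ t, x' t ≤ x t + d) → (∀ t, z' t ≤ z t + r * d) →
        ∀ t, A x' z' t ≤ A x z t + q * d ∧ B x' z' t ≤ B x z t + r * (q * d)) :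
    ∃ x z : ℝ → ℝ, Continuous x ∧ Function.Periodic x T ∧ Continuous z ∧ Function.Periodic z T ∧
      A x z = x ∧ B x z = z := by
  let S : Set (BoundedContinuousFunction ℝ ℝ) := {g | Function.Periodic g T}
  have hS : IsClosed S := by
    have : S = ⋂ t : ℝ, {g : BoundedContinuousFunction ℝ ℝ | g (t + T) = g t} := by
      ext g; simp [S, Function.Periodic]
    rw [this]
    have hev : ∀ t : ℝ, Continuous (fun g : BoundedContinuousFunction ℝ ℝ => g t) := fun t =>
      (LipschitzWith.of_dist_le_mul (K := 1) fun f g => by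
        simpa using BoundedContinuousFunction.dist_coe_le_dist t).continuous
    exact isClosed_iInter fun t => isClosed_eq (hev (t + T)) (hev t)
  have : CompleteSpace S := hS.completeSpace_coe
  have exA : ∀ v : S × S, ∃ u : S, ∀ t, (u : BoundedContinuousFunction ℝ ℝ) t =
      A v.1.1 (fun s => r * v.2.1 s) t := by
    intro v
    have hz : Function.Periodic (fun s => r * v.2.1 s) T := fun s => by
      show r * v.2.1 (s + T) = r * v.2.1 s
      rw [v.2.2 s]
    have := hA v.1.1 (fun s => r * v.2.1 s) v.1.1.continuous v.1.2
      (continuous_const.mul v.2.1.continuous) hz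
    obtain ⟨G, hG⟩ := periodic_bcf hT this.1 this.2
    exact ⟨⟨G, fun s => by rw [hG, hG]; exact this.2 s⟩, hG⟩
  have exB : ∀ v : S × S, ∃ u : S, ∀ t, (u : BoundedContinuousFunction ℝ ℝ) t =
      B v.1.1 (fun s => r * v.2.1 s) t / r := by
    intro v
    have hz : Function.Periodic (fun s => r * v.2.1 s) T := fun s => by
      show r * v.2.1 (s + T) = r * v.2.1 s
      rw [v.2.2 s]
    have := hB v.1.1 (fun s => r * v.2.1 s) v.1.1.continuous v.1.2
      (continuous_const.mul v.2.1.continuous) hz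
    have hz2 : Function.Periodic (fun t => B v.1.1 (fun s => r * v.2.1 s) t / r) T := fun s => by
      show B _ _ (s + T) / r = B _ _ s / r
      rw [this.2 s]
    obtain ⟨G, hG⟩ := periodic_bcf hT (this.1.div_const r) hz2
    exact ⟨⟨G, fun s => by rw [hG, hG]; exact hz2 s⟩, hG⟩
  choose fA hfA using exA
  choose fB hfB using exB
  let Φ : S × S → S × S := fun v => (fA v, fB v)
  have key : ∀ v v' : S × S, ∀ t, (fA v').1 t ≤ (fA v).1 t + q * dist v v' ∧
      (fB v').1 t ≤ (fB v).1 t + q * dist v v' := by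
    intro v v' t
    have hx : ∀ s, v'.1.1 s ≤ v.1.1 s + dist v v' := fun s => by
      have h1 : dist v.1 v'.1 ≤ dist v v' := le_max_left _ _
      have h2 : dist (v.1.1 s) (v'.1.1 s) ≤ dist v.1 v'.1 :=
        BoundedContinuousFunction.dist_coe_le_dist s
      rw [Real.dist_eq] at h2
      have := (abs_le.1 h2).1
      linarith
    have hz : ∀ s, r * v'.2.1 s ≤ r * v.2.1 s + r * dist v v' := fun s => by
      have h1 : dist v.2 v'.2 ≤ dist v v' := le_max_right _ _
      have h2 : dist (v.2.1 s) (v'.2.1 s) ≤ dist v.2 v'.2 :=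
        BoundedContinuousFunction.dist_coe_le_dist s
      rw [Real.dist_eq] at h2
      have := (abs_le.1 h2).1
      rw [← mul_add]
      exact mul_le_mul_of_nonneg_left (by linarith) hr.le
    have := hAB v.1.1 (fun s => r * v.2.1 s) v'.1.1 (fun s => r * v'.2.1 s) v.1.1.continuous
      (continuous_const.mul v.2.1.continuous) v'.1.1.continuous
      (continuous_const.mul v'.2.1.continuous) (dist v v') dist_nonneg hx hz t
    rw [hfA, hfA, hfB, hfB]
    refine ⟨this.1, ?_⟩
    rw [div_le_iff₀ hr, add_mul, div_mul_cancel₀ _ hr.ne']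
    linarith [this.2]
  have hΦ : ContractingWith ⟨q, hq0⟩ Φ := by
    refine ⟨by exact_mod_cast hq1, LipschitzWith.of_dist_le_mul fun v v' => ?_⟩
    have hd : 0 ≤ q * dist v v' := mul_nonneg hq0 dist_nonneg
    show dist (Φ v) (Φ v') ≤ q * dist v v'
    rw [Prod.dist_eq]
    apply max_le
    · rw [Subtype.dist_eq, BoundedContinuousFunction.dist_le hd]
      intro t
      have h1 := (key v v' t).1
      have h2 := (key v' v t).1
      rw [dist_comm v' v] at h2
      rw [Real.dist_eq, abs_le]
      constructor <;> simp only [Φ] <;> linarith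
    · rw [Subtype.dist_eq, BoundedContinuousFunction.dist_le hd]
      intro t
      have h1 := (key v v' t).2
      have h2 := (key v' v t).2
      rw [dist_comm v' v] at h2
      rw [Real.dist_eq, abs_le]
      constructor <;> simp only [Φ] <;> linarith
  have : Nonempty (S × S) := by
    refine ⟨(⟨0, ?_⟩, ⟨0, ?_⟩)⟩ <;> intro t <;> simp
  have hfix := hΦ.fixedPoint_isFixedPt
  set v := ContractingWith.fixedPoint Φ hΦ
  have e1 : fA v = v.1 := congrArg Prod.fst hfix
  have e2 : fB v = v.2 := congrArg Prod.snd hfix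
  refine ⟨v.1.1, fun s => r * v.2.1 s, v.1.1.continuous, v.1.2,
      continuous_const.mul v.2.1.continuous, fun s => by
        show r * v.2.1 (s + T) = r * v.2.1 s
        rw [v.2.2 s], ?_, ?_⟩
  · ext t
    rw [← hfA v t, e1]
  · ext t
    have := hfB v t
    rw [e2] at this
    rw [this]; field_simp


lemma resolvent_exists {T a M m : ℝ} (hT : 0 < T) (ha : 0 < a) (hM : 0 < M) (hm : 0 < m)
    (hm1 : m ≤ 1) {F : ℝ → ℝ} (hF : Continuous F)
    (hF1 : ∀ w w', ∃ θ, m ≤ θ ∧ θ ≤ 1 ∧ F w' - F w = θ * (w' - w))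
    {h : ℝ → ℝ} (hh : Continuous h) (hhp : Function.Periodic h T) :
    ∃ x w : ℝ → ℝ, Continuous x ∧ Function.Periodic x T ∧ Continuous w ∧ Function.Periodic w T ∧
      (∀ t, HasDerivAt x (F (w t)) t) ∧
      (∀ t, HasDerivAt w (h t + M * x t - a * F (w t)) t) := by
  obtain ⟨β, hβa, hβM⟩ : ∃ β, a < β ∧ M ≤ β * (β - a) * m := by
    refine ⟨a + 1 + M / m, by have := div_pos hM hm; linarith, ?_⟩
    have h1 := div_pos hM hm
    have h2 : M / m * m = M := div_mul_cancel₀ _ hm.ne'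
    nlinarith [mul_pos ha hm, mul_pos h1 hm, mul_pos (mul_pos ha h1) hm, mul_pos (mul_pos h1 h1) hm]
  have hβ : 0 < β := ha.trans hβa
  have hβa' : 0 < β - a := sub_pos.2 hβa
  -- weight
  obtain ⟨r, hr0, hrβ, hrM⟩ : ∃ r, 0 < r ∧ r < β ∧ (β - a) * (β - r) = M / 2 := by
    have h1 : M / (2 * (β - a)) < β := by
      rw [div_lt_iff₀ (by positivity)]
      have : β * (β - a) * m ≤ β * (β - a) * 1 :=
        mul_le_mul_of_nonneg_left hm1 (mul_pos hβ hβa').le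
      linarith
    refine ⟨β - M / (2 * (β - a)), by linarith, ?_, ?_⟩
    · have : 0 < M / (2 * (β - a)) := by positivity
      linarith
    · field_simp; ring
  set q1 := 1 - m * (1 - r / β) with hq1
  set q2 := 1 - M / 2 / (β * r) with hq2
  have hrβ' : r / β < 1 := (div_lt_one hβ).2 hrβ
  have hrβ0 : 0 < r / β := div_pos hr0 hβ
  have hq1' : q1 < 1 := by
    have : 0 < m * (1 - r / β) := mul_pos hm (by linarith)
    linarith
  have hq2' : q2 < 1 := by
    have : 0 < M / 2 / (β * r) := by positivity
    linarith
  have hq10 : 0 ≤ q1 := by nlinarith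
  have hβn : -β ≠ 0 := by simpa using hβ.ne'
  obtain ⟨x, z, hx, hxp, hz, hzp, e1, e2⟩ := pair_fix hT
    (fun x z => avgOp T β (fun t => x t + F (z t - β * x t) / β))
    (fun x z => avgOp T (-β) (fun t => z t - (h t + M * x t + (β - a) * F (z t - β * x t)) / β))
    (max q1 q2) r (le_max_of_le_left hq10) (max_lt hq1' hq2') hr0
    (by
      intro x z hx hxp hz hzp
      have hp : Function.Periodic (fun t => x t + F (z t - β * x t) / β) T := fun t => by
        simp only [hxp t, hzp t]
      exact ⟨avgOp_continuous hT hβ.ne' (by fun_prop) hp, avgOp_periodic hp⟩)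
    (by
      intro x z hx hxp hz hzp
      have hp : Function.Periodic
          (fun t => z t - (h t + M * x t + (β - a) * F (z t - β * x t)) / β) T := fun t => by
        simp only [hxp t, hzp t, hhp t]
      exact ⟨avgOp_continuous hT hβn (by fun_prop) hp, avgOp_periodic hp⟩)
    (by
      intro x z x' z' hx hz hx' hz' d hd h1 h2 t
      refine ⟨avgOp_le hT hβ.ne' (by fun_prop) (by fun_prop) (fun t => ?_) t,
        avgOp_le hT hβn (by fun_prop) (by fun_prop) (fun t => ?_) t⟩
      · obtain ⟨θ, hθ, hθ1, e⟩ := hF1 (z t - β * x t) (z' t - β * x' t)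
        have g1 := h1 t
        have g2 := h2 t
        have e' : F (z' t - β * x' t) = F (z t - β * x t)
          + θ * ((z' t - β * x' t) - (z t - β * x t)) := by linarith
        rw [e']
        have : x' t + (F (z t - β * x t) + θ * ((z' t - β * x' t) - (z t - β * x t))) / β
          = x t + F (z t - β * x t) / β + ((1 - θ) * (x' t - x t) + θ * (z' t - z t) / β) := by
          field_simp; ring
        rw [this]
        have h3 : (1 - θ) * (x' t - x t) ≤ (1 - θ) * d :=
          mul_le_mul_of_nonneg_left (by linarith) (by linarith)
        have h4 : θ * (z' t - z t) / β ≤ θ * (r * d) / β := by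
          apply div_le_div_of_nonneg_right _ hβ.le
          exact mul_le_mul_of_nonneg_left (by linarith) (by linarith)
        have h5 : (1 - θ) * d + θ * (r * d) / β = (1 - θ * (1 - r / β)) * d := by
          field_simp; ring
        have h6 : (1 - θ * (1 - r / β)) * d ≤ q1 * d := by
          apply mul_le_mul_of_nonneg_right _ hd
          have : m * (1 - r / β) ≤ θ * (1 - r / β) :=
            mul_le_mul_of_nonneg_right hθ (by linarith)
          linarith
        have h7 : q1 * d ≤ max q1 q2 * d := mul_le_mul_of_nonneg_right (le_max_left _ _) hd
        linarith
      · obtain ⟨θ, hθ, hθ1, e⟩ := hF1 (z t - β * x t) (z' t - β * x' t)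
        have g1 := h1 t
        have g2 := h2 t
        have e' : F (z' t - β * x' t) = F (z t - β * x t)
          + θ * ((z' t - β * x' t) - (z t - β * x t)) := by linarith
        rw [e']
        have : z' t - (h t + M * x' t + (β - a) * (F (z t - β * x t) +
            θ * ((z' t - β * x' t) - (z t - β * x t)))) / β
          = z t - (h t + M * x t + (β - a) * F (z t - β * x t)) / β +
            ((β - (β - a) * θ) * (z' t - z t) + ((β - a) * β * θ - M) * (x' t - x t)) / β := by
          field_simp; ring
        rw [this]
        have c1 : 0 ≤ β - (β - a) * θ := by nlinarith
        have c2 : 0 ≤ (β - a) * β * θ - M := by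
          have : (β - a) * β * m ≤ (β - a) * β * θ :=
            mul_le_mul_of_nonneg_left hθ (mul_pos hβa' hβ).le
          linarith
        have h3 : (β - (β - a) * θ) * (z' t - z t) ≤ (β - (β - a) * θ) * (r * d) :=
          mul_le_mul_of_nonneg_left (by linarith) c1
        have h4 : ((β - a) * β * θ - M) * (x' t - x t) ≤ ((β - a) * β * θ - M) * d :=
          mul_le_mul_of_nonneg_left (by linarith) c2
        have h5 : (β - (β - a) * θ) * (r * d) + ((β - a) * β * θ - M) * d ≤
            (β * r - M / 2) * d := by
          have : (β - (β - a) * θ) * (r * d) + ((β - a) * β * θ - M) * d =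
            (β * r + ((β - a) * (β - r)) * θ - M) * d := by ring
          rw [this, hrM]
          apply mul_le_mul_of_nonneg_right _ hd
          nlinarith
        have h6 : ((β - (β - a) * θ) * (z' t - z t) + ((β - a) * β * θ - M) * (x' t - x t)) / β
            ≤ (β * r - M / 2) * d / β := by
          apply div_le_div_of_nonneg_right _ hβ.le
          linarith
        have h7 : (β * r - M / 2) * d / β = r * (q2 * d) := by
          rw [hq2]; field_simp
        have h8 : r * (q2 * d) ≤ r * (max q1 q2 * d) :=
          mul_le_mul_of_nonneg_left (mul_le_mul_of_nonneg_right (le_max_right _ _) hd) hr0.le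
        linarith)
  have hp1 : Function.Periodic (fun t => x t + F (z t - β * x t) / β) T := fun t => by
    simp only [hxp t, hzp t]
  have hp2 : Function.Periodic
      (fun t => z t - (h t + M * x t + (β - a) * F (z t - β * x t)) / β) T := fun t => by
    simp only [hxp t, hzp t, hhp t]
  have d1 : ∀ t, HasDerivAt x (F (z t - β * x t)) t := fun t => by
    have := avgOp_hasDerivAt hT hβ.ne' (g := fun t => x t + F (z t - β * x t) / β)
      (by fun_prop) hp1 t
    rw [e1] at this
    refine this.congr_deriv ?_
    field_simp; ring
  have d2 : ∀ t, HasDerivAt z (h t + M * x t + (β - a) * F (z t - β * x t)) t := fun t => by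
    have := avgOp_hasDerivAt hT hβn
      (g := fun t => z t - (h t + M * x t + (β - a) * F (z t - β * x t)) / β)
      (by fun_prop) hp2 t
    rw [e2] at this
    refine this.congr_deriv ?_
    field_simp; ring
  refine ⟨x, fun t => z t - β * x t, hx, hxp, by fun_prop, fun t => by
    simp only [hxp t, hzp t], d1, fun t => ?_⟩
  refine ((d2 t).sub ((d1 t).const_mul β)).congr_deriv ?_
  ring

lemma resolvent_comparison {T a M m : ℝ} (hT : 0 < T) (hM : 0 < M) (hm : 0 < m)
    {F : ℝ → ℝ} (hF1 : ∀ w w', ∃ θ, m ≤ θ ∧ θ ≤ 1 ∧ F w' - F w = θ * (w' - w))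
    {h₁ x₁ w₁ h₂ x₂ w₂ : ℝ → ℝ}
    (hx₁ : Function.Periodic x₁ T) (hx₂ : Function.Periodic x₂ T)
    (d₁ : ∀ t, HasDerivAt x₁ (F (w₁ t)) t)
    (e₁ : ∀ t, HasDerivAt w₁ (h₁ t + M * x₁ t - a * F (w₁ t)) t)
    (d₂ : ∀ t, HasDerivAt x₂ (F (w₂ t)) t)
    (e₂ : ∀ t, HasDerivAt w₂ (h₂ t + M * x₂ t - a * F (w₂ t)) t)
    {ε : ℝ} (hle : ∀ t, h₁ t ≤ h₂ t + M * ε) (t : ℝ) : x₂ t ≤ x₁ t + ε := by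
  set X : ℝ → ℝ := fun t => x₂ t - x₁ t with hX
  have dX : ∀ t, HasDerivAt X (F (w₂ t) - F (w₁ t)) t := fun t => (d₂ t).sub (d₁ t)
  have cX : Continuous X := continuous_iff_continuousAt.2 fun t => (dX t).continuousAt
  have pX : Function.Periodic X T := fun t => by simp only [hX, hx₁ t, hx₂ t]
  obtain ⟨t0, _, ht0⟩ := (isCompact_Icc (a := (0:ℝ)) (b := T)).exists_isMaxOn
    ⟨0, by simp [hT.le]⟩ cX.continuousOn
  have hmax : ∀ s, X s ≤ X t0 := fun s => by
    obtain ⟨y, hy, e⟩ := pX.exists_mem_Ico₀ hT s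
    rw [e]; exact ht0 ⟨hy.1, hy.2.le⟩
  by_contra hcon
  push Not at hcon
  have hpos : ε < X t0 := by
    have := hmax t
    simp only [hX] at this ⊢
    linarith
  have hz : F (w₂ t0) - F (w₁ t0) = 0 :=
    (IsLocalMax.hasDerivAt_eq_zero (Filter.Eventually.of_forall hmax) (dX t0))
  have hw : w₂ t0 - w₁ t0 = 0 := by
    obtain ⟨θ, hθ, _, e⟩ := hF1 (w₁ t0) (w₂ t0)
    rw [hz] at e
    rcases mul_eq_zero.1 e.symm with h | h
    · linarith
    · exact h
  have dW : HasDerivAt (fun t => w₂ t - w₁ t) (h₂ t0 - h₁ t0 + M * X t0) t0 := by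
    refine ((e₂ t0).sub (e₁ t0)).congr_deriv ?_
    simp only [hX]
    linear_combination (-a) * hz
  have hdpos : 0 < deriv (fun t => w₂ t - w₁ t) t0 := by
    rw [dW.deriv]
    have := hle t0
    nlinarith
  have hev := eventually_nhdsWithin_sign_eq_of_deriv_pos hdpos hw
  obtain ⟨η, hη, hball⟩ := Metric.eventually_nhds_iff.1 hev
  have hmono : StrictMonoOn X (Icc t0 (t0 + η / 2)) := by
    apply strictMonoOn_of_deriv_pos (convex_Icc _ _) cX.continuousOn
    intro s hs
    rw [interior_Icc] at hs
    rw [(dX s).deriv]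
    have h1 := hball (y := s) (by rw [Real.dist_eq, abs_lt]; constructor <;> linarith [hs.1, hs.2])
    have hwpos : 0 < w₂ s - w₁ s := by
      rw [sign_pos (show 0 < s - t0 by linarith [hs.1])] at h1
      exact sign_eq_one_iff.1 h1
    obtain ⟨θ, hθ, _, e⟩ := hF1 (w₁ s) (w₂ s)
    rw [e]; exact mul_pos (by linarith) hwpos
  have := hmono (by constructor <;> linarith) (by constructor <;> linarith)
    (show t0 < t0 + η / 2 by linarith)
  exact absurd (hmax _) (not_le.2 this)


/-- `T`-periodic functions with Lipschitz constant `c`. -/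
def InE (c T : ℝ) (u : ℝ → ℝ) : Prop :=
  Function.Periodic u T ∧ ∀ s t, u s ≤ u t + c * |s - t|

lemma InE.abs_sub {c T : ℝ} {u : ℝ → ℝ} (h : InE c T u) (s t : ℝ) :
    |u s - u t| ≤ c * |s - t| := by
  have h1 := h.2 s t
  have h2 := h.2 t s
  rw [abs_sub_comm t s] at h2
  rw [abs_le]; constructor <;> linarith

lemma InE.continuous {c T : ℝ} {u : ℝ → ℝ} (h : InE c T u) : Continuous u := by
  have : LipschitzWith (Real.toNNReal c) u := LipschitzWith.of_dist_le_mul fun s t => by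
    rw [Real.dist_eq, Real.dist_eq]
    exact (h.abs_sub s t).trans
      (mul_le_mul_of_nonneg_right (Real.le_coe_toNNReal c) (abs_nonneg _))
  exact this.continuous

lemma InE.neg {c T : ℝ} {u : ℝ → ℝ} (h : InE c T u) : InE c T (fun t => - u t) := by
  refine ⟨fun t => by simp only [h.1 t], fun s t => ?_⟩
  have := h.2 t s
  rw [abs_sub_comm t s] at this
  linarith

lemma InE.iSup {c T : ℝ} {x : ℕ → ℝ → ℝ} (h : ∀ n, InE c T (x n)) {K : ℝ}
    (hK : ∀ n t, x n t ≤ K) : InE c T (fun t => ⨆ n, x n t) := by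
  have hb : ∀ t, BddAbove (range fun n => x n t) := fun t => ⟨K, by rintro _ ⟨n, rfl⟩; exact hK n t⟩
  refine ⟨fun t => by simp only [(h _).1 t], fun s t => ?_⟩
  apply ciSup_le
  intro n
  have := le_ciSup (hb t) n
  have h2 := (h n).2 s t
  simp only at this ⊢
  linarith

lemma InE.mono_lim {c T : ℝ} (hT : 0 < T) {x : ℕ → ℝ → ℝ} (h : ∀ n, InE c T (x n)) {K : ℝ}
    (hK : ∀ n t, x n t ≤ K) (hm : ∀ t, Monotone fun n => x n t) :
    ∃ Z, InE c T Z ∧ (∀ n t, x n t ≤ Z t) ∧ (∀ B : ℝ → ℝ, (∀ n t, x n t ≤ B t) → ∀ t, Z t ≤ B t) ∧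
      ∀ ε > 0, ∃ n, ∀ t, Z t ≤ x n t + ε := by
  have hb : ∀ t, BddAbove (range fun n => x n t) := fun t => ⟨K, by rintro _ ⟨n, rfl⟩; exact hK n t⟩
  have hZ := InE.iSup h hK
  refine ⟨_, hZ, fun n t => le_ciSup (hb t) n, fun B hB t => ciSup_le fun n => hB n t,
    fun ε hε => ?_⟩
  have hu := Monotone.tendstoUniformlyOn_of_forall_tendsto (F := x)
    (f := fun t => ⨆ n, x n t) (isCompact_Icc (a := (0:ℝ)) (b := T))
    (fun n => (h n).continuous.continuousOn) (fun t _ => hm t) hZ.continuous.continuousOn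
    (fun t _ => tendsto_atTop_ciSup (hm t) (hb t))
  rw [Metric.tendstoUniformlyOn_iff] at hu
  obtain ⟨n, hn⟩ := (hu ε hε).exists
  refine ⟨n, fun t => ?_⟩
  obtain ⟨k, hk⟩ : ∃ y ∈ Ico 0 T, ∃ z : ℤ, t = y + z * T := by
    obtain ⟨y, hy, -⟩ := existsUnique_add_zsmul_mem_Ico hT t 0
    refine ⟨t + y • T, by simpa using hy, -y, ?_⟩
    simp
  obtain ⟨hk, z, e⟩ := hk
  have := hn k ⟨hk.1, hk.2.le⟩
  rw [Real.dist_eq] at this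
  have h3 := (abs_lt.1 this).2
  have e1 : (⨆ n, x n t) = ⨆ n, x n k := by rw [e]; exact (hZ.1.int_mul z) k
  have e2 : x n t = x n k := by rw [e]; exact ((h n).1.int_mul z) k
  show (⨆ n, x n t) ≤ _
  rw [e1, e2]; linarith

lemma fix_of_orbit {c T : ℝ} (hT : 0 < T) (G : (ℝ → ℝ) → (ℝ → ℝ))
    (hG : ∀ u, InE c T u → InE c T (G u))
    (hmono : ∀ u v, InE c T u → InE c T v → ∀ ε : ℝ, 0 ≤ ε → (∀ t, u t ≤ v t + ε) →
      ∀ t, G u t ≤ G v t + 2 * ε)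
    (hshift : ∀ u v, InE c T u → InE c T v → ∀ m : ℕ, (∀ t, u t ≤ v t + m * (2 * π)) →
      ∀ t, G u t ≤ G v t + m * (2 * π))
    (x : ℕ → ℝ → ℝ) (hx : ∀ n, InE c T (x n)) (hxG : ∀ n, x (n + 1) = G (x n)) {K : ℝ}
    (hK : ∀ n t, |x n t| ≤ K) : ∃ Z, InE c T Z ∧ G Z = Z := by
  have hK1 : ∀ n t, x n t ≤ K := fun n t => (abs_le.1 (hK n t)).2
  have hK2 : ∀ n t, -K ≤ x n t := fun n t => (abs_le.1 (hK n t)).1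
  have hmono0 : ∀ u v, InE c T u → InE c T v → (∀ t, u t ≤ v t) → ∀ t, G u t ≤ G v t := by
    intro u v hu hv h t
    simpa using hmono u v hu hv 0 le_rfl (by simpa using h) t
  -- tail suprema
  set Y : ℕ → ℝ → ℝ := fun n t => ⨆ k, x (n + k) t with hY
  have hYE : ∀ n, InE c T (Y n) := fun n => InE.iSup (fun k => hx (n + k)) (fun k t => hK1 _ t)
  have hbY : ∀ n t, BddAbove (range fun k => x (n + k) t) :=
    fun n t => ⟨K, by rintro _ ⟨k, rfl⟩; exact hK1 _ t⟩
  have hxY : ∀ n k t, x (n + k) t ≤ Y n t := fun n k t => le_ciSup (hbY n t) k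
  have hYG : ∀ n t, Y (n + 1) t ≤ G (Y n) t := by
    intro n t
    apply ciSup_le
    intro k
    have : n + 1 + k = (n + k) + 1 := by ring
    rw [this, hxG]
    exact hmono0 _ _ (hx _) (hYE n) (hxY n k) t
  have hYanti : ∀ t, Antitone fun n => Y n t := fun t => antitone_nat_of_succ_le fun n => by
    apply ciSup_le
    intro k
    have : n + 1 + k = n + (k + 1) := by ring
    rw [this]
    exact hxY n (k + 1) t
  have hYlow : ∀ n t, -K ≤ Y n t := fun n t => (hK2 (n + 0) t).trans (hxY n 0 t)
  obtain ⟨V, hVE, hV1, hV2, hV3⟩ := InE.mono_lim hT (x := fun n t => - Y n t) (K := K)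
    (fun n => (hYE n).neg) (fun n t => by linarith [hYlow n t]) (fun t => fun i j hij => by
      have := hYanti t hij
      simp only at this ⊢
      linarith)
  have hWE := hVE.neg
  set W : ℝ → ℝ := fun t => - V t with hW
  have hWY : ∀ n t, W t ≤ Y n t := fun n t => by have := hV1 n t; simp only [hW]; linarith
  have hWG : ∀ t, W t ≤ G W t := by
    intro t
    apply le_of_forall_pos_le_add
    intro ε hε
    obtain ⟨n, hn⟩ := hV3 (ε / 2) (by linarith)
    have h1 := hmono (Y n) W (hYE n) hWE (ε / 2) (by linarith)
      (fun t => by have := hn t; simp only [hW]; linarith) t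
    have h2 := hYG n t
    have h3 := hWY (n + 1) t
    linarith
  -- iterate from below
  set y : ℕ → ℝ → ℝ := fun n => G^[n] W with hy
  have hysucc : ∀ n, y (n + 1) = G (y n) := fun n => Function.iterate_succ_apply' G n W
  have hyE : ∀ n, InE c T (y n) := by
    intro n
    induction n with
    | zero => exact hWE
    | succ n ih => rw [hysucc]; exact hG _ ih
  have hymono : ∀ n t, y n t ≤ y (n + 1) t := by
    intro n
    induction n with
    | zero => exact hWG
    | succ n ih =>
      intro t
      rw [hysucc (n + 1)]
      conv_lhs => rw [hysucc n]
      exact hmono0 _ _ (hyE n) (hyE (n + 1)) ih t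
  obtain ⟨m, hm⟩ := exists_nat_ge (2 * K)
  have hWK : ∀ t, W t ≤ K := fun t => (hWY 0 t).trans (ciSup_le fun k => hK1 _ t)
  have hK0 : 0 ≤ K := (abs_nonneg _).trans (hK 0 0)
  have hm2 : 2 * K ≤ m * (2 * π) := by
    have : (1:ℝ) ≤ 2 * π := by linarith [Real.pi_gt_three]
    nlinarith [Nat.cast_nonneg (α := ℝ) m]
  have hyx : ∀ n t, y n t ≤ x n t + m * (2 * π) := by
    intro n
    induction n with
    | zero => intro t; have h1 := hWK t; have h2 := hK2 0 t; show W t ≤ _; linarith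
    | succ n ih => intro t; rw [hysucc, hxG]; exact hshift _ _ (hyE n) (hx n) m ih t
  obtain ⟨Z, hZE, hZ1, hZ2, hZ3⟩ := InE.mono_lim hT (x := y) (K := K + m * (2 * π)) hyE
    (fun n t => by linarith [hyx n t, hK1 n t]) (fun t => monotone_nat_of_le_succ fun n => hymono n t)
  refine ⟨Z, hZE, ?_⟩
  ext t
  apply le_antisymm
  · apply le_of_forall_pos_le_add
    intro ε hε
    obtain ⟨n, hn⟩ := hZ3 (ε / 2) (by linarith)
    have h1 := hmono Z (y n) hZE (hyE n) (ε / 2) (by linarith) hn t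
    rw [← hysucc] at h1
    have h2 := hZ1 (n + 1) t
    linarith
  · apply hZ2
    intro n t
    refine (hymono n t).trans ?_
    rw [hysucc]
    exact hmono0 _ _ (hyE n) hZE (hZ1 n) t

lemma InE.sup_bound {c T : ℝ} (hT : 0 < T) {v : ℝ → ℝ} (hv : InE c T v)
    (h0 : (∫ t in (0:ℝ)..T, v t) = 0) (t : ℝ) : |v t| ≤ c * T / 4 := by
  have hc := hv.continuous
  have hI : (∫ r in (t - T / 2)..(t + T / 2), v r) = 0 := by
    have := hv.1.intervalIntegral_add_eq (t - T / 2) 0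
    rw [zero_add, h0] at this
    rw [← this]; congr 1; ring
  have hsplit := intervalIntegral.integral_add_adjacent_intervals
    (hc.intervalIntegrable (μ := volume) (t - T / 2) t) (hc.intervalIntegrable t (t + T / 2))
  rw [hI] at hsplit
  have hR : (∫ r in t..(t + T / 2), v r) = ∫ r in (0:ℝ)..(T / 2), v (t + r) := by
    rw [intervalIntegral.integral_comp_add_left (fun r => v r) t]; simp
  have hL : (∫ r in (t - T / 2)..t, v r) = ∫ r in (0:ℝ)..(T / 2), v (t - r) := by
    rw [intervalIntegral.integral_comp_sub_left (fun r => v r) t]; simp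
  rw [hR, hL] at hsplit
  have c1 : Continuous fun r => v (t + r) := by fun_prop
  have c2 : Continuous fun r => v (t - r) := by fun_prop
  rw [← intervalIntegral.integral_add (c2.intervalIntegrable _ _) (c1.intervalIntegrable _ _)]
    at hsplit
  have c3 : Continuous fun r => v (t - r) + v (t + r) := by fun_prop
  have hlin : (∫ r in (0:ℝ)..(T / 2), 2 * c * r) = c * T ^ 2 / 4 := by
    rw [intervalIntegral.integral_const_mul, integral_id]; ring
  have hcst : (∫ r in (0:ℝ)..(T / 2), 2 * v t) = T * v t := by
    rw [intervalIntegral.integral_const, smul_eq_mul]; ring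
  have hid : (∫ r in (0:ℝ)..(T / 2), (2 * v t + 2 * c * r)) = T * v t + c * T ^ 2 / 4 := by
    rw [intervalIntegral.integral_add (by simp) (by
      apply Continuous.intervalIntegrable; fun_prop), hlin, hcst]
  have hid2 : (∫ r in (0:ℝ)..(T / 2), (2 * v t - 2 * c * r)) = T * v t - c * T ^ 2 / 4 := by
    rw [intervalIntegral.integral_sub (by simp) (by
      apply Continuous.intervalIntegrable; fun_prop), hlin, hcst]
  have i1 : (∫ r in (0:ℝ)..(T / 2), (v (t - r) + v (t + r))) ≤
      ∫ r in (0:ℝ)..(T / 2), (2 * v t + 2 * c * r) := by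
    apply intervalIntegral.integral_mono_on (by linarith) (c3.intervalIntegrable _ _)
      (Continuous.intervalIntegrable (by fun_prop) _ _)
    intro r hr
    have a1 := hv.2 (t - r) t
    have a2 := hv.2 (t + r) t
    simp only [sub_sub_cancel_left, abs_neg, add_sub_cancel_left, abs_of_nonneg hr.1] at a1 a2
    linarith
  have i2 : (∫ r in (0:ℝ)..(T / 2), (2 * v t - 2 * c * r)) ≤
      (∫ r in (0:ℝ)..(T / 2), (v (t - r) + v (t + r))) := by
    apply intervalIntegral.integral_mono_on (by linarith)
      (Continuous.intervalIntegrable (by fun_prop) _ _) (c3.intervalIntegrable _ _)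
    intro r hr
    have a1 := hv.2 t (t - r)
    have a2 := hv.2 t (t + r)
    simp only [sub_sub_cancel, sub_add_cancel_left, abs_neg, abs_of_nonneg hr.1] at a1 a2
    linarith
  rw [hid, hsplit] at i1
  rw [hid2, hsplit] at i2
  rw [abs_le]
  constructor
  · by_contra hn
    push Not at hn
    nlinarith
  · by_contra hn
    push Not at hn
    nlinarith

lemma cos_integral_lower {c T δ : ℝ} (hc : 0 < c) (hT : 0 < T)
    (hk : c * (T / (2 * Real.sqrt 3)) < π) (hδ : δ ∈ Set.Ioo 0 (π / 2))
    (hψ : 0 < 2 * δ * Real.cos δ + (c * T - 2 * δ) * Real.cos (c * (T / (2 * Real.sqrt 3)))) :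
    ∃ κ : ℝ, 0 < κ ∧ ∀ v, InE c T v → (∫ t in (0:ℝ)..T, v t) = 0 →
      κ ≤ ∫ t in (0:ℝ)..T, Real.cos (v t) := by
  obtain ⟨hδ0, hδ1⟩ := hδ
  have hcosδ : 0 < Real.cos δ := Real.cos_pos_of_mem_Ioo ⟨by linarith, hδ1⟩
  have hkk : c * T / 4 ≤ c * (T / (2 * Real.sqrt 3)) := by
    have h3 : Real.sqrt 3 ≤ 2 := by
      rw [Real.sqrt_le_left (by norm_num)]; norm_num
    have h30 : 0 < Real.sqrt 3 := by positivity
    rw [mul_div_assoc]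
    apply mul_le_mul_of_nonneg_left _ hc.le
    apply div_le_div_of_nonneg_left hT.le (by positivity) (by linarith)
  have hcosle : ∀ x y : ℝ, |x| ≤ y → y ≤ π → Real.cos y ≤ Real.cos x := by
    intro x y h1 h2
    rw [← Real.cos_abs x]
    exact Real.cos_le_cos_of_nonneg_of_le_pi (abs_nonneg _) h2 h1
  by_cases hcase : c * T < 2 * δ
  · refine ⟨T * Real.cos δ, by positivity, fun v hv h0 => ?_⟩
    have hb := hv.sup_bound hT h0
    have : (∫ t in (0:ℝ)..T, Real.cos δ) ≤ ∫ t in (0:ℝ)..T, Real.cos (v t) := by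
      apply intervalIntegral.integral_mono_on hT.le (by simp)
        ((Real.continuous_cos.comp hv.continuous).intervalIntegrable _ _)
      intro t _
      exact hcosle _ _ ((hb t).trans (by linarith [mul_pos hc hT])) (by linarith)
    simpa using this
  · push Not at hcase
    refine ⟨(2 * δ * Real.cos δ + (c * T - 2 * δ) * Real.cos (c * (T / (2 * Real.sqrt 3)))) / c,
      by positivity, fun v hv h0 => ?_⟩
    have hb := hv.sup_bound hT h0
    set γ := Real.cos (c * (T / (2 * Real.sqrt 3))) with hγ
    have hcc : Continuous fun t => Real.cos (v t) := Real.continuous_cos.comp hv.continuous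
    -- a zero of v
    obtain ⟨t0, ht0⟩ : ∃ t0, v t0 = 0 := by
      have hd : ∀ t, HasDerivAt (fun t => ∫ r in (0:ℝ)..t, v r) (v t) t := fun t =>
        intervalIntegral.integral_hasDerivAt_right
          (hv.continuous.intervalIntegrable _ _)
          (hv.continuous.stronglyMeasurableAtFilter _ _) hv.continuous.continuousAt
      obtain ⟨C, _, hC⟩ := exists_hasDerivAt_eq_slope (fun t => ∫ r in (0:ℝ)..t, v r) v hT
        (fun t _ => (hd t).continuousAt.continuousWithinAt) (fun t _ => hd t)
      refine ⟨C, ?_⟩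
      simpa [h0] using hC
    have hI : (∫ t in (0:ℝ)..T, Real.cos (v t)) =
        ∫ t in (t0 - T / 2)..(t0 + T / 2), Real.cos (v t) := by
      have hp : Function.Periodic (fun t => Real.cos (v t)) T := fun t => by simp only [hv.1 t]
      have := hp.intervalIntegral_add_eq 0 (t0 - T / 2)
      rw [zero_add] at this
      rw [this]; congr 1; ring
    have hδc : δ / c ≤ T / 2 := by rw [div_le_iff₀ hc]; linarith
    have hδc0 : 0 < δ / c := by positivity
    rw [hI, ← intervalIntegral.integral_add_adjacent_intervals (b := t0 - δ / c)
      (hcc.intervalIntegrable _ _) (hcc.intervalIntegrable _ _),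
      ← intervalIntegral.integral_add_adjacent_intervals (a := t0 - δ / c) (b := t0 + δ / c)
      (hcc.intervalIntegrable _ _) (hcc.intervalIntegrable _ _)]
    have hγle : ∀ t, γ ≤ Real.cos (v t) := fun t => hcosle _ _ ((hb t).trans hkk) hk.le
    have j1 : (∫ t in (t0 - T / 2)..(t0 - δ / c), γ) ≤
        ∫ t in (t0 - T / 2)..(t0 - δ / c), Real.cos (v t) :=
      intervalIntegral.integral_mono_on (by linarith) (by simp) (hcc.intervalIntegrable _ _)
        fun t _ => hγle t
    have j3 : (∫ t in (t0 + δ / c)..(t0 + T / 2), γ) ≤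
        ∫ t in (t0 + δ / c)..(t0 + T / 2), Real.cos (v t) :=
      intervalIntegral.integral_mono_on (by linarith) (by simp) (hcc.intervalIntegrable _ _)
        fun t _ => hγle t
    have j2 : (∫ t in (t0 - δ / c)..(t0 + δ / c), Real.cos δ) ≤
        ∫ t in (t0 - δ / c)..(t0 + δ / c), Real.cos (v t) := by
      apply intervalIntegral.integral_mono_on (by linarith) (by simp) (hcc.intervalIntegrable _ _)
      intro t ht
      apply hcosle _ _ _ (by linarith)
      have h1 := hv.abs_sub t t0
      rw [ht0, sub_zero] at h1
      refine h1.trans ?_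
      have : |t - t0| ≤ δ / c := by rw [abs_le]; constructor <;> linarith [ht.1, ht.2]
      calc c * |t - t0| ≤ c * (δ / c) := mul_le_mul_of_nonneg_left this hc.le
        _ = δ := by field_simp
    simp only [intervalIntegral.integral_const, smul_eq_mul] at j1 j2 j3
    have e : (2 * δ * Real.cos δ + (c * T - 2 * δ) * γ) / c =
      (t0 - δ / c - (t0 - T / 2)) * γ + ((t0 + δ / c - (t0 - δ / c)) * Real.cos δ +
        (t0 + T / 2 - (t0 + δ / c)) * γ) := by field_simp; ring
    rw [e]
    linarith

lemma sin_integral_bounds {c T κ : ℝ} (hT : 0 < T)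
    (hκ : ∀ v, InE c T v → (∫ t in (0:ℝ)..T, v t) = 0 → κ ≤ ∫ t in (0:ℝ)..T, Real.cos (v t))
    {u : ℝ → ℝ} (hu : InE c T u) {μ : ℝ} (hμ : (∫ t in (0:ℝ)..T, u t) = T * μ) :
    κ - T * |μ - π / 2| ≤ (∫ t in (0:ℝ)..T, Real.sin (u t)) ∧
    (∫ t in (0:ℝ)..T, Real.sin (u t)) ≤ -κ + T * |μ - 3 * π / 2| := by
  have hvE : InE c T (fun t => u t - μ) :=
    ⟨fun t => by simp only [hu.1 t], fun s t => by have := hu.2 s t; linarith⟩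
  have hv0 : (∫ t in (0:ℝ)..T, (u t - μ)) = 0 := by
    rw [intervalIntegral.integral_sub (hu.continuous.intervalIntegrable _ _) (by simp), hμ]
    simp
  have h := hκ _ hvE hv0
  have hcc : Continuous fun t => Real.cos (u t - μ) := Real.continuous_cos.comp hvE.continuous
  have hss : Continuous fun t => Real.sin (u t) := Real.continuous_sin.comp hu.continuous
  have hlip : ∀ x y : ℝ, |Real.cos x - Real.cos y| ≤ |x - y| := fun x y => by
    simpa [Real.dist_eq] using Real.lipschitzWith_cos.dist_le_mul x y
  constructor
  · have h1 : (∫ t in (0:ℝ)..T, (Real.cos (u t - μ) - |μ - π / 2|)) ≤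
        ∫ t in (0:ℝ)..T, Real.sin (u t) := by
      apply intervalIntegral.integral_mono_on hT.le
        (Continuous.intervalIntegrable (by fun_prop) _ _) (hss.intervalIntegrable _ _)
      intro t _
      have e : Real.sin (u t) = Real.cos (u t - π / 2) := by rw [Real.cos_sub_pi_div_two]
      have := hlip (u t - μ) (u t - π / 2)
      rw [show u t - μ - (u t - π / 2) = -(μ - π / 2) by ring, abs_neg] at this
      rw [e]
      linarith [(abs_le.1 this).2]
    rw [intervalIntegral.integral_sub (hcc.intervalIntegrable _ _) (by simp)] at h1
    simp only [intervalIntegral.integral_const, smul_eq_mul, sub_zero] at h1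
    linarith
  · have h1 : (∫ t in (0:ℝ)..T, Real.sin (u t)) ≤
        ∫ t in (0:ℝ)..T, (|μ - 3 * π / 2| - Real.cos (u t - μ)) := by
      apply intervalIntegral.integral_mono_on hT.le (hss.intervalIntegrable _ _)
        (Continuous.intervalIntegrable (by fun_prop) _ _)
      intro t _
      have e : Real.sin (u t) = - Real.cos (u t - 3 * π / 2) := by
        rw [show u t - 3 * π / 2 = u t - π / 2 - π by ring, Real.cos_sub_pi,
          Real.cos_sub_pi_div_two]; ring
      have := hlip (u t - μ) (u t - 3 * π / 2)
      rw [show u t - μ - (u t - 3 * π / 2) = -(μ - 3 * π / 2) by ring, abs_neg] at this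
      rw [e]
      linarith [(abs_le.1 this).2]
    rw [intervalIntegral.integral_sub (by simp) (hcc.intervalIntegrable _ _)] at h1
    simp only [intervalIntegral.integral_const, smul_eq_mul, sub_zero] at h1
    linarith

/-- inverse of the relativistic operator -/
noncomputable def phiInv (c w : ℝ) : ℝ := w / Real.sqrt (1 + w ^ 2 / c ^ 2)

lemma phiInv_aux (c w : ℝ) : 0 < 1 + w ^ 2 / c ^ 2 := by positivity

lemma phiInv_hasDerivAt (c w : ℝ) :
    HasDerivAt (phiInv c) (1 / (Real.sqrt (1 + w ^ 2 / c ^ 2)) ^ 3) w := by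
  have hp := phiInv_aux c w
  have h1 : HasDerivAt (fun w : ℝ => 1 + w ^ 2 / c ^ 2) (2 * w / c ^ 2) w := by
    have := ((hasDerivAt_pow 2 w).div_const (c ^ 2)).const_add 1
    simpa using this
  have h2 := h1.sqrt hp.ne'
  have h3 := (hasDerivAt_id w).div h2 (Real.sqrt_pos.2 hp).ne'
  refine h3.congr_deriv ?_
  have hs := Real.sq_sqrt hp.le
  have hs0 := Real.sqrt_pos.2 hp
  set S := Real.sqrt (1 + w ^ 2 / c ^ 2)
  simp only [id]
  field_simp
  have : w ^ 2 / c ^ 2 = S ^ 2 - 1 := by linarith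
  rw [show S ^ 2 - w ^ 2 / c ^ 2 = 1 by linarith]

lemma phiInv_abs_lt {c : ℝ} (hc : 0 < c) (w : ℝ) : |phiInv c w| < c := by
  unfold phiInv
  have hs0 := Real.sqrt_pos.2 (phiInv_aux c w)
  rw [abs_div, abs_of_pos hs0, div_lt_iff₀ hs0]
  rw [← Real.sqrt_sq_eq_abs, ← Real.sqrt_sq hc.le, ← Real.sqrt_mul (sq_nonneg c),
    Real.sqrt_sq hc.le]
  apply Real.sqrt_lt_sqrt (sq_nonneg w)
  have : c ^ 2 * (1 + w ^ 2 / c ^ 2) = c ^ 2 + w ^ 2 := by field_simp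
  rw [this]
  nlinarith

lemma phi_phiInv {c : ℝ} (hc : 0 < c) (w : ℝ) : phi c (phiInv c w) = w := by
  unfold phi phiInv
  have hp := phiInv_aux c w
  have hs := Real.sq_sqrt hp.le
  have hs0 := Real.sqrt_pos.2 hp
  have : 1 - (w / Real.sqrt (1 + w ^ 2 / c ^ 2)) ^ 2 / c ^ 2
      = (1 / Real.sqrt (1 + w ^ 2 / c ^ 2)) ^ 2 := by
    rw [div_pow, div_pow, hs]
    field_simp
    ring
  rw [this, Real.sqrt_sq (by positivity)]
  field_simp

lemma clamp_lemma {R w w' : ℝ} (hR : 0 < R) (h : w ≤ w') :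
    0 ≤ max (-R) (min R w') - max (-R) (min R w) ∧
      max (-R) (min R w') - max (-R) (min R w) ≤ w' - w := by
  rcases max_cases (-R) (min R w') with ⟨e1, h1⟩ | ⟨e1, h1⟩ <;>
  rcases max_cases (-R) (min R w) with ⟨e2, h2⟩ | ⟨e2, h2⟩ <;>
  rcases min_cases R w' with ⟨e3, h3⟩ | ⟨e3, h3⟩ <;>
  rcases min_cases R w with ⟨e4, h4⟩ | ⟨e4, h4⟩ <;>
  constructor <;> linarith

lemma phiInv_trunc {c : ℝ} (hc : 0 < c) {R : ℝ} (hR : 0 < R) :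
    ∃ (F : ℝ → ℝ) (m : ℝ), 0 < m ∧ m ≤ 1 ∧ Continuous F ∧
      (∀ w w', ∃ θ, m ≤ θ ∧ θ ≤ 1 ∧ F w' - F w = θ * (w' - w)) ∧
      ∀ w, |w| ≤ R → F w = phiInv c w := by
  set m := 1 / (Real.sqrt (1 + R ^ 2 / c ^ 2)) ^ 3 with hm
  have hS1 : ∀ w : ℝ, 1 ≤ Real.sqrt (1 + w ^ 2 / c ^ 2) := fun w => by
    rw [Real.one_le_sqrt]
    have : 0 ≤ w ^ 2 / c ^ 2 := by positivity
    linarith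
  have hd1 : ∀ w : ℝ, 1 / (Real.sqrt (1 + w ^ 2 / c ^ 2)) ^ 3 ≤ 1 := fun w => by
    rw [div_le_one (by have := hS1 w; positivity)]
    exact one_le_pow₀ (hS1 w)
  have hm0 : 0 < m := by have := hS1 R; positivity
  have hdm : ∀ w : ℝ, |w| ≤ R → m ≤ 1 / (Real.sqrt (1 + w ^ 2 / c ^ 2)) ^ 3 := fun w hw => by
    have h1 : w ^ 2 ≤ R ^ 2 := sq_le_sq' (by linarith [(abs_le.1 hw).1]) (abs_le.1 hw).2
    have := hS1 w
    apply one_div_le_one_div_of_le (by positivity)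
    gcongr
  have hslope0 : ∀ w w', |w| ≤ R → |w'| ≤ R → w < w' →
      ∃ θ, m ≤ θ ∧ θ ≤ 1 ∧ phiInv c w' - phiInv c w = θ * (w' - w) := by
    intro w w' hw hw' hlt
    obtain ⟨ξ, hξ, e⟩ := exists_hasDerivAt_eq_slope (phiInv c) _ hlt
      (fun x _ => (phiInv_hasDerivAt c x).continuousAt.continuousWithinAt)
      (fun x _ => phiInv_hasDerivAt c x)
    refine ⟨_, hdm ξ ?_, hd1 ξ, ?_⟩
    · rw [abs_le] at *; constructor <;> linarith [hξ.1, hξ.2]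
    · rw [e, div_mul_cancel₀ _ (by linarith)]
  set cl : ℝ → ℝ := fun w => max (-R) (min R w) with hcl
  have hclR : ∀ w, |cl w| ≤ R := fun w => by
    rw [abs_le]
    exact ⟨le_max_left _ _, max_le (by linarith) (min_le_left _ _)⟩
  have hclm : ∀ w w', w ≤ w' → 0 ≤ cl w' - cl w ∧ cl w' - cl w ≤ w' - w := fun w w' h => by
    exact clamp_lemma hR h
  set F : ℝ → ℝ := fun w => phiInv c (cl w) + m * (w - cl w) with hF
  have hslope1 : ∀ w w', w < w' → ∃ θ, m ≤ θ ∧ θ ≤ 1 ∧ F w' - F w = θ * (w' - w) := by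
    intro w w' hlt
    obtain ⟨hc0, hc1⟩ := hclm w w' hlt.le
    obtain ⟨θ, hθ, hθ1, e⟩ : ∃ θ, m ≤ θ ∧ θ ≤ 1 ∧
        phiInv c (cl w') - phiInv c (cl w) = θ * (cl w' - cl w) := by
      rcases hc0.eq_or_lt with h | h
      · exact ⟨m, le_rfl, hd1 R, by rw [show cl w' = cl w by linarith]; ring⟩
      · exact hslope0 _ _ (hclR w) (hclR w') (by linarith)
    have hw : 0 < w' - w := by linarith
    have key : F w' - F w = θ * (cl w' - cl w) + m * ((w' - w) - (cl w' - cl w)) := by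
      simp only [hF]; linarith
    refine ⟨(F w' - F w) / (w' - w), ?_, ?_, (div_mul_cancel₀ _ hw.ne').symm⟩
    · rw [le_div_iff₀ hw, key]; nlinarith
    · rw [div_le_iff₀ hw, key]
      nlinarith [hd1 R]
  refine ⟨F, m, hm0, hd1 R, ?_, ?_, ?_⟩
  · have c1 : Continuous (phiInv c) := continuous_iff_continuousAt.2 fun x =>
      (phiInv_hasDerivAt c x).continuousAt
    have c2 : Continuous cl := by fun_prop
    fun_prop
  · intro w w'
    rcases lt_trichotomy w w' with h | h | h
    · exact hslope1 w w' h
    · exact ⟨1, hd1 R, le_rfl, by rw [h]; ring⟩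
    · obtain ⟨θ, h1, h2, e⟩ := hslope1 w' w h
      exact ⟨θ, h1, h2, by linarith⟩
  · intro w hw
    have : cl w = w := by
      rw [abs_le] at hw
      simp only [hcl]
      rw [min_eq_right hw.2, max_eq_right hw.1]
    simp only [hF, this]; ring

lemma apriori {c T a b m P : ℝ} (hT : 0 < T) (hc : 0 < c) (ha : 0 < a) (hb : 0 < b) (hm : 0 < m)
    {F : ℝ → ℝ} (hF0 : F 0 = 0)
    (hF1 : ∀ w w', ∃ θ, m ≤ θ ∧ θ ≤ 1 ∧ F w' - F w = θ * (w' - w))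
    {p u x w : ℝ → ℝ} (hP : ∀ t, |p t| ≤ P) (hu : InE c T u)
    (hxp : Function.Periodic x T) (hwp : Function.Periodic w T)
    (d : ∀ t, HasDerivAt x (F (w t)) t)
    (e : ∀ t, HasDerivAt w ((p t - b * Real.sin (u t) - b * u t) + b * x t - a * F (w t)) t)
    {C : ℝ} (hC : C = (P + b) / b + c * T) (t : ℝ) :
    |w t| ≤ (P + b + b * (c * T) + b * C) * T + 2 * a * C := by
  have hbC : b * C = P + b + b * (c * T) := by rw [hC]; field_simp
  have hu0 : ∀ t, |u t - u 0| ≤ c * T := by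
    intro t
    obtain ⟨t', ht', e'⟩ := hu.1.exists_mem_Ico₀ hT t
    rw [e']
    refine (hu.abs_sub t' 0).trans ?_
    apply mul_le_mul_of_nonneg_left _ hc.le
    rw [sub_zero, abs_of_nonneg ht'.1]; exact ht'.2.le
  have hpb : ∀ t, |p t - b * Real.sin (u t)| ≤ P + b := by
    intro t
    have h1 := abs_le.1 (hP t)
    have h2 := Real.sin_le_one (u t)
    have h3 := Real.neg_one_le_sin (u t)
    rw [abs_le]; constructor <;> nlinarith
  have hux : ∀ t, |b * (u t - u 0)| ≤ b * (c * T) := by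
    intro t
    rw [abs_mul, abs_of_pos hb]
    exact mul_le_mul_of_nonneg_left (hu0 t) hb.le
  have k1 : ∀ t : ℝ, HasDerivAt (fun _ : ℝ => u 0) (F ((fun _ : ℝ => (0:ℝ)) t)) t := by
    intro t; simp only [hF0]; exact hasDerivAt_const _ _
  have k2 : ∀ t : ℝ, HasDerivAt (fun _ : ℝ => (0:ℝ)) ((fun _ : ℝ => - (b * u 0)) t +
      b * ((fun _ : ℝ => u 0) t) - a * F ((fun _ : ℝ => (0:ℝ)) t)) t := by
    intro t; simp only [hF0]
    have := hasDerivAt_const t (0:ℝ)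
    exact this.congr_deriv (by ring)
  have hcp : Function.Periodic (fun _ : ℝ => u 0) T := fun _ => rfl
  have up : ∀ t, x t ≤ u 0 + C := fun t =>
    resolvent_comparison hT hb hm hF1 hcp hxp k1 k2 d e (ε := C)
      (fun t => by
        have h1 := abs_le.1 (hpb t)
        have h2 := abs_le.1 (hux t)
        linarith) t
  have lo : ∀ t, u 0 ≤ x t + C := fun t =>
    resolvent_comparison hT hb hm hF1 hxp hcp d e k1 k2 (ε := C)
      (fun t => by
        have h1 := abs_le.1 (hpb t)
        have h2 := abs_le.1 (hux t)
        linarith) t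
  have hB : ∀ t, |(p t - b * Real.sin (u t) - b * u t) + b * x t| ≤
      P + b + b * (c * T) + b * C := by
    intro t
    have h1 := abs_le.1 (hpb t)
    have h2 := abs_le.1 (hux t)
    have h3 := mul_le_mul_of_nonneg_left (up t) hb.le
    have h4 := mul_le_mul_of_nonneg_left (lo t) hb.le
    rw [abs_le]; constructor <;> linarith
  obtain ⟨t0, _, h0⟩ := exists_hasDerivAt_eq_zero (f := x) (f' := fun t => F (w t)) hT
    (fun t _ => (d t).continuousAt.continuousWithinAt) (by have := hxp 0; rw [zero_add] at this; exact this.symm)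
    (fun t _ => d t)
  have hw0 : w t0 = 0 := by
    obtain ⟨θ, h1, _, h2⟩ := hF1 0 (w t0)
    rw [hF0, h0, sub_zero, sub_zero] at h2
    rcases mul_eq_zero.1 h2.symm with h | h
    · linarith
    · exact h
  obtain ⟨t', ht', e'⟩ := hwp.exists_mem_Ico hT t t0
  rw [e']
  have hy : ∀ t, HasDerivAt (fun t => w t + a * x t)
      ((p t - b * Real.sin (u t) - b * u t) + b * x t) t := fun t => by
    refine ((e t).add ((d t).const_mul a)).congr_deriv ?_
    ring
  have hmv := Convex.norm_image_sub_le_of_norm_hasDerivWithin_le (s := Set.univ)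
    (f := fun t => w t + a * x t) (fun t _ => (hy t).hasDerivWithinAt)
    (fun t _ => by rw [Real.norm_eq_abs]; exact hB t) convex_univ (Set.mem_univ t0) (Set.mem_univ t')
  rw [Real.norm_eq_abs, Real.norm_eq_abs, hw0] at hmv
  have hB0 : 0 ≤ P + b + b * (c * T) + b * C := (abs_nonneg _).trans (hB 0)
  have hmv2 := hmv.trans (mul_le_mul_of_nonneg_left (show |t' - t0| ≤ T by
    rw [abs_le]; constructor <;> linarith [ht'.1, ht'.2]) hB0)
  have h1 := abs_le.1 hmv2
  have h3 := mul_le_mul_of_nonneg_left (up t') ha.le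
  have h4 := mul_le_mul_of_nonneg_left (lo t') ha.le
  have h5 := mul_le_mul_of_nonneg_left (up t0) ha.le
  have h6 := mul_le_mul_of_nonneg_left (lo t0) ha.le
  rw [abs_le]; constructor <;> linarith

lemma pend_exists {c a b T κ s : ℝ} (hc : 0 < c) (ha : 0 < a) (hb : 0 < b) (hT : 0 < T)
    (hκ : ∀ v, InE c T v → (∫ t in (0:ℝ)..T, v t) = 0 → κ ≤ ∫ t in (0:ℝ)..T, Real.cos (v t))
    {p : ℝ → ℝ} (hpc : Continuous p) (hpp : Function.Periodic p T)
    (hpi : (∫ t in (0:ℝ)..T, p t) = s * T) (hs : |s| * T ≤ b * κ) :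
    ∃ x, IsPendSol c a b T p x := by
  obtain ⟨P, hP⟩ := periodic_bdd hT hpc hpp
  have hP0 : 0 ≤ P := (abs_nonneg _).trans (hP 0)
  set C := (P + b) / b + c * T with hC
  have hC0 : 0 < C := by positivity
  set R := (P + b + b * (c * T) + b * C) * T + 2 * a * C with hR
  have hR0 : 0 < R := by positivity
  obtain ⟨F, m, hm, hm1, hFc, hF1, hFR⟩ := phiInv_trunc hc hR0
  have hF0 : F 0 = 0 := by
    rw [hFR 0 (by simpa using hR0.le)]; simp [phiInv]
  have ex : ∀ u, ∃ xw : (ℝ → ℝ) × (ℝ → ℝ), InE c T u →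
      Function.Periodic xw.1 T ∧ Continuous xw.2 ∧ Function.Periodic xw.2 T ∧
      (∀ t, HasDerivAt xw.1 (F (xw.2 t)) t) ∧
      (∀ t, HasDerivAt xw.2 ((p t - b * Real.sin (u t) - b * u t) + b * xw.1 t
        - a * F (xw.2 t)) t) := by
    intro u
    by_cases hu : InE c T u
    · have huc := hu.continuous
      obtain ⟨x, w, _, h2, h3, h4, h5, h6⟩ := resolvent_exists hT ha hb hm hm1 hFc hF1
        (h := fun t => p t - b * Real.sin (u t) - b * u t) (by fun_prop)
        (fun t => by simp only [hpp t, hu.1 t])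
      exact ⟨(x, w), fun _ => ⟨h2, h3, h4, h5, h6⟩⟩
    · exact ⟨(0, 0), fun h => absurd h hu⟩
  choose xw hxw using ex
  have hwR : ∀ u, InE c T u → ∀ t, |(xw u).2 t| ≤ R := by
    intro u hu t
    obtain ⟨h2, h3, h4, h5, h6⟩ := hxw u hu
    exact apriori hT hc ha hb hm hF0 hF1 hP hu h2 h4 h5 h6 hC t
  have hd : ∀ u, InE c T u → ∀ t, HasDerivAt (xw u).1 (phiInv c ((xw u).2 t)) t := by
    intro u hu t
    rw [← hFR _ (hwR u hu t)]
    exact (hxw u hu).2.2.2.1 t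
  have hG : ∀ u, InE c T u → InE c T (xw u).1 := by
    intro u hu
    refine ⟨(hxw u hu).1, fun r t => ?_⟩
    have hmv := Convex.norm_image_sub_le_of_norm_hasDerivWithin_le (s := Set.univ)
      (f := (xw u).1) (fun t _ => (hd u hu t).hasDerivWithinAt)
      (fun t _ => by rw [Real.norm_eq_abs]; exact (phiInv_abs_lt hc _).le) convex_univ
      (Set.mem_univ t) (Set.mem_univ r)
    rw [Real.norm_eq_abs, Real.norm_eq_abs] at hmv
    linarith [(abs_le.1 hmv).2]
  have hincr : ∀ y z : ℝ, y ≤ z → Real.sin y + y ≤ Real.sin z + z := by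
    intro y z h
    have : |Real.sin y - Real.sin z| ≤ |y - z| := by
      simpa [Real.dist_eq] using Real.lipschitzWith_sin.dist_le_mul y z
    rw [abs_of_nonpos (sub_nonpos.2 h)] at this
    linarith [(abs_le.1 this).2]
  have hmono : ∀ u v, InE c T u → InE c T v → ∀ ε : ℝ, 0 ≤ ε → (∀ t, u t ≤ v t + ε) →
      ∀ t, (xw u).1 t ≤ (xw v).1 t + 2 * ε := by
    intro u v hu hv ε hε h t
    obtain ⟨a2, a3, a4, a5, a6⟩ := hxw u hu
    obtain ⟨b2, b3, b4, b5, b6⟩ := hxw v hv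
    refine resolvent_comparison hT hb hm hF1 b2 a2 b5 b6 a5 a6 (fun t => ?_) t
    have h1 := hincr _ _ (h t)
    have h2 : |Real.sin (v t + ε) - Real.sin (v t)| ≤ |v t + ε - v t| := by
      simpa [Real.dist_eq] using Real.lipschitzWith_sin.dist_le_mul (v t + ε) (v t)
    rw [add_sub_cancel_left, abs_of_nonneg hε] at h2
    have h3 : Real.sin (u t) + u t ≤ Real.sin (v t) + v t + 2 * ε := by
      linarith [(abs_le.1 h2).2]
    have := mul_le_mul_of_nonneg_left h3 hb.le
    linarith
  have hshift : ∀ u v, InE c T u → InE c T v → ∀ n : ℕ, (∀ t, u t ≤ v t + n * (2 * π)) →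
      ∀ t, (xw u).1 t ≤ (xw v).1 t + n * (2 * π) := by
    intro u v hu hv n h t
    obtain ⟨a2, a3, a4, a5, a6⟩ := hxw u hu
    obtain ⟨b2, b3, b4, b5, b6⟩ := hxw v hv
    refine resolvent_comparison hT hb hm hF1 b2 a2 b5 b6 a5 a6 (fun t => ?_) t
    have h1 := hincr _ _ (h t)
    rw [Real.sin_add_nat_mul_two_pi] at h1
    have := mul_le_mul_of_nonneg_left h1 hb.le
    linarith
  have hmean : ∀ u, InE c T u → b * (∫ t in (0:ℝ)..T, (xw u).1 t) =
      b * (∫ t in (0:ℝ)..T, u t) + b * (∫ t in (0:ℝ)..T, Real.sin (u t)) - s * T := by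
    intro u hu
    obtain ⟨a2, a3, a4, a5, a6⟩ := hxw u hu
    have huc := hu.continuous
    have hxc := (hG u hu).continuous
    have hy : ∀ t, HasDerivAt (fun t => (xw u).2 t + a * (xw u).1 t)
        ((p t - b * Real.sin (u t) - b * u t) + b * (xw u).1 t) t := fun t => by
      refine ((a6 t).add ((a5 t).const_mul a)).congr_deriv ?_
      ring
    have hintg := intervalIntegral.integral_eq_sub_of_hasDerivAt (a := 0) (b := T)
      (fun t _ => hy t) (Continuous.intervalIntegrable (by fun_prop) _ _)
    have e1 := a2 0
    have e2 := a4 0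
    rw [zero_add] at e1 e2
    rw [e1, e2, sub_self] at hintg
    rw [intervalIntegral.integral_add (Continuous.intervalIntegrable (by fun_prop) _ _)
        (Continuous.intervalIntegrable (by fun_prop) _ _),
      intervalIntegral.integral_sub (Continuous.intervalIntegrable (by fun_prop) _ _)
        (Continuous.intervalIntegrable (by fun_prop) _ _),
      intervalIntegral.integral_sub (Continuous.intervalIntegrable (by fun_prop) _ _)
        (Continuous.intervalIntegrable (by fun_prop) _ _), hpi,
      intervalIntegral.integral_const_mul, intervalIntegral.integral_const_mul,
      intervalIntegral.integral_const_mul] at hintg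
    linarith
  set orb : ℕ → ℝ → ℝ := fun n => (fun u => (xw u).1)^[n] (fun _ => π) with horb
  have horbS : ∀ n, orb (n + 1) = (xw (orb n)).1 := fun n => by
    simp only [horb, Function.iterate_succ_apply']
  have hpi0 := Real.pi_pos
  have horbE : ∀ n, InE c T (orb n) := by
    intro n
    induction n with
    | zero => exact ⟨fun _ => rfl, fun r t => by
        have : 0 ≤ c * |r - t| := by positivity
        simp only [horb, Function.iterate_zero, id]; linarith⟩
    | succ n ih => rw [horbS]; exact hG _ ih
  have horbM : ∀ n, ∃ μ, (∫ t in (0:ℝ)..T, orb n t) = T * μ ∧ π / 2 ≤ μ ∧ μ ≤ 3 * π / 2 := by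
    intro n
    induction n with
    | zero => exact ⟨π, by simp [horb], by linarith, by linarith⟩
    | succ n ih =>
      obtain ⟨μ, h1, h2, h3⟩ := ih
      have hm1 := hmean _ (horbE n)
      rw [← horbS, h1] at hm1
      obtain ⟨k1, k2⟩ := sin_integral_bounds hT hκ (horbE n) h1
      rw [abs_of_nonneg (by linarith)] at k1
      rw [abs_of_nonpos (by linarith)] at k2
      have k1' := mul_le_mul_of_nonneg_left k1 hb.le
      have k2' := mul_le_mul_of_nonneg_left k2 hb.le
      have s1 : s * T ≤ |s| * T := mul_le_mul_of_nonneg_right (le_abs_self s) hT.le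
      have s2 : -|s| * T ≤ s * T := mul_le_mul_of_nonneg_right (neg_abs_le s) hT.le
      refine ⟨(∫ t in (0:ℝ)..T, orb (n + 1) t) / T, by field_simp, ?_, ?_⟩
      · rw [le_div_iff₀ hT]
        refine le_of_mul_le_mul_left ?_ hb
        rw [hm1]; linarith
      · rw [div_le_iff₀ hT]
        refine le_of_mul_le_mul_left ?_ hb
        rw [hm1]; linarith
  have hK : ∀ n t, |orb n t| ≤ 3 * π / 2 + c * T / 4 := by
    intro n t
    obtain ⟨μ, h1, h2, h3⟩ := horbM n
    have hu := horbE n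
    have hvE : InE c T (fun t => orb n t - μ) :=
      ⟨fun t => by simp only [hu.1 t], fun s t => by have := hu.2 s t; linarith⟩
    have hv0 : (∫ t in (0:ℝ)..T, (orb n t - μ)) = 0 := by
      rw [intervalIntegral.integral_sub (hu.continuous.intervalIntegrable _ _) (by simp), h1]
      simp
    have := abs_le.1 (hvE.sup_bound hT hv0 t)
    rw [abs_le]; constructor <;> linarith [this.1, this.2]
  obtain ⟨Z, hZ, hGZ⟩ := fix_of_orbit hT (fun u => (xw u).1) hG hmono hshift orb horbE horbS hK
  obtain ⟨a2, a3, a4, a5, a6⟩ := hxw Z hZ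
  have hdZ := hd Z hZ
  have hZc := hZ.continuous
  rw [hGZ] at hdZ a6
  have hder : deriv Z = fun t => phiInv c ((xw Z).2 t) := funext fun t => (hdZ t).deriv
  have hpc1 : Continuous (phiInv c) := continuous_iff_continuousAt.2 fun x =>
      (phiInv_hasDerivAt c x).continuousAt
  have hphi : (fun t => phi c (deriv Z t)) = (xw Z).2 := by
    funext t; rw [hder]; exact phi_phiInv hc _
  have hderw : deriv (xw Z).2 = fun t =>
      (p t - b * Real.sin (Z t) - b * Z t) + b * Z t - a * F ((xw Z).2 t) :=
    funext fun t => (a6 t).deriv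
  refine ⟨Z, hZ.1, ?_, ?_, ?_, ?_⟩
  · rw [contDiff_one_iff_deriv]
    refine ⟨fun t => (hdZ t).differentiableAt, ?_⟩
    rw [hder]; exact hpc1.comp a3
  · intro t; rw [hder]; exact phiInv_abs_lt hc _
  · rw [hphi, contDiff_one_iff_deriv]
    refine ⟨fun t => (a6 t).differentiableAt, ?_⟩
    rw [hderw]; fun_prop
  · intro t
    rw [hphi, hderw, hder]
    simp only
    rw [hFR _ (hwR Z hZ t)]
    ring

/-- if `ψ(δ) > 0` for some `δ ∈ (0, π/2)` (with `k = T/(2√3)`, `ck < π`),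
then `0` is an interior point of `I(p₀)` for every admissible forcing `p₀`. -/
theorem zero_interior_solvSet_of_psi_pos (c a b T : ℝ) (hc : 0 < c) (ha : 0 < a) (hb : 0 < b)
    (hT : 0 < T) (hk : c * (T / (2 * Real.sqrt 3)) < Real.pi)
    (hψ : ∃ δ : ℝ, δ ∈ Set.Ioo 0 (Real.pi / 2) ∧
      0 < 2 * δ * Real.cos δ + (c * T - 2 * δ) * Real.cos (c * (T / (2 * Real.sqrt 3)))) :
    ∀ p₀ : ℝ → ℝ, Continuous p₀ → Function.Periodic p₀ T →
      (∫ t in (0:ℝ)..T, p₀ t) = 0 →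
      ∃ ε : ℝ, 0 < ε ∧ Set.Icc (-ε) ε ⊆ solvSet c a b T p₀ := by
  intro p₀ hpc hpp hp0
  obtain ⟨δ, hδ, hψ⟩ := hψ
  obtain ⟨κ, hκ0, hκ⟩ := cos_integral_lower hc hT hk hδ hψ
  refine ⟨b * κ / T, by positivity, fun s hs => ?_⟩
  refine pend_exists (s := s) hc ha hb hT hκ (by fun_prop) (fun t => by simp only [hpp t]) ?_ ?_
  · rw [intervalIntegral.integral_add (hpc.intervalIntegrable _ _) (by simp), hp0]
    simp; ring
  · rw [← le_div_iff₀ hT, abs_le]; exact hs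
end
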